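/- Let d ≥ 1 be an integer and let r be a prime power. For every family of r(d+1) hyperplanes in ℝ^d in general position, there exists a partition of the family into r subfamilies of d+1 hyperplanes each, and a point p ∈ ℝ^d, such that p belongs to the induced simplex of every one of the r subfamilies. -/

import Mathlib

/-- The hyperplane `{x ∈ ℝ^d : ⟨v, x⟩ = c}`. -/
def hplaneSet (d : ℕ) (v : Fin d → ℝ) (c : ℝ) : Set (Fin d → ℝ) :=
  {x | ∑ m, v m * x m = c}

/-- An indexed family of hyperplanes `⟨v i, x⟩ = c i` in `ℝ^d` is in general position
if the normal vectors of any `d` of them are linearly independent and no `d+1` of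
them have a common point. -/
def InGeneralPosition (d : ℕ) {ι : Type*} (v : ι → Fin d → ℝ) (c : ι → ℝ) : Prop :=
  (∀ g : Fin d → ι, Function.Injective g →
    LinearIndependent ℝ (fun m => v (g m))) ∧
  (∀ g : Fin (d + 1) → ι, Function.Injective g →
    ¬∃ x : Fin d → ℝ, ∀ m, x ∈ hplaneSet d (v (g m)) (c (g m)))

/-- The simplex induced by `d+1` hyperplanes in general position: the convex hull of
the `d+1` points obtained as the common point of all hyperplanes but one. -/
noncomputable def inducedSimplex (d : ℕ) (v : Fin (d + 1) → Fin d → ℝ)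
    (c : Fin (d + 1) → ℝ) : Set (Fin d → ℝ) :=
  convexHull ℝ
    {x | ∃ k : Fin (d + 1), ∀ i : Fin (d + 1), i ≠ k → x ∈ hplaneSet d (v i) (c i)}


namespace DT

/-! ### Ordered chains -/

section chains
variable {F : Type*} [CommRing F] {V : Type*}

/-- prepend a vertex -/
noncomputable def consL (F : Type*) [CommRing F] {V : Type*} (v : V) : (List V →₀ F) →ₗ[F] (List V →₀ F) :=
  Finsupp.lmapDomain F F (List.cons v)

noncomputable def bdL (F : Type*) [CommRing F] {V : Type*} : List V → (List V →₀ F)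
  | [] => 0
  | v :: l => Finsupp.single l 1 - consL F v (bdL F l)

/-- boundary operator -/
noncomputable def bd (F : Type*) [CommRing F] {V : Type*} : (List V →₀ F) →ₗ[F] (List V →₀ F) :=
  Finsupp.linearCombination F (bdL F)

/-- induced action of a self-map of the vertex set -/
noncomputable def act (F : Type*) [CommRing F] {V : Type*} (f : V → V) : (List V →₀ F) →ₗ[F] (List V →₀ F) :=
  Finsupp.lmapDomain F F (List.map f)

@[simp] lemma consL_single (v : V) (l : List V) (c : F) :
    consL F v (Finsupp.single l c) = Finsupp.single (v :: l) c := by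
  simp [consL, Finsupp.lmapDomain_apply, Finsupp.mapDomain_single]

@[simp] lemma act_single (f : V → V) (l : List V) (c : F) :
    act F f (Finsupp.single l c) = Finsupp.single (l.map f) c := by
  simp [act, Finsupp.lmapDomain_apply, Finsupp.mapDomain_single]

lemma bd_single (l : List V) : bd F (Finsupp.single l 1) = bdL F l := by
  simp [bd]

lemma hom_ext {M : Type*} [AddCommMonoid M] [Module F M] {f g : (List V →₀ F) →ₗ[F] M}
    (h : ∀ l, f (Finsupp.single l 1) = g (Finsupp.single l 1)) : f = g := by
  apply Finsupp.lhom_ext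
  intro l c
  have : (Finsupp.single l c : List V →₀ F) = c • Finsupp.single l 1 := by simp
  rw [this, map_smul, map_smul, h]

lemma bd_cons (v : V) (x : List V →₀ F) : bd F (consL F v x) = x - consL F v (bd F x) := by
  have : (bd F) ∘ₗ (consL F v) = LinearMap.id - (consL F v) ∘ₗ (bd F) := by
    apply hom_ext
    intro l
    simp [bd_single, bdL]
  simpa using LinearMap.congr_fun this x

lemma bd_bd (x : List V →₀ F) : bd F (bd F x) = 0 := by
  have : (bd F) ∘ₗ (bd F) = (0 : (List V →₀ F) →ₗ[F] (List V →₀ F)) := by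
    apply hom_ext
    intro l
    simp only [LinearMap.comp_apply, bd_single, LinearMap.zero_apply]
    induction l with
    | nil => simp [bdL]
    | cons v l ih => simp [bdL, bd_cons, bd_single, ih]
  simpa using LinearMap.congr_fun this x

lemma act_cons (f : V → V) (v : V) (x : List V →₀ F) :
    act F f (consL F v x) = consL F (f v) (act F f x) := by
  have : (act F f) ∘ₗ (consL F v) = (consL F (f v)) ∘ₗ (act F f) := by
    apply hom_ext
    intro l
    simp
  simpa using LinearMap.congr_fun this x

lemma bd_act (f : V → V) (x : List V →₀ F) : bd F (act F f x) = act F f (bd F x) := by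
  have : (bd F) ∘ₗ (act F f) = (act F f) ∘ₗ (bd F) := by
    apply hom_ext
    intro l
    simp only [LinearMap.comp_apply, act_single, bd_single]
    induction l with
    | nil => simp [bdL]
    | cons v l ih => simp [bdL, act_cons, ih]
  simpa using LinearMap.congr_fun this x

lemma act_id : act F (id : V → V) = LinearMap.id := by
  apply hom_ext; intro l; simp

lemma act_comp (f g : V → V) : act F (f ∘ g) = act F f ∘ₗ act F g := by
  apply hom_ext; intro l; simp

/-- if the linear map sends every basis list of `S` into `T`, it maps `supported S` into `T` -/
lemma map_supported {M : Type*} [AddCommMonoid M] [Module F M] (f : (List V →₀ F) →ₗ[F] M)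
    {S : Set (List V)} {T : Submodule F M} (h : ∀ l ∈ S, f (Finsupp.single l 1) ∈ T)
    {x : List V →₀ F} (hx : x ∈ Finsupp.supported F F S) : f x ∈ T := by
  rw [Finsupp.supported_eq_span_single] at hx
  have : Submodule.span F ((fun i => Finsupp.single i (1 : F)) '' S) ≤ T.comap f := by
    rw [Submodule.span_le]
    rintro _ ⟨l, hl, rfl⟩
    exact h l hl
  exact this hx

lemma single_mem {S : Set (List V)} {l : List V} (h : l ∈ S) (c : F) :
    (Finsupp.single l c : List V →₀ F) ∈ Finsupp.supported F F S :=
  Finsupp.single_mem_supported F c h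

/-! exactness of the full simplex -/

lemma cone_exact {P : V → Prop} {v : V} (hv : P v) (j : ℕ) (c : List V →₀ F)
    (hc : c ∈ Finsupp.supported F F {l : List V | l.length = j ∧ ∀ w ∈ l, P w}) (hb : bd F c = 0) :
    ∃ b ∈ Finsupp.supported F F {l : List V | l.length = j + 1 ∧ ∀ w ∈ l, P w}, bd F b = c := by
  refine ⟨consL F v c, ?_, ?_⟩
  · refine map_supported (consL F v) ?_ hc
    rintro l ⟨h1, h2⟩
    rw [consL_single]
    refine single_mem ?_ _
    simp only [Set.mem_ofPred_eq, List.length_cons, h1, List.mem_cons, true_and]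
    rintro w (rfl | h)
    · exact hv
    · exact h2 _ h
  · rw [bd_cons, hb]; simp

end chains

section joins
variable {F : Type*} [CommRing F] {Lay G : Type*} [Fintype G] [DecidableEq Lay] [DecidableEq G] [Inhabited G]

/-- coloured chains on a list of layers -/
def KS (G : Type*) {Lay : Type*} (L : List Lay) (j : ℕ) : Set (List (Lay × G)) :=
  {l | (l.map Prod.fst).Sublist L ∧ l.length = j}

noncomputable def unconsFun {V : Type*} [DecidableEq V] (F : Type*) [CommRing F] (v : V) : List V → (List V →₀ F)
  | [] => 0
  | w :: l => if w = v then Finsupp.single l 1 else 0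

noncomputable def uncons {V : Type*} [DecidableEq V] (F : Type*) [CommRing F] (v : V) :
    (List V →₀ F) →ₗ[F] (List V →₀ F) :=
  Finsupp.linearCombination F (unconsFun F v)

lemma uncons_cons {V : Type*} [DecidableEq V] (v w : V) (x : List V →₀ F) :
    uncons F v (consL F w x) = if w = v then x else 0 := by
  have : (uncons F v) ∘ₗ (consL F w) = if w = v then LinearMap.id else 0 := by
    apply hom_ext
    intro l
    by_cases h : w = v <;> simp [uncons, unconsFun, h]
  have := LinearMap.congr_fun this x
  by_cases h : w = v <;> simpa [h] using this

lemma uncons_zero {V : Type*} [DecidableEq V] (v : V) {S : Set (List V)} (hS : ∀ l ∈ S, v ∉ l)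
    {x : List V →₀ F} (hx : x ∈ Finsupp.supported F F S) : uncons F v x = 0 := by
  have := map_supported (uncons F v) (T := ⊥) ?_ hx
  · simpa using this
  · intro l hl
    cases l with
    | nil => simp [uncons, unconsFun]
    | cons w l =>
      have : w ≠ v := by
        rintro rfl; exact hS _ hl (by simp)
      simp [uncons, unconsFun, this]

lemma KS_bd {L : List Lay} {j : ℕ} {c : List (Lay × G) →₀ F}
    (hc : c ∈ Finsupp.supported F F (KS G L (j+1))) : bd F c ∈ Finsupp.supported F F (KS G L j) := by
  have key : ∀ (l : List (Lay × G)), bdL F l ∈ Finsupp.supported F F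
      {l' : List (Lay × G) | l'.Sublist l ∧ l'.length + 1 = l.length} := by
    intro l
    induction l with
    | nil => simp [bdL]
    | cons v l ih =>
      refine Submodule.sub_mem _ (single_mem ?_ _) (map_supported _ ?_ ih)
      · simp
      · rintro l' ⟨h1, h2⟩
        rw [consL_single]
        refine single_mem ?_ _
        simp [h1, h2]
  refine map_supported (bd F) ?_ hc
  rintro l ⟨h1, h2⟩
  rw [bd_single]
  refine Finsupp.supported_mono ?_ (key l)
  rintro l' ⟨h3, h4⟩
  exact ⟨(h3.map _).trans h1, by omega⟩

lemma KS_exact (L : List Lay) (hL : L.Nodup) : ∀ (j : ℕ) (c : List (Lay × G) →₀ F)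
    (_ : c ∈ Finsupp.supported F F (KS G L j)) (_ : bd F c = 0) (_ : j < L.length),
    ∃ b ∈ Finsupp.supported F F (KS G L (j+1)), bd F b = c := by
  induction L with
  | nil => intro j c _ _ h; simp at h
  | cons a L ih =>
    have ha : a ∉ L := (List.nodup_cons.1 hL).1
    have ih := ih (List.nodup_cons.1 hL).2
    intro j c hc hb hj
    have hnot : ∀ j (x : G), ∀ l ∈ KS G L j, (a, x) ∉ l := by
      rintro j x l ⟨h1, -⟩ hm
      exact ha (h1.subset (List.mem_map_of_mem (f := Prod.fst) hm))
    have hcons : ∀ (x : G) (j : ℕ) (y : List (Lay × G) →₀ F), y ∈ Finsupp.supported F F (KS G L j) →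
        consL F (a, x) y ∈ Finsupp.supported F F (KS G (a :: L) (j+1)) := by
      intro x j y hy
      refine map_supported (consL F (a, x)) ?_ hy
      rintro l ⟨h1, h2⟩
      rw [consL_single]
      have hm : ((a, x) :: l) ∈ KS G (a :: L) (j+1) := ⟨by simpa using h1, by simp [h2]⟩
      exact single_mem hm _
    have hmono : ∀ j, Finsupp.supported F F (KS G L j) ≤ Finsupp.supported F F (KS G (a :: L) j) := by
      intro j
      refine Finsupp.supported_mono ?_
      rintro l ⟨h1, h2⟩
      exact ⟨h1.cons a, h2⟩
    -- decomposition
    set c0 : List (Lay × G) →₀ F := c - ∑ x : G, consL F (a, x) (uncons F (a, x) c) with hc0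
    have hc0mem : c0 ∈ Finsupp.supported F F (KS G L j) := by
      have := map_supported (LinearMap.id - ∑ x : G, consL F (a, x) ∘ₗ uncons F (a, x))
        (T := Finsupp.supported F F (KS G L j)) ?_ hc
      · simpa [hc0] using this
      · rintro l ⟨h1, h2⟩
        cases l with
        | nil =>
          simp only [LinearMap.sub_apply, LinearMap.id_apply, LinearMap.sum_apply, LinearMap.comp_apply]
          simp only [uncons, Finsupp.linearCombination_single, unconsFun]
          simp only [smul_zero, map_zero, Finset.sum_const_zero, sub_zero]
          have hm : ([] : List (Lay × G)) ∈ KS G L j := ⟨by simp, h2⟩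
          exact single_mem hm _
        | cons w l =>
          obtain ⟨w1, w2⟩ := w
          simp only [LinearMap.sub_apply, LinearMap.id_apply, LinearMap.sum_apply, LinearMap.comp_apply]
          simp only [uncons, Finsupp.linearCombination_single, unconsFun]
          by_cases hw : w1 = a
          · subst hw
            have : ∑ x : G, (consL F (w1, x)) ((1:F) • if (w1, w2) = (w1, x) then Finsupp.single l (1:F) else 0)
                = Finsupp.single ((w1, w2) :: l) 1 := by
              rw [Finset.sum_eq_single w2]
              · simp
              · intro b _ hb
                have : ¬ (w2 = b) := fun h => hb h.symm
                simp [this]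
              · simp
            rw [this]; simp
          · simp only [Prod.mk.injEq, hw, false_and, if_false, smul_zero, map_zero, Finset.sum_const_zero, sub_zero]
            have hm : ((w1, w2) :: l) ∈ KS G L j := by
              refine ⟨?_, h2⟩
              simp only [List.map_cons] at h1 ⊢
              cases h1 with
              | cons _ h => exact h
              | cons_cons _ h => exact absurd rfl hw
            exact single_mem hm _
    have hdec : c = c0 + ∑ x : G, consL F (a, x) (uncons F (a, x) c) := by
      rw [hc0]; abel
    -- c0 part
    have hcc0 : (∀ x : G, uncons F (a, x) c = 0) → c = c0 := fun h => by rw [hc0]; simp [h]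
    clear_value c0
    have hbc := hb
    rw [hdec, map_add, map_sum] at hbc
    simp only [bd_cons] at hbc
    rw [Finset.sum_sub_distrib] at hbc
    cases j with
    | zero =>
      -- c is a multiple of the empty list
      have hux : ∀ x : G, uncons F (a, x) c = 0 := by
        intro x
        refine uncons_zero (S := KS G (a :: L) 0) (a, x) ?_ hc
        rintro l ⟨-, h2⟩
        rw [List.length_eq_zero_iff] at h2
        simp [h2]
      have hc' : c = c0 := hcc0 hux
      refine ⟨consL F (a, default) c0, hcons _ _ _ hc0mem, ?_⟩
      rw [bd_cons, ← hc', hb]; simp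
    | succ j =>
      have hux : ∀ x : G, uncons F (a, x) c ∈ Finsupp.supported F F (KS G L j) := by
        intro x
        refine map_supported (uncons F (a, x)) ?_ hc
        rintro l ⟨h1, h2⟩
        cases l with
        | nil => simp [uncons, unconsFun]
        | cons w l =>
          obtain ⟨w1, w2⟩ := w
          simp only [uncons, Finsupp.linearCombination_single, unconsFun, one_smul]
          split_ifs with h
          · obtain ⟨rfl, rfl⟩ := Prod.mk.injEq _ _ _ _ ▸ h
            have hm : l ∈ KS G L j := ⟨by simpa using h1, by simpa using h2⟩
            exact single_mem hm _
          · simp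
      have hbux : ∀ x : G, bd F (uncons F (a, x) c) = 0 := by
        intro x
        have h := congrArg (uncons F (a, x)) hbc
        rw [map_add, map_sub, map_sum, map_sum, map_zero] at h
        have e1 : uncons F (a, x) (bd F c0) = 0 := uncons_zero _ (hnot j x) (KS_bd hc0mem)
        have e2 : ∀ y : G, uncons F (a, x) (uncons F (a, y) c) = 0 := fun y =>
          uncons_zero _ (hnot j x) (hux y)
        simp only [e1, e2, uncons_cons, Finset.sum_const_zero, zero_add, zero_sub, neg_eq_zero] at h
        rw [Finset.sum_eq_single x] at h
        · simpa using h
        · intro y _ hy; simp [hy]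
        · simp
      choose b hbm hbb using fun x => ih j (uncons F (a, x) c) (hux x) (hbux x) (by simpa using hj)
      simp only [hbux, map_zero, Finset.sum_const_zero, sub_zero] at hbc
      refine ⟨consL F (a, default) c0 + ∑ x : G, (consL F (a, default) (b x) - consL F (a, x) (b x)), ?_, ?_⟩
      · refine Submodule.add_mem _ (hcons _ _ _ hc0mem) (Submodule.sum_mem _ fun x _ => ?_)
        exact Submodule.sub_mem _ (hcons _ _ _ (hbm x)) (hcons _ _ _ (hbm x))
      · rw [map_add, map_sum]
        simp only [map_sub, bd_cons, hbb]
        have : bd F c0 = - ∑ x : G, uncons F (a, x) c := by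
          rw [eq_neg_iff_add_eq_zero]; exact hbc
        rw [this]
        conv_rhs => rw [hdec]
        simp only [map_neg, map_sum, Finset.sum_sub_distrib]
        abel
end joins

/-! ### Lifting lemma -/

lemma exists_lift {F E J : Type*} [CommRing F] [AddCommGroup E] [Module F E]
    (δ : E →ₗ[F] E) (deg : J → ℕ) (valid : J → Prop) (D : (J → E) →ₗ[F] (J → E))
    (C C' : J → Submodule F E)
    (hloc : ∀ j Θ Θ', valid j → (∀ j', valid j' → deg j' < deg j → Θ j' = Θ' j') → D Θ j = D Θ' j)
    (hcar : ∀ j Θ, valid j → (∀ j', valid j' → deg j' < deg j → Θ j' ∈ C j') → D Θ j ∈ C' j)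
    (hcomm : ∀ Θ : J → E, D (fun j => δ (Θ j)) = fun j => δ (D Θ j))
    (hDD : ∀ Θ j, valid j → D (D Θ) j = 0)
    (hexact : ∀ j, valid j → ∀ c ∈ C' j, δ c = 0 → ∃ b ∈ C j, δ b = c)
    (hbdd : ∃ K, ∀ j, valid j → deg j < K) (β : J → E) (s : F) (hβ : ∀ j, valid j → β j ∈ C' j)
    (hβ' : ∀ j, valid j → δ (β j) = - (s • D β j)) :
    ∃ Θ : J → E, ∀ j, valid j → Θ j ∈ C j ∧ δ (Θ j) = s • D Θ j + β j := by
  classical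
  have step : ∀ K : ℕ, ∃ Θ : J → E, ∀ j, valid j → deg j < K → Θ j ∈ C j ∧ δ (Θ j) = s • D Θ j + β j := by
    intro K
    induction K with
    | zero => exact ⟨0, fun j _ h => absurd h (Nat.not_lt_zero _)⟩
    | succ K ih =>
      obtain ⟨Θ, hΘ⟩ := ih
      have hex : ∀ j, valid j → deg j = K → ∃ b ∈ C j, δ b = s • D Θ j + β j := by
        intro j hj hd
        apply hexact j hj
        · refine Submodule.add_mem _ (Submodule.smul_mem _ _ (hcar j Θ hj ?_)) (hβ j hj)
          intro j' hj' hlt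
          exact (hΘ j' hj' (by omega)).1
        · have h1 : δ (D Θ j) = D (fun j => δ (Θ j)) j := by rw [hcomm]
          have h2 : D (fun j => δ (Θ j)) j = D (s • D Θ + β) j := by
            apply hloc j _ _ hj
            intro j' hj' hlt
            exact (hΘ j' hj' (by omega)).2
          rw [map_add, map_smul, h1, h2, map_add, map_smul, Pi.add_apply, Pi.smul_apply, hDD _ _ hj,
            hβ' j hj]
          simp
      let Θ' : J → E := fun j => if h : valid j ∧ deg j = K then (hex j h.1 h.2).choose else Θ j
      have hΘ' : ∀ j, deg j ≠ K → Θ' j = Θ j := by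
        intro j hj
        simp [Θ', hj]
      refine ⟨Θ', fun j hj hlt => ?_⟩
      have hD : D Θ' j = D Θ j := by
        apply hloc j _ _ hj
        intro j' hj' hlt'
        exact hΘ' j' (by omega)
      rw [hD]
      by_cases hK : deg j = K
      · have : Θ' j = (hex j hj hK).choose := by simp [Θ', hj, hK]
        rw [this]
        exact (hex j hj hK).choose_spec
      · rw [hΘ' j hK]
        exact hΘ j hj (by omega)
  obtain ⟨K, hK⟩ := hbdd
  obtain ⟨Θ, hΘ⟩ := step K
  exact ⟨Θ, fun j hj => hΘ j hj (hK j hj)⟩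

lemma antisym_sum {ι E : Type*} [AddCommGroup E] (s : Finset ι) (f : ι → ι → E)
    (h0 : ∀ i ∈ s, f i i = 0) (h1 : ∀ i ∈ s, ∀ j ∈ s, f i j = - f j i) : ∑ i ∈ s, ∑ j ∈ s, f i j = 0 := by
  classical
  rw [← Finset.sum_product']
  refine Finset.sum_involution (fun x _ => (x.2, x.1)) ?_ ?_ ?_ ?_
  · rintro ⟨i, j⟩ h
    simp only [Finset.mem_product] at h
    simp [h1 i h.1 j h.2]
  · rintro ⟨i, j⟩ h hne heq
    simp only [Finset.mem_product] at h
    simp only [Prod.mk.injEq] at heq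
    apply hne
    rw [heq.1]
    exact h0 i h.1
  · rintro ⟨i, j⟩ h
    simp only [Finset.mem_product] at h ⊢
    exact ⟨h.2, h.1⟩
  · rintro ⟨i, j⟩ h; rfl

end DT


namespace DT

section ext
variable {F : Type*} [Field F] {V : Type*}

abbrev Lam (F : Type*) [Field F] (V : Type*) := ExteriorAlgebra F (V →₀ F)

noncomputable def iv (F : Type*) [Field F] {V : Type*} (v : V) : Lam F V :=
  ExteriorAlgebra.ι F (Finsupp.single v 1)

/-- ordered chains to exterior algebra -/
noncomputable def q (F : Type*) [Field F] {V : Type*} : (List V →₀ F) →ₗ[F] Lam F V :=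
  Finsupp.linearCombination F (fun l => (l.map (iv F)).prod)

lemma iv_sq (v : V) : iv F v * iv F v = 0 := ExteriorAlgebra.ι_sq_zero _

lemma iv_anti (v w : V) : iv F v * iv F w = - (iv F w * iv F v) :=
  eq_neg_of_add_eq_zero_left (ExteriorAlgebra.ι_add_mul_swap _ _)

lemma q_single (l : List V) (c : F) : q F (Finsupp.single l c) = c • (l.map (iv F)).prod := by
  simp [q]

lemma q_cons (v : V) (x : List V →₀ F) : q F (consL F v x) = iv F v * q F x := by
  have : (q F) ∘ₗ (consL F v) = (LinearMap.mulLeft F (iv F v)) ∘ₗ (q F) := by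
    apply hom_ext; intro l; simp [q_single]
  simpa using LinearMap.congr_fun this x

lemma iv_mul_prod_of_mem (v : V) (l : List V) (h : v ∈ l) : iv F v * (l.map (iv F)).prod = 0 := by
  induction l with
  | nil => simp at h
  | cons w l ih =>
    rw [List.map_cons, List.prod_cons, ← mul_assoc]
    rcases List.mem_cons.1 h with rfl | h
    · rw [iv_sq, zero_mul]
    · rw [iv_anti, neg_mul, mul_assoc, ih h, mul_zero, neg_zero]

lemma prod_not_nodup (l : List V) (h : ¬ l.Nodup) : (l.map (iv F)).prod = 0 := by
  induction l with
  | nil => simp at h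
  | cons w l ih =>
    rw [List.map_cons, List.prod_cons]
    by_cases hw : w ∈ l
    · exact iv_mul_prod_of_mem w l hw
    · rw [ih (fun h' => h (List.nodup_cons.2 ⟨hw, h'⟩)), mul_zero]

noncomputable def mapf (F : Type*) [Field F] {V : Type*} (f : V → V) : Lam F V →ₐ[F] Lam F V :=
  ExteriorAlgebra.map (Finsupp.lmapDomain F F f)

@[simp] lemma mapf_iv (f : V → V) (v : V) : mapf F f (iv F v) = iv F (f v) := by
  simp [mapf, iv, Finsupp.lmapDomain_apply, Finsupp.mapDomain_single]

lemma mapf_prod (f : V → V) (l : List V) :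
    mapf F f (l.map (iv F)).prod = ((l.map f).map (iv F)).prod := by
  rw [map_list_prod, List.map_map, List.map_map]
  congr 1
  apply List.map_congr_left
  intro v _
  simp

lemma q_act (f : V → V) (x : List V →₀ F) : q F (act F f x) = mapf F f (q F x) := by
  have : (q F) ∘ₗ (act F f) = (mapf F f).toLinearMap ∘ₗ (q F) := by
    apply hom_ext; intro l
    simp only [LinearMap.comp_apply, act_single, q_single, one_smul, AlgHom.toLinearMap_apply, mapf_prod]
  simpa using LinearMap.congr_fun this x

/-- the operators `Z` of the periodic resolution -/
noncomputable def Zop (F : Type*) [Field F] {V : Type*} (p : ℕ) (f : V → V) (a : ℕ) :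
    (List V →₀ F) →ₗ[F] (List V →₀ F) :=
  if Odd a then act F f - LinearMap.id else ∑ t ∈ Finset.range p, act F (f^[t])

noncomputable def ZL (F : Type*) [Field F] {V : Type*} (p : ℕ) (f : V → V) (a : ℕ) :
    Lam F V →ₗ[F] Lam F V :=
  if Odd a then (mapf F f).toLinearMap - LinearMap.id
  else ∑ t ∈ Finset.range p, (mapf F (f^[t])).toLinearMap

lemma q_Zop (p : ℕ) (f : V → V) (a : ℕ) (x : List V →₀ F) : q F (Zop F p f a x) = ZL F p f a (q F x) := by
  by_cases h : Odd a <;> simp [Zop, ZL, h, q_act]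

lemma bd_Zop (p : ℕ) (f : V → V) (a : ℕ) (x : List V →₀ F) : bd F (Zop F p f a x) = Zop F p f a (bd F x) := by
  by_cases h : Odd a <;> simp [Zop, h, bd_act]

lemma act_act (f g : V → V) (x : List V →₀ F) : act F f (act F g x) = act F (f ∘ g) x := by
  rw [act_comp]; rfl

lemma Zop_Zop {p : ℕ} {f : V → V} (hf : f^[p] = id) (a : ℕ) (x : List V →₀ F) :
    Zop F p f (a+1) (Zop F p f a x) = 0 := by
  have key : ∑ t ∈ Finset.range p, act F (f^[t+1]) x = ∑ t ∈ Finset.range p, act F (f^[t]) x := by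
    have h1 := Finset.sum_range_succ (fun t => act F (f^[t]) x) p
    have h2 := Finset.sum_range_succ' (fun t => act F (f^[t]) x) p
    rw [h1] at h2
    simp only [hf, Function.iterate_zero] at h2
    exact (add_right_cancel h2).symm
  by_cases h : Odd a
  · have h' : ¬ Odd (a+1) := by grind
    simp only [Zop, h, h', if_true, if_false, LinearMap.sub_apply, LinearMap.id_apply, LinearMap.sum_apply, map_sub, act_act]
    rw [sub_eq_zero, ← key]
    rfl
  · have h' : Odd (a+1) := by grind
    simp only [Zop, h, h', if_true, if_false, LinearMap.sub_apply, LinearMap.id_apply, LinearMap.sum_apply, map_sum, act_act]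
    rw [Finset.sum_sub_distrib, sub_eq_zero, ← key]
    refine Finset.sum_congr rfl fun t _ => ?_
    rw [Function.iterate_succ']

lemma Zop_comm {p : ℕ} {f g : V → V} (hfg : Function.Commute f g) (a b : ℕ) (x : List V →₀ F) :
    Zop F p f a (Zop F p g b x) = Zop F p g b (Zop F p f a x) := by
  have h0 : ∀ s t (y : List V →₀ F), act F (f^[s]) (act F (g^[t]) y) = act F (g^[t]) (act F (f^[s]) y) := by
    intro s t y
    rw [act_act, act_act, (hfg.iterate_iterate s t).comp_eq]
  have h1 : ∀ t (y : List V →₀ F), act F f (act F (g^[t]) y) = act F (g^[t]) (act F f y) := fun t y => h0 1 t y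
  have h2 : ∀ s (y : List V →₀ F), act F (f^[s]) (act F g y) = act F g (act F (f^[s]) y) := fun s y => h0 s 1 y
  have h3 : ∀ (y : List V →₀ F), act F f (act F g y) = act F g (act F f y) := fun y => h0 1 1 y
  by_cases ha : Odd a <;> by_cases hb : Odd b <;>
    simp only [Zop, ha, hb, if_true, if_false, LinearMap.sub_apply, LinearMap.id_apply, LinearMap.sum_apply, map_sub, map_sum, h0, h1, h2, h3, Finset.sum_sub_distrib]
  · abel
  · rw [Finset.sum_comm]

lemma Zop_act {p : ℕ} {f g : V → V} (hfg : Function.Commute f g) (a : ℕ) (x : List V →₀ F) :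
    Zop F p f a (act F g x) = act F g (Zop F p f a x) := by
  have h2 : ∀ s (y : List V →₀ F), act F (f^[s]) (act F g y) = act F g (act F (f^[s]) y) := by
    intro s y
    rw [act_act, act_act, (hfg.iterate_left s).comp_eq]
  have h3 : ∀ (y : List V →₀ F), act F f (act F g y) = act F g (act F f y) := fun y => h2 1 y
  by_cases ha : Odd a <;>
    simp only [Zop, ha, if_true, if_false, LinearMap.sub_apply, LinearMap.id_apply, LinearMap.sum_apply, map_sub, map_sum, h2, h3]

/-- Eilenberg–Zilber style maps -/
noncomputable def BL (F : Type*) [Field F] {V : Type*} (p : ℕ) (f : V → V) : List V → ℕ → (List V →₀ F)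
  | [], 0 => Finsupp.single [] 1
  | [], _ + 1 => 0
  | x :: t, 0 => consL F x (BL F p f t 0)
  | x :: t, a + 1 => consL F x (BL F p f t (a+1) + (-1 : F) ^ t.length • Zop F p f (a+1) (BL F p f (x :: t) a))
termination_by l a => (l, a)

noncomputable def B (F : Type*) [Field F] {V : Type*} (p : ℕ) (f : V → V) (a : ℕ) :
    (List V →₀ F) →ₗ[F] (List V →₀ F) :=
  Finsupp.linearCombination F (fun l => BL F p f l a)

lemma B_single (p : ℕ) (f : V → V) (a : ℕ) (l : List V) : B F p f a (Finsupp.single l 1) = BL F p f l a := by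
  simp [B]

lemma BL_length (p : ℕ) (f : V → V) (l : List V) (a : ℕ) (S : Set V) (hS : ∀ v ∈ S, f v ∈ S) (hl : ∀ v ∈ l, v ∈ S) :
    BL F p f l a ∈ Finsupp.supported F F {l' : List V | l'.length = l.length + a ∧ ∀ v ∈ l', v ∈ S} := by
  have hS' : ∀ t, ∀ v ∈ S, f^[t] v ∈ S := by
    intro t
    induction t with
    | zero => intro v hv; exact hv
    | succ t ih => intro v hv; rw [Function.iterate_succ']; exact hS _ (ih v hv)
  have hZ : ∀ n a (x : List V →₀ F), x ∈ Finsupp.supported F F {l' : List V | l'.length = n ∧ ∀ v ∈ l', v ∈ S} →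
      Zop F p f a x ∈ Finsupp.supported F F {l' : List V | l'.length = n ∧ ∀ v ∈ l', v ∈ S} := by
    intro n a x hx
    have hact : ∀ t, act F (f^[t]) x ∈ Finsupp.supported F F {l' : List V | l'.length = n ∧ ∀ v ∈ l', v ∈ S} := by
      intro t
      refine map_supported _ ?_ hx
      rintro l ⟨h1, h2⟩
      rw [act_single]
      refine single_mem ?_ _
      refine ⟨by simpa using h1, ?_⟩
      intro v hv
      obtain ⟨w, hw, rfl⟩ := List.mem_map.1 hv
      exact hS' t w (h2 w hw)
    by_cases h : Odd a
    · simp only [Zop, h, if_true, LinearMap.sub_apply, LinearMap.id_apply]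
      exact Submodule.sub_mem _ (hact 1) hx
    · simp only [Zop, h, if_false, LinearMap.sum_apply]
      exact Submodule.sum_mem _ fun t _ => hact t
  have hc : ∀ n x (y : List V →₀ F), x ∈ S → y ∈ Finsupp.supported F F {l' : List V | l'.length = n ∧ ∀ v ∈ l', v ∈ S} →
      consL F x y ∈ Finsupp.supported F F {l' : List V | l'.length = n + 1 ∧ ∀ v ∈ l', v ∈ S} := by
    intro n x y hxS hy
    refine map_supported _ ?_ hy
    rintro l ⟨h1, h2⟩
    rw [consL_single]
    refine single_mem ?_ _
    refine ⟨by simpa using h1, ?_⟩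
    intro v hv
    rcases List.mem_cons.1 hv with rfl | hv
    · exact hxS
    · exact h2 v hv
  induction l generalizing a with
  | nil =>
    cases a with
    | zero => rw [BL]; exact single_mem (by simp) _
    | succ a => rw [BL]; exact Submodule.zero_mem _
  | cons x t ih =>
    have ih := fun a => ih a (fun v hv => hl v (List.mem_cons_of_mem _ hv))
    have hx := hl x (by simp)
    induction a with
    | zero =>
      rw [BL]; have := hc _ x _ hx (ih 0); simpa using this
    | succ a iha =>
      rw [BL]
      have h := hc (t.length + (a+1)) x _ hx (Submodule.add_mem _ (ih (a+1)) (Submodule.smul_mem _ ((-1 : F) ^ t.length) (hZ _ (a+1) _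
        (by convert iha using 4; simp; omega))))
      convert h using 4
      simp; omega

lemma B_mem (p : ℕ) (f : V → V) (n a : ℕ) (S : Set V) (hS : ∀ v ∈ S, f v ∈ S) {x : List V →₀ F}
    (hx : x ∈ Finsupp.supported F F {l' : List V | l'.length = n ∧ ∀ v ∈ l', v ∈ S}) :
    B F p f a x ∈ Finsupp.supported F F {l' : List V | l'.length = n + a ∧ ∀ v ∈ l', v ∈ S} := by
  refine map_supported _ ?_ hx
  rintro l ⟨rfl, h2⟩
  rw [B_single]
  exact BL_length p f l a S hS h2

lemma BL_act {p : ℕ} {f g : V → V} (hfg : Function.Commute f g) (l : List V) (a : ℕ) :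
    BL F p f (l.map g) a = act F g (BL F p f l a) := by
  induction l generalizing a with
  | nil => cases a <;> simp [BL]
  | cons x t ih =>
    induction a with
    | zero => rw [List.map_cons, BL, BL, ih, act_cons]
    | succ a iha =>
      rw [List.map_cons, BL, BL, ← List.map_cons, iha, ih, act_cons, map_add (act F g), map_smul (act F g), Zop_act hfg, List.length_map]

lemma B_act {p : ℕ} {f g : V → V} (hfg : Function.Commute f g) (a : ℕ) (x : List V →₀ F) :
    B F p f a (act F g x) = act F g (B F p f a x) := by
  have : (B F p f a) ∘ₗ (act F g) = (act F g) ∘ₗ (B F p f a) := by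
    apply hom_ext; intro l
    simp only [LinearMap.comp_apply, act_single, B_single, BL_act hfg]
  simpa using LinearMap.congr_fun this x

lemma B_Zop {p : ℕ} {f g : V → V} (hfg : Function.Commute f g) (a b : ℕ) (x : List V →₀ F) :
    B F p f a (Zop F p g b x) = Zop F p g b (B F p f a x) := by
  have h : ∀ t y, B F p f a (act F (g^[t]) y) = act F (g^[t]) (B F p f a y) := fun t y => B_act (hfg.iterate_right t) a y
  by_cases hb : Odd b <;> simp [Zop, hb, h, B_act hfg]

lemma B_cons_zero (p : ℕ) (f : V → V) (x : V) (y : List V →₀ F) :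
    B F p f 0 (consL F x y) = consL F x (B F p f 0 y) := by
  have : (B F p f 0) ∘ₗ (consL F x) = (consL F x) ∘ₗ (B F p f 0) := by
    apply hom_ext; intro l
    simp only [LinearMap.comp_apply, consL_single, B_single, BL]
  simpa using LinearMap.congr_fun this y

lemma B_cons_succ (p : ℕ) (f : V → V) (a n : ℕ) (x : V) (y : List V →₀ F)
    (hy : y ∈ Finsupp.supported F F {l' : List V | l'.length = n}) :
    B F p f (a+1) (consL F x y) = consL F x (B F p f (a+1) y + (-1 : F) ^ n • Zop F p f (a+1) (B F p f a (consL F x y))) := by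
  have := map_supported ((B F p f (a+1)) ∘ₗ (consL F x) - (consL F x) ∘ₗ (B F p f (a+1) + (-1 : F) ^ n • (Zop F p f (a+1) ∘ₗ B F p f a ∘ₗ consL F x)))
    (T := ⊥) ?_ hy
  · simpa [sub_eq_zero] using this
  · rintro l rfl
    simp only [LinearMap.comp_apply, LinearMap.sub_apply, LinearMap.add_apply, LinearMap.smul_apply, consL_single, B_single, BL, sub_self, Submodule.zero_mem]

lemma bdL_length (l : List V) : bdL F l ∈ Finsupp.supported F F {l' : List V | l'.length = l.length - 1} := by
  induction l with
  | nil => simp [bdL]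
  | cons v l ih =>
    refine Submodule.sub_mem _ (single_mem (by simp) _) ?_
    cases l with
    | nil => simp [bdL]
    | cons w l =>
    refine map_supported _ ?_ ih
    rintro l' h
    rw [consL_single]
    refine single_mem ?_ _
    simp at h ⊢
    exact h

lemma bd_BL {p : ℕ} {f : V → V} (hf : f^[p] = id) (l : List V) (a : ℕ) :
    bd F (BL F p f l a) = B F p f a (bdL F l) +
      if a = 0 then 0 else (-1 : F) ^ (l.length + 1) • Zop F p f a (BL F p f l (a - 1)) := by
  induction l generalizing a with
  | nil =>
    rcases a with _ | _ | a
    · simp [BL, bdL, bd]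
    · have h1 : Zop F p f 1 (Finsupp.single [] 1) = 0 := by simp [Zop]
      simp [BL, bdL, h1]
    · simp [BL, bdL]
  | cons x t ih =>
    induction a with
    | zero =>
      have := ih 0
      simp only [if_true, add_zero] at this ⊢
      rw [BL, bd_cons, this, bdL, map_sub, B_single, B_cons_zero]
    | succ a iha =>
      have ih1 := ih (a+1)
      simp only [Nat.add_sub_cancel, Nat.succ_ne_zero, if_false] at ih1 ⊢
      rw [BL, bd_cons, map_add, map_smul, bd_Zop, iha, ih1, bdL, map_sub, B_single]
      have hZZ : Zop F p f (a+1) (if a = 0 then 0 else (-1 : F) ^ ((x :: t).length + 1) • Zop F p f a (BL F p f (x :: t) (a - 1))) = 0 := by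
        split_ifs
        · simp
        · rw [map_smul, Zop_Zop hf, smul_zero]
      rw [map_add (Zop F p f (a+1)), hZZ, add_zero]
      rcases t with _ | ⟨y, t⟩
      · have h1 : Zop F p f (a+1) (BL F p f [] a) = 0 := by
          cases a with
          | zero => simp [BL, Zop]
          | succ a => simp [BL]
        simp [bdL, B_single, h1]
      rw [map_sub (B F p f (a+1)), B_cons_succ p f a t.length x (bdL F (y :: t)) (by simpa using bdL_length (F := F) (y :: t)),
        B_single]
      simp only [List.length_cons, map_add, map_sub, map_smul, pow_succ]
      module

lemma bd_B {p : ℕ} {f : V → V} (hf : f^[p] = id) (n a : ℕ) (x : List V →₀ F)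
    (hx : x ∈ Finsupp.supported F F {l' : List V | l'.length = n}) :
    bd F (B F p f a x) = B F p f a (bd F x) +
      if a = 0 then 0 else (-1 : F) ^ (n + 1) • Zop F p f a (B F p f (a - 1) x) := by
  have := map_supported (bd F ∘ₗ B F p f a - B F p f a ∘ₗ bd F - (if a = 0 then 0 else (-1 : F) ^ (n + 1) • Zop F p f a ∘ₗ B F p f (a - 1)))
    (T := ⊥) ?_ hx
  · by_cases ha : a = 0
    · simpa [ha, sub_eq_zero] using this
    · simp only [ha, if_false] at this ⊢
      simp only [LinearMap.comp_apply, LinearMap.sub_apply, LinearMap.smul_apply, Submodule.mem_bot] at this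
      rw [sub_sub, sub_eq_zero] at this
      exact this
  · rintro l rfl
    by_cases ha : a = 0
    · simp [ha, B_single, bd_single, bd_BL hf]
    · simp [ha, B_single, bd_single, bd_BL hf]

end ext
end DT


namespace DT

section row
variable {F : Type*} [Field F] {V : Type*}

lemma neg_one_pow_p (p : ℕ) [Fact p.Prime] [CharP F p] : (-1 : F) ^ p = -1 := by
  rcases (Fact.out : p.Prime).eq_two_or_odd' with rfl | h
  · have : (2 : F) = 0 := by exact_mod_cast CharP.cast_eq_zero F 2
    have h1 : (1 : F) = -1 := by
      rw [eq_neg_iff_add_eq_zero]; rw [← this]; norm_num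
    rw [← h1]; simp
  · exact h.neg_one_pow

lemma neg_one_pow_pred (p : ℕ) [Fact p.Prime] [CharP F p] : (-1 : F) ^ (p - 1) = 1 := by
  have h := neg_one_pow_p (F := F) p
  have hp : p = (p - 1) + 1 := by have := (Fact.out : p.Prime).pos; omega
  rw [hp, pow_succ] at h
  simp only [mul_neg, mul_one, neg_inj] at h
  simpa using h

lemma add_pow_sq_zero {A : Type*} [Ring A] {S e : A} (h : Commute S e) (he : e * e = 0) (n : ℕ) :
    (S + e) ^ (n + 1) = S ^ (n + 1) + (n + 1 : ℕ) • (S ^ n * e) := by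
  induction n with
  | zero => simp
  | succ n ih =>
    rw [pow_succ (S + e), ih]
    have h1 : S ^ n * e * S = S ^ (n+1) * e := by rw [mul_assoc, ← h.eq, ← mul_assoc, ← pow_succ]
    have h2 : S ^ n * e * e = 0 := by rw [mul_assoc, he, mul_zero]
    rw [add_mul, mul_add, mul_add, smul_mul_assoc, smul_mul_assoc, h1, h2, ← pow_succ]
    simp only [succ_nsmul, smul_zero, add_zero]
    abel

lemma iv_pair_comm (a b w : V) : Commute (iv F a * iv F b) (iv F w) := by
  unfold Commute SemiconjBy
  rw [mul_assoc, iv_anti b w, mul_neg, ← mul_assoc, iv_anti a w, neg_mul, neg_neg, mul_assoc]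

lemma iv_aba (a b : V) : iv F a * (iv F b * iv F a) = 0 := by
  rw [iv_anti b a, mul_neg, ← mul_assoc, iv_sq, zero_mul, neg_zero]

lemma iv_pair_pair (a b c d : V) : Commute (iv F a * iv F b) (iv F c * iv F d) :=
  (iv_pair_comm a b c).mul_right (iv_pair_comm a b d)

noncomputable def seqP (F : Type*) [Field F] {V : Type*} (u : ℕ → V) (m : ℕ) : Lam F V :=
  ((List.range m).map (fun t => iv F (u t))).prod

lemma seqP_eq (u : ℕ → V) (m : ℕ) : seqP F u m = (((List.range m).map u).map (iv F)).prod := by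
  rw [List.map_map]; rfl

lemma seqP_succ (u : ℕ → V) (m : ℕ) : seqP F u (m+1) = seqP F u m * iv F (u m) := by
  simp [seqP, List.range_succ]

lemma seqP_mul (u : ℕ → V) (m t : ℕ) (ht : t < m) : seqP F u m * iv F (u t) = 0 := by
  have := prod_not_nodup (F := F) ((List.range m).map u ++ [u t]) ?_
  · rw [seqP_eq]; simpa using this
  · intro h
    rw [List.nodup_append] at h
    exact h.2.2 (u t) (List.mem_map_of_mem (List.mem_range.2 ht)) (u t) (by simp) rfl

lemma seq_pow (u : ℕ → V) (j : ℕ) :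
    iv F (u 0) * (∑ i ∈ Finset.range (2 * j), iv F (u i) * iv F (u (i+1))) ^ j = (j.factorial : F) • seqP F u (2 * j + 1) := by
  induction j with
  | zero => simp [seqP]
  | succ j ih =>
    set S := ∑ i ∈ Finset.range (2 * j), iv F (u i) * iv F (u (i+1)) with hS
    set a := iv F (u (2*j)) * iv F (u (2*j+1)) with ha
    set b := iv F (u (2*j+1)) * iv F (u (2*j+2)) with hb
    have hsum : ∑ i ∈ Finset.range (2 * (j+1)), iv F (u i) * iv F (u (i+1)) = S + (a + b) := by
      rw [show 2 * (j+1) = 2*j+1+1 by ring, Finset.sum_range_succ, Finset.sum_range_succ, add_assoc]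
    have hee : (a + b) * (a + b) = 0 := by
      have haa : a * a = 0 := by
        rw [ha, mul_assoc, iv_aba, mul_zero]
      have hbb : b * b = 0 := by
        rw [hb, mul_assoc, iv_aba, mul_zero]
      have hab : a * b = 0 := by
        rw [ha, hb, mul_assoc, ← mul_assoc (iv F (u (2*j+1))), iv_sq, zero_mul, mul_zero]
      have hba : b * a = 0 := by
        rw [← hab]; exact (iv_pair_pair _ _ _ _).eq
      simp [mul_add, add_mul, haa, hbb, hab, hba]
    have hcomm : Commute S (a + b) := by
      refine Commute.sum_left _ _ _ fun i _ => ?_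
      exact (iv_pair_pair _ _ _ _).add_right (iv_pair_pair _ _ _ _)
    rw [hsum, add_pow_sq_zero hcomm hee, mul_add, mul_smul_comm, pow_succ, ← mul_assoc, ← mul_assoc, ih]
    have h1 : seqP F u (2*j+1) * S = 0 := by
      rw [hS, Finset.mul_sum]
      refine Finset.sum_eq_zero fun i hi => ?_
      rw [← mul_assoc, seqP_mul, zero_mul]
      have := Finset.mem_range.1 hi; omega
    have h2 : seqP F u (2*j+1) * (a + b) = seqP F u (2*(j+1)+1) := by
      rw [mul_add, ha, ← mul_assoc, seqP_mul _ _ _ (by omega), zero_mul, zero_add, hb, ← mul_assoc,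
        ← seqP_succ, ← seqP_succ]
      rfl
    rw [smul_mul_assoc, h1, smul_zero, zero_add, smul_mul_assoc, h2, Nat.factorial_succ, Nat.cast_mul, mul_smul,
      ← Nat.cast_smul_eq_nsmul F]

/-- row product -/
noncomputable def varpi (F : Type*) [Field F] {V : Type*} (p : ℕ) (f : V → V) (y : V) : Lam F V :=
  seqP F (fun t => f^[t] y) p

noncomputable def Rr (F : Type*) [Field F] {V : Type*} (p : ℕ) (f : V → V) (x : V) : ℕ → Lam F V
  | 0 => iv F x
  | c + 1 => iv F x * ZL F p f (c+1) (Rr F p f x c)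

noncomputable def cc (F : Type*) [Field F] {V : Type*} (p : ℕ) (f : V → V) (x : V) : Lam F V :=
  ∑ t ∈ Finset.range p, iv F (f^[t] x) * iv F (f^[t+1] x)

lemma mapf_cc {p : ℕ} {f : V → V} (hf : f^[p] = id) (x : V) : mapf F f (cc F p f x) = cc F p f x := by
  rw [cc, map_sum]
  have h1 := Finset.sum_range_succ (fun t => iv F (f^[t] x) * iv F (f^[t+1] x)) p
  have h2 := Finset.sum_range_succ' (fun t => iv F (f^[t] x) * iv F (f^[t+1] x)) p
  rw [h1] at h2
  have h3 : f^[p+1] x = f x := by rw [Function.iterate_succ_apply', hf]; rfl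
  rw [h3, hf] at h2
  simp only [Function.iterate_zero, Function.iterate_succ_apply', id] at h2 ⊢
  rw [add_right_cancel h2]
  simp

lemma mapf_iter (f : V → V) (t : ℕ) (y : Lam F V) (h : mapf F f y = y) : mapf F (f^[t]) y = y := by
  have hcomp : ∀ (f g : V → V) y, mapf F (f ∘ g) y = mapf F f (mapf F g y) := by
    intro f g y
    have : mapf F (f ∘ g) = (mapf F f).comp (mapf F g) := by
      unfold mapf
      rw [ExteriorAlgebra.map_comp_map]
      congr 1
      rw [Finsupp.lmapDomain_comp]
    rw [this]; rfl
  have hid : mapf F (id : V → V) = AlgHom.id F _ := by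
    unfold mapf
    rw [Finsupp.lmapDomain_id, ExteriorAlgebra.map_id]
  induction t with
  | zero => rw [Function.iterate_zero, hid]; rfl
  | succ t ih => rw [Function.iterate_succ', hcomp, ih, h]

lemma Rr_formula {p : ℕ} {f : V → V} (hf : f^[p] = id) (x : V) (j : ℕ) :
    Rr F p f x (2 * j) = iv F x * cc F p f x ^ j ∧
    Rr F p f x (2 * j + 1) = iv F x * iv F (f x) * cc F p f x ^ j := by
  have hodd : ∀ j, Rr F p f x (2 * j) = iv F x * cc F p f x ^ j →
    Rr F p f x (2 * j + 1) = iv F x * iv F (f x) * cc F p f x ^ j := by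
    intro j h
    have ho : Odd (2 * j + 1) := ⟨j, rfl⟩
    rw [Rr, h, ZL]
    simp only [ho, if_true, LinearMap.sub_apply, AlgHom.toLinearMap_apply, LinearMap.id_apply, map_mul, map_pow, mapf_cc hf, mapf_iv]
    rw [mul_sub, ← mul_assoc, ← mul_assoc, iv_sq, zero_mul, sub_zero]
  refine ⟨?_, ?_⟩
  · induction j with
    | zero => simp [Rr]
    | succ j ih =>
      have ho : ¬ Odd (2 * j + 1 + 1) := by grind
      rw [show 2 * (j+1) = 2 * j + 1 + 1 by ring, Rr, hodd j ih, ZL]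
      simp only [ho, if_false, LinearMap.sum_apply, AlgHom.toLinearMap_apply, map_mul, map_pow, mapf_iter f _ _ (mapf_cc hf x), mapf_iv]
      rw [← Finset.sum_mul, pow_succ', ]
      congr 1
  · apply hodd
    induction j with
    | zero => simp [Rr]
    | succ j ih =>
      have ho : ¬ Odd (2 * j + 1 + 1) := by grind
      rw [show 2 * (j+1) = 2 * j + 1 + 1 by ring, Rr, hodd j ih, ZL]
      simp only [ho, if_false, LinearMap.sum_apply, AlgHom.toLinearMap_apply, map_mul, map_pow, mapf_iter f _ _ (mapf_cc hf x), mapf_iv]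
      rw [← Finset.sum_mul, pow_succ', ]
      congr 1

lemma cc_comm (p : ℕ) (f : V → V) (x w : V) : Commute (cc F p f x) (iv F w) :=
  Commute.sum_left _ _ _ fun _ _ => iv_pair_comm _ _ _

lemma Rr_top (F : Type*) [Field F] (V : Type*) (p : ℕ) [hp : Fact p.Prime] [CharP F p] : ∃ ρ : F, ρ ≠ 0 ∧ ∀ (f : V → V), f^[p] = id → ∀ x : V,
    Rr F p f x (p - 1) = ρ • varpi F p f x := by
  rcases hp.out.eq_two_or_odd' with rfl | ⟨j, rfl⟩
  · refine ⟨1, one_ne_zero, fun f hf x => ?_⟩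
    have := (Rr_formula (F := F) hf x 0).2
    simp only [mul_zero, zero_add, pow_zero, mul_one] at this
    simp [this, varpi, seqP, List.range_succ]
  · refine ⟨(j.factorial : F), ?_, fun f hf x => ?_⟩
    · rw [Ne, CharP.cast_eq_zero_iff F (2*j+1), hp.out.dvd_factorial]
      omega
    · rw [Nat.add_sub_cancel, (Rr_formula (F := F) hf x j).1, varpi, ← seq_pow]
      simp only [Function.iterate_zero, id]
      rw [cc, Finset.sum_range_succ, hf]
      have key : ∀ n, iv F x * (∑ t ∈ Finset.range (2 * j), iv F (f^[t] x) * iv F (f^[t+1] x) + iv F (f^[2*j] x) * iv F (id x)) ^ n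
         = iv F x * (∑ t ∈ Finset.range (2 * j), iv F (f^[t] x) * iv F (f^[t+1] x)) ^ n := by
        intro n
        induction n with
        | zero => simp
        | succ n ih =>
          set S := ∑ t ∈ Finset.range (2 * j), iv F (f^[t] x) * iv F (f^[t+1] x)
          have hw : iv F x * (iv F (f^[2*j] x) * iv F x) = 0 := by
            exact iv_aba _ _
          have hS : Commute S (iv F x) := Commute.sum_left _ _ _ fun _ _ => iv_pair_comm _ _ _
          have hS2 : Commute S (iv F (f^[2*j] x)) := Commute.sum_left _ _ _ fun _ _ => iv_pair_comm _ _ _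
          rw [pow_succ, ← mul_assoc, ih, mul_add, pow_succ, mul_assoc, mul_assoc, id]
          have : iv F x * (S ^ n * (iv F (f^[2*j] x) * iv F x)) = 0 := by
            rw [← mul_assoc, ← (hS.pow_left n).eq, mul_assoc, hw, mul_zero]
          rw [this, add_zero]
      exact key j

lemma q_eq_zero {S : Set (List V)} (hS : ∀ l ∈ S, ¬ l.Nodup) {x : List V →₀ F}
    (hx : x ∈ Finsupp.supported F F S) : q F x = 0 := by
  have := map_supported (q F) (T := ⊥) (fun l hl => by
    rw [q_single, prod_not_nodup l (hS l hl), smul_zero]; exact Submodule.zero_mem _) hx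
  simpa using this

lemma BL_top_zero {p : ℕ} {f : V → V} (hp : 0 < p) (hf : f^[p] = id) (x : List V) (a : ℕ) (ha : x.length * (p - 1) < a) :
    q F (BL F p f x a) = 0 := by
  classical
  set S : Finset V := x.toFinset.biUnion (fun y => (Finset.range p).image (fun t => f^[t] y)) with hS
  have hcard : S.card ≤ x.length * p := by
    refine (Finset.card_biUnion_le_card_mul _ _ p ?_).trans ?_
    · intro y _
      exact Finset.card_image_le.trans (by simp)
    · exact Nat.mul_le_mul_right _ (List.toFinset_card_le _)
  have hSf : ∀ v ∈ (S : Set V), f v ∈ (S : Set V) := by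
    intro v hv
    simp only [hS, Finset.coe_biUnion, Set.mem_iUnion, Finset.mem_coe, Finset.mem_image, Finset.mem_range] at hv ⊢
    obtain ⟨y, hy, t, ht, rfl⟩ := hv
    refine ⟨y, hy, ?_⟩
    by_cases h : t + 1 < p
    · exact ⟨t + 1, h, by rw [Function.iterate_succ_apply']⟩
    · refine ⟨0, hp, ?_⟩
      rw [← Function.iterate_succ_apply' f t y, show t.succ = p by omega, hf]; rfl
  have hxS : ∀ v ∈ x, v ∈ (S : Set V) := by
    intro v hv
    simp only [hS, Finset.coe_biUnion, Set.mem_iUnion, Finset.mem_coe, Finset.mem_image, Finset.mem_range]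
    exact ⟨v, by simpa using hv, 0, hp, rfl⟩
  refine q_eq_zero ?_ (BL_length (F := F) p f x a (S : Set V) hSf hxS)
  rintro l ⟨h1, h2⟩ hnd
  have h3 : l.toFinset ⊆ S := by
    intro v hv
    exact h2 v (List.mem_toFinset.1 hv)
  have h4 := Finset.card_le_card h3
  rw [List.toFinset_card_of_nodup hnd, h1] at h4
  have h5 : x.length * p = x.length * (p - 1) + x.length := by
    obtain ⟨m, rfl⟩ : ∃ m, p = m + 1 := ⟨p - 1, by omega⟩
    simp; ring
  omega

lemma ZL_period {p : ℕ} [hp : Fact p.Prime] [CharP F p] (f : V → V) (M c : ℕ) :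
    ZL F p f (M * (p - 1) + c) = ZL F p f c := by
  rcases hp.out.eq_two_or_odd' with rfl | h
  · have h2 : (2 : F) = 0 := by exact_mod_cast CharP.cast_eq_zero F 2
    have key : ∀ a, ZL F 2 f a = (mapf F f).toLinearMap - LinearMap.id := by
      intro a
      by_cases ha : Odd a
      · simp [ZL, ha]
      · simp only [ZL, ha, if_false, Finset.sum_range_succ, Finset.sum_range_zero, zero_add, Function.iterate_zero, Function.iterate_one]
        have : (mapf F (id : V → V)).toLinearMap = LinearMap.id := by
          unfold mapf
          rw [Finsupp.lmapDomain_id, ExteriorAlgebra.map_id]; rfl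
        rw [this, add_comm, sub_eq_add_neg]
        congr 1
        rw [eq_neg_iff_add_eq_zero, ← two_smul F, h2, zero_smul]
    rw [key, key]
  · obtain ⟨j, rfl⟩ := h
    have : Odd (M * (2 * j + 1 - 1) + c) ↔ Odd c := by
      rw [Nat.add_sub_cancel]
      have : Even (M * (2 * j)) := by rw [show M * (2 * j) = 2 * (M * j) by ring]; exact even_two_mul _
      grind
    simp only [ZL, this]

lemma mapf_varpi {p : ℕ} [hp : Fact p.Prime] [CharP F p] {f : V → V} (hf : f^[p] = id) (y : V) :
    mapf F f (varpi F p f y) = varpi F p f y := by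
  have hmove : ∀ (l : List V) (w : V), (l.map (iv F)).prod * iv F w = (-1 : F) ^ l.length • (iv F w * (l.map (iv F)).prod) := by
    intro l w
    induction l with
    | nil => simp
    | cons v l ih =>
      rw [List.map_cons, List.prod_cons, mul_assoc, ih, mul_smul_comm, ← mul_assoc, iv_anti v w, neg_mul, mul_assoc,
        List.length_cons, pow_succ]
      simp
  obtain ⟨m, rfl⟩ : ∃ m, p = m + 1 := ⟨p - 1, by have := hp.out.pos; omega⟩
  have h1 : mapf F f (varpi F (m+1) f y) = ((List.range m).map (fun t => iv F (f^[t+1] y))).prod * iv F y := by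
    rw [varpi, seqP_eq, mapf_prod, List.range_succ]
    simp only [List.map_append, List.map_map, List.map_cons, List.map_nil, List.prod_append, List.prod_singleton]
    congr 2
    · apply List.map_congr_left; intro t _; simp only [Function.comp]; rw [Function.iterate_succ_apply']
    · rw [← Function.iterate_succ_apply' f m y, hf]; rfl
  have h2 : varpi F (m+1) f y = iv F y * ((List.range m).map (fun t => iv F (f^[t+1] y))).prod := by
    rw [varpi, seqP, List.range_succ_eq_map]
    simp [Function.comp_def]
  rw [h1, h2]
  have := hmove ((List.range m).map (fun t => f^[t+1] y)) y
  rw [List.map_map] at this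
  have hs := neg_one_pow_pred (F := F) (m+1)
  simp only [Nat.add_sub_cancel] at hs
  simpa [Function.comp_def, hs] using this

theorem row_lemma (F : Type*) [Field F] (V : Type*) (p : ℕ) [hp : Fact p.Prime] [CharP F p] (L : ℕ) :
    ∃ s : F, s ≠ 0 ∧ ∀ (f : V → V), f^[p] = id → ∀ x : List V, x.length = L →
      q F (BL F p f x (L * (p - 1))) = s • (x.map (varpi F p f)).prod := by
  classical
  induction L with
  | zero =>
    refine ⟨1, one_ne_zero, fun f hf x hx => ?_⟩
    rw [List.length_eq_zero_iff] at hx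
    subst hx
    simp [BL, q_single]
  | succ L ih =>
    obtain ⟨s, hs, ih⟩ := ih
    obtain ⟨ρ, hρ, hR⟩ := Rr_top F V p
    refine ⟨((-1 : F) ^ L) ^ (p - 1) * ρ * s, by simp [hs, hρ], ?_⟩
    rintro f hf (_ | ⟨x, x'⟩) hx
    · simp at hx
    replace hx : x'.length = L := by simpa using hx
    set Ω := q F (BL F p f x' (L * (p - 1))) with hΩ
    have hΩ' := ih f hf x' hx
    have hΩf : mapf F f Ω = Ω := by
      rw [hΩ, hΩ', map_smul, map_list_prod, List.map_map]
      congr 2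
      apply List.map_congr_left
      intro v _
      exact mapf_varpi hf v
    -- the row of x
    set row : Finset V := (Finset.range p).image (fun t => f^[t] x) with hrow
    have hfrow : ∀ v, v ∈ row → f v ∈ row := by
      intro v hv
      simp only [hrow, Finset.mem_image, Finset.mem_range] at hv ⊢
      obtain ⟨t, ht, rfl⟩ := hv
      by_cases h : t + 1 < p
      · exact ⟨t + 1, h, by rw [Function.iterate_succ_apply']⟩
      · refine ⟨0, hp.out.pos, ?_⟩
        rw [← Function.iterate_succ_apply' f t x, show t.succ = p by omega, hf]; rfl
    have hfrow' : ∀ t v, v ∈ row → f^[t] v ∈ row := by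
      intro t
      induction t with
      | zero => intro v hv; exact hv
      | succ t ih => intro v hv; rw [Function.iterate_succ']; exact hfrow _ (ih v hv)
    have hxrow : x ∈ row := by
      simp only [hrow, Finset.mem_image, Finset.mem_range]
      exact ⟨0, hp.out.pos, rfl⟩
    let cnt : List V → ℕ := fun l => l.countP (fun v => decide (v ∈ row))
    let C : ℕ → Submodule F (List V →₀ F) := fun j => Finsupp.supported F F {l | j ≤ cnt l}
    have hCcons : ∀ j y, y ∈ C j → consL F x y ∈ C (j+1) := by
      intro j y hy
      refine map_supported _ ?_ hy
      intro l hl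
      rw [consL_single]
      refine single_mem ?_ _
      have hl' : j ≤ cnt l := hl
      show j + 1 ≤ cnt (x :: l)
      simp only [cnt, List.countP_cons, hxrow] at hl' ⊢
      simpa using hl'
    have hCact : ∀ j t y, y ∈ C j → act F (f^[t]) y ∈ C j := by
      intro j t y hy
      refine map_supported _ ?_ hy
      intro l hl
      rw [act_single]
      refine single_mem ?_ _
      have hl' : j ≤ cnt l := hl
      refine hl'.trans ?_
      show cnt l ≤ cnt (l.map _)
      simp only [cnt, List.countP_map]
      apply List.countP_mono_left
      intro v _ hv
      simp only [Function.comp, decide_eq_true_eq] at hv ⊢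
      exact hfrow' t v hv
    have hCZ : ∀ j a y, y ∈ C j → Zop F p f a y ∈ C j := by
      intro j a y hy
      by_cases h : Odd a
      · simp only [Zop, h, if_true, LinearMap.sub_apply, LinearMap.id_apply]
        exact Submodule.sub_mem _ (hCact j 1 y hy) hy
      · simp only [Zop, h, if_false, LinearMap.sum_apply]
        exact Submodule.sum_mem _ fun t _ => hCact j t y hy
    let I : ℕ → Submodule F (Lam F V) := fun j => (C j).map (q F)
    have hImul : ∀ j y, y ∈ I j → iv F x * y ∈ I (j+1) := by
      rintro j _ ⟨y, hy, rfl⟩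
      rw [← q_cons]
      exact Submodule.mem_map_of_mem (hCcons j y hy)
    have hIZ : ∀ j a y, y ∈ I j → ZL F p f a y ∈ I j := by
      rintro j a _ ⟨y, hy, rfl⟩
      rw [← q_Zop]
      exact Submodule.mem_map_of_mem (hCZ j a y hy)
    have hItop : ∀ y ∈ I (p+1), y = 0 := by
      rintro _ ⟨y, hy, rfl⟩
      refine q_eq_zero ?_ hy
      intro l hl hnd
      have hl' : p + 1 ≤ cnt l := hl
      have h1 : cnt l ≤ row.card := by
        simp only [cnt, List.countP_eq_length_filter]
        rw [← List.toFinset_card_of_nodup (hnd.filter _)]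
        apply Finset.card_le_card
        intro v hv
        simpa using (List.mem_filter.1 (List.mem_toFinset.1 hv)).2
      have h2 : row.card ≤ p := Finset.card_image_le.trans (by simp)
      omega
    have hC1 : ∀ a, BL F p f (x :: x') a ∈ C 1 := by
      intro a
      have h0 : ∀ y : List V →₀ F, y ∈ C 0 := by
        intro y
        have : {l : List V | 0 ≤ cnt l} = Set.univ := by ext; simp
        simp only [C, this, Finsupp.supported_univ, Submodule.mem_top]
      cases a with
      | zero => rw [BL]; exact hCcons 0 _ (h0 _)
      | succ a => rw [BL]; exact hCcons 0 _ (h0 _)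
    have hZmul : ∀ a y, ZL F p f a (y * Ω) = ZL F p f a y * Ω := by
      intro a y
      by_cases h : Odd a
      · simp only [ZL, h, if_true, LinearMap.sub_apply, LinearMap.id_apply, AlgHom.toLinearMap_apply, map_mul, hΩf, sub_mul]
      · simp only [ZL, h, if_false, LinearMap.sum_apply, AlgHom.toLinearMap_apply, map_mul, mapf_iter f _ _ hΩf, Finset.sum_mul]
    have claim : ∀ c, q F (BL F p f (x :: x') (L * (p - 1) + c)) - ((-1 : F) ^ L) ^ c • (Rr F p f x c * Ω) ∈ I (c + 2) := by
      intro c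
      induction c with
      | zero =>
        rw [add_zero, pow_zero, one_smul, Rr]
        rcases hM : L * (p - 1) with _ | M
        · rw [BL, q_cons, hΩ, hM, sub_self]; exact Submodule.zero_mem _
        · rw [BL, q_cons, ← hM, map_add, mul_add, ← hΩ, add_sub_cancel_left]
          refine hImul 1 _ (Submodule.mem_map_of_mem ?_)
          exact Submodule.smul_mem _ _ (hCZ _ _ _ (hC1 _))
      | succ c ihc =>
        rw [← add_assoc, BL, q_cons, map_add, mul_add, BL_top_zero hp.out.pos hf x' _ (by rw [hx]; omega), mul_zero, zero_add,
          map_smul, q_Zop, Rr, hx]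
        rw [add_assoc (L * (p-1)), ZL_period]
        have h := hImul _ _ (Submodule.smul_mem _ ((-1 : F) ^ L) (hIZ _ (c+1) _ ihc))
        rw [map_sub, map_smul, hZmul, smul_sub, smul_smul, mul_sub] at h
        rw [pow_succ', mul_assoc]
        convert h using 2
        simp
    have hfin := hItop _ (by
      have := claim (p - 1)
      rwa [show p - 1 + 2 = p + 1 by have := hp.out.pos; omega] at this)
    rw [show (L + 1) * (p - 1) = L * (p - 1) + (p - 1) by ring]
    rw [sub_eq_zero.1 hfin, hR f hf x, hΩ, hΩ', List.map_cons, List.prod_cons, smul_mul_smul_comm, smul_smul, mul_assoc]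

lemma prod_swap (l l' : List V) : (l.map (iv F)).prod * (l'.map (iv F)).prod =
    (-1 : F) ^ (l.length * l'.length) • ((l'.map (iv F)).prod * (l.map (iv F)).prod) := by
  have hmove : ∀ (l : List V) (w : V), (l.map (iv F)).prod * iv F w = (-1 : F) ^ l.length • (iv F w * (l.map (iv F)).prod) := by
    intro l w
    induction l with
    | nil => simp
    | cons v l ih =>
      rw [List.map_cons, List.prod_cons, mul_assoc, ih, mul_smul_comm, ← mul_assoc, iv_anti v w, neg_mul, mul_assoc,
        List.length_cons, pow_succ]
      simp
  induction l' with
  | nil => simp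
  | cons w l' ih =>
    rw [List.map_cons, List.prod_cons, ← mul_assoc, hmove, smul_mul_assoc, mul_assoc, ih, mul_smul_comm, smul_smul, mul_assoc,
      List.length_cons, Nat.mul_succ, pow_add, mul_comm ((-1 : F) ^ l.length)]

/-- the algebra map sending each generator to its row product -/
noncomputable def Psi (F : Type*) [Field F] {V : Type*} (p : ℕ) [hp : Fact p.Prime] [CharP F p] (f : V → V) : Lam F V →ₐ[F] Lam F V :=
  ExteriorAlgebra.lift F ⟨Finsupp.linearCombination F (varpi F p f), by
    have hsw : ∀ y w, varpi F p f y * varpi F p f w = - (varpi F p f w * varpi F p f y) := by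
      intro y w
      have := prod_swap (F := F) ((List.range p).map (fun t => f^[t] y)) ((List.range p).map (fun t => f^[t] w))
      rw [← seqP_eq, ← seqP_eq] at this
      simp only [List.length_map, List.length_range, pow_mul, neg_one_pow_p p, neg_one_smul] at this
      exact this
    have hsq : ∀ y, varpi F p f y * varpi F p f y = 0 := by
      intro y
      have := prod_not_nodup (F := F) ((List.range p).map (fun t => f^[t] y) ++ (List.range p).map (fun t => f^[t] y)) ?_
      · rwa [List.map_append, List.prod_append, ← seqP_eq] at this
      · intro h
        rw [List.nodup_append] at h
        have hy : y ∈ (List.range p).map (fun t => f^[t] y) := List.mem_map.2 ⟨0, List.mem_range.2 hp.out.pos, rfl⟩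
        exact h.2.2 y hy y hy rfl
    have hsw2 : ∀ y m, varpi F p f y * Finsupp.linearCombination F (varpi F p f) m =
        - (Finsupp.linearCombination F (varpi F p f) m * varpi F p f y) := by
      intro y m
      induction m using Finsupp.induction_linear with
      | zero => simp
      | add a b ha hb => rw [map_add, mul_add, add_mul, ha, hb]; abel
      | single w c => rw [Finsupp.linearCombination_single, mul_smul_comm, smul_mul_assoc, hsw, smul_neg]
    intro m
    induction m using Finsupp.induction with
    | zero => simp
    | single_add w c m _ _ ih =>
      rw [map_add, mul_add, add_mul, add_mul, ih, Finsupp.linearCombination_single, smul_mul_assoc, smul_mul_assoc, mul_smul_comm, mul_smul_comm,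
        hsq, hsw2]
      simp⟩

@[simp] lemma Psi_iv (p : ℕ) [hp : Fact p.Prime] [CharP F p] (f : V → V) (v : V) :
    Psi F p f (iv F v) = varpi F p f v := by
  simp [Psi, iv]

noncomputable def BB (F : Type*) [Field F] {V : Type*} (p : ℕ) (f : ℕ → V → V) (m : ℕ → ℕ) : ℕ → (List V →₀ F) →ₗ[F] (List V →₀ F)
  | 0 => LinearMap.id
  | k + 1 => B F p (f k) (m k) ∘ₗ BB F p f m k

def flat {V : Type*} (p : ℕ) (f : ℕ → V → V) : ℕ → List V → List V
  | 0, x => x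
  | k + 1, x => (flat p f k x).flatMap (fun y => (List.range p).map (fun t => (f k)^[t] y))

noncomputable def PsiK (F : Type*) [Field F] {V : Type*} (p : ℕ) [hp : Fact p.Prime] [CharP F p] (f : ℕ → V → V) : ℕ → (Lam F V →ₐ[F] Lam F V)
  | 0 => AlgHom.id F _
  | k + 1 => (Psi F p (f k)).comp (PsiK F p f k)

lemma PsiK_prod (p : ℕ) [hp : Fact p.Prime] [CharP F p] (f : ℕ → V → V) (k : ℕ) (x : List V) :
    PsiK F p f k (x.map (iv F)).prod = ((flat p f k x).map (iv F)).prod := by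
  induction k with
  | zero => rfl
  | succ k ih =>
    rw [PsiK, AlgHom.comp_apply, ih, flat]
    generalize flat p f k x = l
    induction l with
    | nil => simp
    | cons y l ihl =>
      rw [List.map_cons, List.prod_cons, map_mul, ihl, Psi_iv, List.flatMap_cons, List.map_append, List.prod_append, varpi, seqP_eq]

lemma BB_mem (p : ℕ) (f : ℕ → V → V) (m : ℕ → ℕ) (k n : ℕ) (S : Set V) (hS : ∀ l < k, ∀ v ∈ S, f l v ∈ S) {x : List V →₀ F}
    (hx : x ∈ Finsupp.supported F F {l' : List V | l'.length = n ∧ ∀ v ∈ l', v ∈ S}) :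
    BB F p f m k x ∈ Finsupp.supported F F {l' : List V | l'.length = n + ∑ l ∈ Finset.range k, m l ∧ ∀ v ∈ l', v ∈ S} := by
  induction k with
  | zero => simpa [BB] using hx
  | succ k ih =>
    have := B_mem p (f k) _ (m k) S (hS k (by omega)) (ih (fun l hl => hS l (by omega)))
    rw [Finset.sum_range_succ, ← add_assoc]
    exact this

theorem BB_eval (F : Type*) [Field F] (V : Type*) (p : ℕ) [hp : Fact p.Prime] [CharP F p] (L k : ℕ) :
    ∃ s : F, s ≠ 0 ∧ ∀ (f : ℕ → V → V), (∀ l, (f l)^[p] = id) → ∀ x ∈ Finsupp.supported F F {l' : List V | l'.length = L},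
      q F (BB F p f (fun l => L * p ^ l * (p - 1)) k x) = s • PsiK F p f k (q F x) := by
  induction k with
  | zero => exact ⟨1, one_ne_zero, fun f _ x _ => by simp [BB, PsiK]⟩
  | succ k ih =>
    obtain ⟨s, hs, ih⟩ := ih
    obtain ⟨s', hs', hrow⟩ := row_lemma F V p (L * p ^ k)
    refine ⟨s' * s, mul_ne_zero hs' hs, fun f hf x hx => ?_⟩
    have hx' := BB_mem (F := F) p f (fun l => L * p ^ l * (p - 1)) k L Set.univ (by simp) (x := x) (by simpa using hx)
    have hlen : L + ∑ l ∈ Finset.range k, L * p ^ l * (p - 1) = L * p ^ k := by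
      clear hx' hx ih hrow
      obtain ⟨m, rfl⟩ : ∃ m, p = m + 1 := ⟨p - 1, by have := hp.out.pos; omega⟩
      induction k with
      | zero => simp
      | succ k ih =>
        rw [Finset.sum_range_succ, ← add_assoc, ih]; simp only [Nat.add_sub_cancel]; ring
    rw [hlen] at hx'
    have key : ∀ y ∈ Finsupp.supported F F {l' : List V | l'.length = L * p ^ k ∧ ∀ v ∈ l', v ∈ Set.univ},
        q F (B F p (f k) (L * p ^ k * (p - 1)) y) = s' • Psi F p (f k) (q F y) := by
      intro y hy
      have := map_supported (q F ∘ₗ B F p (f k) (L * p ^ k * (p - 1)) - s' • (Psi F p (f k)).toLinearMap ∘ₗ q F) (T := ⊥) ?_ hy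
      · simpa [sub_eq_zero] using this
      · rintro l ⟨hl, -⟩
        simp only [LinearMap.sub_apply, LinearMap.comp_apply, LinearMap.smul_apply, AlgHom.toLinearMap_apply, B_single, q_single, one_smul,
          hrow (f k) (hf k) l hl, Submodule.mem_bot]
        rw [map_list_prod, List.map_map, sub_eq_zero]
        congr 3
        funext v; simp
    rw [BB, LinearMap.comp_apply, key _ hx', ih f hf x hx, map_smul, smul_smul, PsiK, AlgHom.comp_apply]

end row
end DT


namespace DT

section dop
open Classical in
/-- number of nonzero signs -/
noncomputable def nz {N : ℕ} (σ : Fin N → SignType) : ℕ := (Finset.univ.filter (fun i => σ i ≠ 0)).card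

def upd {N : ℕ} (σ : Fin N → SignType) (i : Fin N) : Fin N → SignType := Function.update σ i 0

lemma upd_self {N : ℕ} (σ : Fin N → SignType) (i : Fin N) : upd σ i i = 0 := by simp [upd]
lemma upd_ne {N : ℕ} (σ : Fin N → SignType) {i j : Fin N} (h : j ≠ i) : upd σ i j = σ j := by simp [upd, h]

lemma nz_upd {N : ℕ} {σ : Fin N → SignType} {i : Fin N} (h : σ i ≠ 0) : nz σ = nz (upd σ i) + 1 := by
  classical
  unfold nz
  have : (Finset.univ.filter (fun j => upd σ i j ≠ 0)) = (Finset.univ.filter (fun j => σ j ≠ 0)).erase i := by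
    ext j
    by_cases hj : j = i
    · subst hj; simp only [Finset.mem_filter, Finset.mem_univ, true_and, Finset.mem_erase, upd_self]; simp
    · simp only [Finset.mem_filter, Finset.mem_univ, true_and, Finset.mem_erase, upd_ne σ hj]; simp [hj]
  rw [this, Finset.card_erase_of_mem (by simpa using h)]
  have : 0 < (Finset.univ.filter (fun j => σ j ≠ 0)).card := Finset.card_pos.2 ⟨i, by simpa using h⟩
  omega

variable {F : Type*} [Field F] {V : Type*} {N : ℕ}

def sg (F : Type*) [Field F] (s : SignType) : F := (s : F)

open Classical in
noncomputable def zb {N : ℕ} (σ : Fin N → SignType) (i : Fin N) : ℕ := (Finset.univ.filter (fun j => j < i ∧ σ j = 0)).card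

open Classical in
noncomputable def coef (F : Type*) [Field F] {N : ℕ} (Face : (Fin N → SignType) → Prop) (σ : Fin N → SignType) (i : Fin N) : F :=
  if σ i ≠ 0 ∧ Face (upd σ i) then sg F (σ i) * (-1) ^ zb σ i else 0

lemma coef_ne {Face : (Fin N → SignType) → Prop} {σ : Fin N → SignType} {i : Fin N} (h : coef F Face σ i ≠ 0) :
    σ i ≠ 0 ∧ Face (upd σ i) := by
  by_contra hn
  exact h (by simp only [coef, hn, if_false])


lemma upd_comm (σ : Fin N → SignType) (i j : Fin N) : upd (upd σ i) j = upd (upd σ j) i := by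
  funext t; simp only [upd, Function.update_apply]; split_ifs <;> rfl

lemma zb_upd_lt {σ : Fin N → SignType} {i j : Fin N} (h : i < j) (hi : σ i ≠ 0) : zb (upd σ i) j = zb σ j + 1 := by
  classical
  unfold zb
  have : (Finset.univ.filter (fun t => t < j ∧ upd σ i t = 0)) = insert i (Finset.univ.filter (fun t => t < j ∧ σ t = 0)) := by
    ext t
    by_cases ht : t = i
    · subst ht; simp only [Finset.mem_filter, Finset.mem_univ, true_and, Finset.mem_insert, upd_self]; simp [h]
    · simp only [Finset.mem_filter, Finset.mem_univ, true_and, Finset.mem_insert, upd_ne σ ht]; simp [ht]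
  rw [this, Finset.card_insert_of_notMem (by simp [hi])]

lemma zb_upd_gt {σ : Fin N → SignType} {i j : Fin N} (h : i < j) : zb (upd σ j) i = zb σ i := by
  classical
  unfold zb
  congr 1
  ext t
  simp only [Finset.mem_filter, Finset.mem_univ, true_and]
  constructor
  · rintro ⟨h1, h2⟩
    rw [upd_ne σ (by rintro rfl; exact absurd h1 (not_lt.2 h.le))] at h2
    exact ⟨h1, h2⟩
  · rintro ⟨h1, h2⟩
    rw [upd_ne σ (by rintro rfl; exact absurd h1 (not_lt.2 h.le))]
    exact ⟨h1, h2⟩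

/-- extension property of faces -/
def FP {N : ℕ} (Face : (Fin N → SignType) → Prop) : Prop :=
  ∀ σ τ, Face τ → (∀ i, τ i ≠ 0 → σ i = τ i) → Face σ

lemma FP.upd {Face : (Fin N → SignType) → Prop} (h : FP Face) {σ : Fin N → SignType} {i : Fin N} (hf : Face (DT.upd σ i)) : Face σ := by
  refine h _ _ hf fun j hj => ?_
  by_cases hji : j = i
  · subst hji; simp [DT.upd] at hj
  · rw [upd_ne _ hji]

lemma coef_coef_lt {Face : (Fin N → SignType) → Prop} (h : FP Face) (σ : Fin N → SignType) {i j : Fin N} (hij : i < j) :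
    coef F Face σ i * coef F Face (upd σ i) j = - (coef F Face σ j * coef F Face (upd σ j) i) := by
  have e1 : upd σ i j = σ j := upd_ne σ hij.ne'
  have e2 : upd σ j i = σ i := upd_ne σ hij.ne
  by_cases hc : σ i ≠ 0 ∧ σ j ≠ 0 ∧ Face (upd (upd σ i) j)
  · obtain ⟨h1, h2, h3⟩ := hc
    have h4 : Face (upd σ i) := h.upd h3
    have h3' := h3
    rw [upd_comm] at h3'
    have h5 : Face (upd σ j) := h.upd h3'
    simp only [coef, h1, h2, h3, h4, h5, e1, e2, h3', ne_eq, not_false_eq_true, and_self, if_true, zb_upd_lt hij h1, zb_upd_gt hij, pow_succ]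
    ring
  · have l1 : coef F Face σ i * coef F Face (upd σ i) j = 0 := by
      by_contra hne
      have a1 := coef_ne (left_ne_zero_of_mul hne)
      have a2 := coef_ne (right_ne_zero_of_mul hne)
      exact hc ⟨a1.1, by rw [← e1]; exact a2.1, a2.2⟩
    have l2 : coef F Face σ j * coef F Face (upd σ j) i = 0 := by
      by_contra hne
      have a1 := coef_ne (left_ne_zero_of_mul hne)
      have a2 := coef_ne (right_ne_zero_of_mul hne)
      exact hc ⟨by rw [← e2]; exact a2.1, a1.1, by rw [upd_comm]; exact a2.2⟩
    rw [l1, l2, neg_zero]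

lemma coef_coef_self {Face : (Fin N → SignType) → Prop} (σ : Fin N → SignType) (i : Fin N) :
    coef F Face σ i * coef F Face (upd σ i) i = 0 := by
  by_contra hne
  have a2 := coef_ne (right_ne_zero_of_mul hne)
  exact a2.1 (upd_self σ i)

lemma coef_coef {Face : (Fin N → SignType) → Prop} (h : FP Face) (σ : Fin N → SignType) (i j : Fin N) :
    coef F Face σ i * coef F Face (upd σ i) j = - (coef F Face σ j * coef F Face (upd σ j) i) := by
  rcases lt_trichotomy i j with hij | rfl | hij
  · exact coef_coef_lt h σ hij
  · rw [coef_coef_self, neg_zero]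
  · rw [coef_coef_lt h σ hij, neg_neg]

lemma coef_sum_sum {Face : (Fin N → SignType) → Prop} (h : FP Face) {E : Type*} [AddCommGroup E] [Module F E]
    (σ : Fin N → SignType) (g : (Fin N → SignType) → E) :
    ∑ i, coef F Face σ i • ∑ j, coef F Face (upd σ i) j • g (upd (upd σ i) j) = 0 := by
  simp only [Finset.smul_sum, smul_smul]
  apply antisym_sum
  · intro i _; rw [coef_coef_self, zero_smul]
  · intro i _ j _; rw [coef_coef h σ i j, upd_comm σ i j, neg_smul]

abbrev Ix (N : ℕ) := (Fin N → SignType) × (ℕ → ℕ)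

noncomputable def DS (F : Type*) [Field F] (V : Type*) {N : ℕ} (Face : (Fin N → SignType) → Prop) :
    (Ix N → (List V →₀ F)) →ₗ[F] (Ix N → (List V →₀ F)) where
  toFun Θ := fun j => ∑ i, coef F Face j.1 i • Θ (upd j.1 i, j.2)
  map_add' a b := by funext j; simp [Finset.sum_add_distrib]
  map_smul' c a := by
    funext j
    simp only [Pi.smul_apply, RingHom.id_apply, Finset.smul_sum]
    exact Finset.sum_congr rfl fun i _ => smul_comm _ _ _

def dec (m : ℕ → ℕ) (l : ℕ) : ℕ → ℕ := Function.update m l (m l - 1)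

noncomputable def sgl (F : Type*) [Field F] {N : ℕ} (n l : ℕ) (j : Ix N) : F :=
  (-1) ^ (nz j.1 + n + 1 + ∑ i ∈ Finset.range l, j.2 i)

noncomputable def DL {F : Type*} [Field F] {V : Type*} {N : ℕ} (p n : ℕ) (f : ℕ → V → V) (l : ℕ) :
    (Ix N → (List V →₀ F)) →ₗ[F] (Ix N → (List V →₀ F)) where
  toFun Θ := fun j => if j.2 l = 0 then 0 else sgl F n l j • Zop F p (f l) (j.2 l) (Θ (j.1, dec j.2 l))
  map_add' a b := by
    funext j
    by_cases h : j.2 l = 0 <;> simp [h]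
  map_smul' c a := by
    funext j
    by_cases h : j.2 l = 0
    · simp [h]
    · simp only [h, if_false, Pi.smul_apply, RingHom.id_apply, map_smul]; exact smul_comm _ _ _

lemma dec_self (m : ℕ → ℕ) (l : ℕ) : dec m l l = m l - 1 := by simp [dec]
lemma dec_ne (m : ℕ → ℕ) {l l' : ℕ} (h : l' ≠ l) : dec m l l' = m l' := by simp [dec, h]
lemma dec_comm (m : ℕ → ℕ) {l l' : ℕ} (h : l' ≠ l) : dec (dec m l) l' = dec (dec m l') l := by
  funext t
  simp only [dec, Function.update_apply]
  split_ifs <;> simp_all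
lemma sum_dec (m : ℕ → ℕ) {l k : ℕ} (hl : l < k) (h : m l ≠ 0) :
    ∑ i ∈ Finset.range k, m i = ∑ i ∈ Finset.range k, dec m l i + 1 := by
  rw [← Finset.add_sum_erase _ _ (Finset.mem_range.2 hl), ← Finset.add_sum_erase _ (dec m l) (Finset.mem_range.2 hl), dec_self]
  have : ∑ x ∈ (Finset.range k).erase l, dec m l x = ∑ x ∈ (Finset.range k).erase l, m x :=
    Finset.sum_congr rfl fun x hx => dec_ne m (Finset.ne_of_mem_erase hx)
  rw [this]; omega
lemma sum_dec_ge (m : ℕ → ℕ) {l k : ℕ} (hl : k ≤ l) :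
    ∑ i ∈ Finset.range k, dec m l i = ∑ i ∈ Finset.range k, m i :=
  Finset.sum_congr rfl fun x hx => dec_ne m (by have := Finset.mem_range.1 hx; omega)

variable {Face : (Fin N → SignType) → Prop}

lemma DS_DS (h : FP Face) (Θ : Ix N → (List V →₀ F)) : DS F V Face (DS F V Face Θ) = 0 := by
  funext j
  exact coef_sum_sum h j.1 (fun σ => Θ (σ, j.2))

lemma DS_DL (p n : ℕ) (f : ℕ → V → V) (l : ℕ) (Θ : Ix N → (List V →₀ F)) :
    DS F V Face (DL p n f l Θ) = - DL p n f l (DS F V Face Θ) := by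
  funext j
  simp only [DS, DL, LinearMap.coe_mk, AddHom.coe_mk, Pi.neg_apply]
  by_cases h : j.2 l = 0
  · simp [h]
  · simp only [h, if_false, map_sum, map_smul, Finset.smul_sum]
    rw [← Finset.sum_neg_distrib]
    refine Finset.sum_congr rfl fun i _ => ?_
    by_cases hc : coef F Face j.1 i = 0
    · simp [hc]
    · have := nz_upd (coef_ne hc).1
      rw [smul_comm, ← neg_smul]
      congr 1
      simp only [sgl, this]
      rw [show nz (upd j.1 i) + 1 + n + 1 + ∑ i ∈ Finset.range l, j.2 i = nz (upd j.1 i) + n + 1 + ∑ i ∈ Finset.range l, j.2 i + 1 by ring, pow_succ]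
      ring

lemma DL_DL_self (p n : ℕ) (f : ℕ → V → V) (hf : ∀ l, (f l)^[p] = id) (l : ℕ) (Θ : Ix N → (List V →₀ F)) :
    DL p n f l (DL p n f l Θ) = 0 := by
  funext j
  simp only [DL, LinearMap.coe_mk, AddHom.coe_mk, Pi.zero_apply]
  by_cases h : j.2 l = 0
  · simp [h]
  · simp only [h, if_false, dec_self]
    by_cases h2 : j.2 l - 1 = 0
    · simp [h2]
    · simp only [h2, if_false, map_smul]
      obtain ⟨a, ha⟩ : ∃ a, j.2 l = a + 1 := ⟨j.2 l - 1, by omega⟩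
      rw [ha, Nat.add_sub_cancel, Zop_Zop (hf l), smul_zero, smul_zero]

lemma DL_DL_lt (p n : ℕ) (f : ℕ → V → V) (hfc : ∀ l l', Function.Commute (f l) (f l')) {l l' : ℕ} (hl : l < l') (Θ : Ix N → (List V →₀ F)) :
    DL p n f l (DL p n f l' Θ) = - DL p n f l' (DL p n f l Θ) := by
  funext j
  simp only [DL, LinearMap.coe_mk, AddHom.coe_mk, Pi.neg_apply, dec_ne j.2 hl.ne, dec_ne j.2 hl.ne']
  by_cases h : j.2 l = 0
  · simp [h]
  by_cases h' : j.2 l' = 0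
  · simp [h']
  simp only [h, h', if_false, map_smul, smul_smul, dec_comm j.2 hl.ne]
  rw [Zop_comm (hfc l l'), ← neg_smul]
  congr 1
  simp only [sgl, sum_dec_ge j.2 hl.le, sum_dec j.2 hl h]
  rw [← add_assoc, pow_succ]
  ring

noncomputable def DD {F : Type*} [Field F] {V : Type*} {N : ℕ} (Face : (Fin N → SignType) → Prop) (p n k : ℕ) (f : ℕ → V → V) :
    (Ix N → (List V →₀ F)) →ₗ[F] (Ix N → (List V →₀ F)) :=
  DS F V Face + ∑ l ∈ Finset.range k, DL p n f l

lemma DD_DD (h : FP Face) (p n k : ℕ) (f : ℕ → V → V) (hf : ∀ l, (f l)^[p] = id) (hfc : ∀ l l', Function.Commute (f l) (f l'))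
    (Θ : Ix N → (List V →₀ F)) : DD Face p n k f (DD Face p n k f Θ) = 0 := by
  simp only [DD, LinearMap.add_apply, LinearMap.sum_apply, map_add, map_sum, DS_DS h, DS_DL, Finset.sum_neg_distrib]
  have : ∑ x ∈ Finset.range k, ∑ c ∈ Finset.range k, DL p n f c (DL p n f x Θ) = 0 := by
    apply antisym_sum
    · intro i _; exact DL_DL_self p n f hf i Θ
    · intro i _ j _
      rcases lt_trichotomy i j with hij | rfl | hij
      · rw [DL_DL_lt p n f hfc hij, neg_neg]
      · rw [DL_DL_self p n f hf]; simp
      · rw [DL_DL_lt p n f hfc hij]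
  simp only [Finset.sum_add_distrib]
  rw [this, Finset.sum_neg_distrib]
  abel

lemma DD_bd (p n k : ℕ) (f : ℕ → V → V) (Θ : Ix N → (List V →₀ F)) :
    DD Face p n k f (fun j => bd F (Θ j)) = fun j => bd F (DD Face p n k f Θ j) := by
  funext j
  simp only [DD, LinearMap.add_apply, LinearMap.sum_apply, Pi.add_apply, Finset.sum_apply, map_add, map_sum]
  congr 1
  · simp [DS]
  · refine Finset.sum_congr rfl fun l _ => ?_
    by_cases h : j.2 l = 0 <;> simp [DL, h, bd_Zop]

noncomputable def tot (k : ℕ) (m : ℕ → ℕ) : ℕ := ∑ i ∈ Finset.range k, m i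

lemma Zop_mem (p : ℕ) {f : V → V} {S : Set (List V)} (hS : ∀ l ∈ S, l.map f ∈ S) (a : ℕ) {x : List V →₀ F}
    (hx : x ∈ Finsupp.supported F F S) : Zop F p f a x ∈ Finsupp.supported F F S := by
  have hact : ∀ t, act F (f^[t]) x ∈ Finsupp.supported F F S := by
    intro t
    refine map_supported _ ?_ hx
    intro l hl
    rw [act_single]
    refine single_mem ?_ _
    clear hx
    induction t with
    | zero => simpa using hl
    | succ t ih => rw [Function.iterate_succ', ← List.map_map]; exact hS _ ih
  by_cases h : Odd a
  · simp only [Zop, h, if_true, LinearMap.sub_apply, LinearMap.id_apply]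
    exact Submodule.sub_mem _ (hact 1) hx
  · simp only [Zop, h, if_false, LinearMap.sum_apply]
    exact Submodule.sum_mem _ fun t _ => hact t

/-- specialised lifting lemma -/
theorem lift_D (h : FP Face) (p n k : ℕ) (f : ℕ → V → V) (hf : ∀ l, (f l)^[p] = id)
    (hfc : ∀ l l', Function.Commute (f l) (f l')) (hnz : ∀ σ, Face σ → n + 1 ≤ nz σ)
    (A : (Fin N → SignType) → ℕ → Set (List V)) (e : ℕ)
    (hAmono : ∀ σ i L, A (upd σ i) L ⊆ A σ L)
    (hAf : ∀ σ L l, ∀ x ∈ A σ L, x.map (f l) ∈ A σ L)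
    (hAex : ∀ σ L, Face σ → L < nz σ + e → ∀ c ∈ Finsupp.supported F F (A σ L), bd F c = 0 → ∃ b ∈ Finsupp.supported F F (A σ (L+1)), bd F b = c)
    (β : Ix N → (List V →₀ F)) (s : F)
    (hβ : ∀ σ m, Face σ → tot k m ≤ n → β (σ, m) ∈ Finsupp.supported F F (A σ (nz σ + tot k m - n + e - 1)))
    (hβ' : ∀ σ m, Face σ → tot k m ≤ n → bd F (β (σ, m)) = - (s • DD Face p n k f β (σ, m))) :
    ∃ Θ : Ix N → (List V →₀ F), ∀ σ m, Face σ → tot k m ≤ n →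
      Θ (σ, m) ∈ Finsupp.supported F F (A σ (nz σ + tot k m - n + e)) ∧
      bd F (Θ (σ, m)) = s • DD Face p n k f Θ (σ, m) + β (σ, m) := by
  have key := exists_lift (F := F) (bd F) (fun j : Ix N => nz j.1 + tot k j.2) (fun j => Face j.1 ∧ tot k j.2 ≤ n) (DD Face p n k f)
    (fun j => Finsupp.supported F F (A j.1 (nz j.1 + tot k j.2 - n + e)))
    (fun j => Finsupp.supported F F (A j.1 (nz j.1 + tot k j.2 - n + e - 1)))
    ?_ ?_ (DD_bd p n k f) (fun Θ j _ => by rw [DD_DD h p n k f hf hfc]; rfl) ?_ ?_ β s ?_ ?_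
  · obtain ⟨Θ, hΘ⟩ := key
    exact ⟨Θ, fun σ m h1 h2 => hΘ (σ, m) ⟨h1, h2⟩⟩
  · rintro ⟨σ, m⟩ Θ Θ' ⟨h1, h2⟩ heq
    simp only [DD, LinearMap.add_apply, LinearMap.sum_apply, Pi.add_apply, Finset.sum_apply]
    congr 1
    · simp only [DS, LinearMap.coe_mk, AddHom.coe_mk]
      refine Finset.sum_congr rfl fun i _ => ?_
      by_cases hc : coef F Face σ i = 0
      · simp [hc]
      · obtain ⟨c1, c2⟩ := coef_ne hc
        rw [heq (upd σ i, m) ⟨c2, h2⟩ (by simp only [nz_upd c1]; omega)]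
    · refine Finset.sum_congr rfl fun l hl => ?_
      simp only [DL, LinearMap.coe_mk, AddHom.coe_mk]
      by_cases hm : m l = 0
      · simp [hm]
      · have := sum_dec m (Finset.mem_range.1 hl) hm
        rw [heq (σ, dec m l) ⟨h1, by simp only [tot] at h2 ⊢; omega⟩ (by simp only [tot]; omega)]
  · rintro ⟨σ, m⟩ Θ ⟨h1, h2⟩ hmem
    simp only [DD, LinearMap.add_apply, LinearMap.sum_apply, Pi.add_apply, Finset.sum_apply]
    have hn := hnz σ h1
    refine Submodule.add_mem _ ?_ (Submodule.sum_mem _ fun l hl => ?_)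
    · simp only [DS, LinearMap.coe_mk, AddHom.coe_mk]
      refine Submodule.sum_mem _ fun i _ => ?_
      by_cases hc : coef F Face σ i = 0
      · simp [hc]
      · obtain ⟨c1, c2⟩ := coef_ne hc
        have hh := nz_upd c1
        have hn' := hnz _ c2
        have := hmem (upd σ i, m) ⟨c2, h2⟩ (by simp only [hh]; omega)
        refine Submodule.smul_mem _ _ (Finsupp.supported_mono ?_ this)
        simp only
        rw [show nz (upd σ i) + tot k m - n + e = nz σ + tot k m - n + e - 1 by omega]
        exact hAmono σ i _
    · simp only [DL, LinearMap.coe_mk, AddHom.coe_mk]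
      by_cases hm : m l = 0
      · simp [hm]
      · have := sum_dec m (Finset.mem_range.1 hl) hm
        have hmm := hmem (σ, dec m l) ⟨h1, by simp only [tot] at h2 ⊢; omega⟩ (by simp only [tot]; omega)
        simp only [hm, if_false]
        refine Submodule.smul_mem _ _ (Zop_mem p (hAf σ _ l) _ ?_)
        convert hmm using 3
        simp only [tot]; omega
  · rintro ⟨σ, m⟩ ⟨h1, h2⟩ c hc hb
    have hn := hnz σ h1
    simp only at h2
    have := hAex σ (nz σ + tot k m - n + e - 1) h1 (by omega) c hc hb
    rwa [show nz σ + tot k m - n + e - 1 + 1 = nz σ + tot k m - n + e by omega] at this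
  · refine ⟨N + n + 1, ?_⟩
    rintro ⟨σ, m⟩ ⟨h1, h2⟩
    have : nz σ ≤ N := (Finset.card_le_univ _).trans (by simp)
    simp only at h2 ⊢
    omega
  · rintro ⟨σ, m⟩ ⟨h1, h2⟩; exact hβ σ m h1 h2
  · rintro ⟨σ, m⟩ ⟨h1, h2⟩; exact hβ' σ m h1 h2

end dop
end DT


namespace DT

section theta
variable {F : Type*} [Field F] {V : Type*} {N : ℕ} {Face : (Fin N → SignType) → Prop}

open Classical in
noncomputable def al0 {F : Type*} [Field F] (V : Type*) {N : ℕ} (n : ℕ) (ε : (Fin N → SignType) → F) (σ : Fin N → SignType) : List V →₀ F :=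
  if nz σ = n + 1 then Finsupp.single [] (ε σ) else 0

open Classical in
noncomputable def al {F : Type*} [Field F] (V : Type*) {N : ℕ} (n k : ℕ) (ε : (Fin N → SignType) → F) (j : Ix N) : List V →₀ F :=
  if tot k j.2 = 0 then al0 V n ε j.1 else 0

/-- the cocycle condition on the vertex weights -/
def EpsC {F : Type*} [Field F] {N : ℕ} (Face : (Fin N → SignType) → Prop) (n : ℕ) (ε : (Fin N → SignType) → F) : Prop :=
  ∀ σ, Face σ → nz σ = n + 2 → ∑ i, coef F Face σ i * ε (upd σ i) = 0

lemma bd_nil (c : F) : bd F (Finsupp.single ([] : List V) c) = 0 := by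
  have : (Finsupp.single ([] : List V) c) = c • Finsupp.single [] (1 : F) := by simp
  rw [this, map_smul, bd_single, bdL, smul_zero]

lemma bd_al0 (n : ℕ) (ε : (Fin N → SignType) → F) (σ : Fin N → SignType) : bd F (al0 V n ε σ) = 0 := by
  unfold al0; split_ifs
  · exact bd_nil _
  · simp

lemma sum_al0 {n : ℕ} {ε : (Fin N → SignType) → F} (hε : EpsC Face n ε) {σ : Fin N → SignType} (hσ : Face σ) :
    ∑ i, coef F Face σ i • al0 V n ε (upd σ i) = 0 := by
  by_cases h : nz σ = n + 2
  · have h1 : ∀ i, coef F Face σ i • al0 V n ε (upd σ i) = Finsupp.single [] (coef F Face σ i * ε (upd σ i)) := by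
      intro i
      by_cases hc : coef F Face σ i = 0
      · simp [hc]
      · have := nz_upd (coef_ne hc).1
        have h2 : nz (upd σ i) = n + 1 := by omega
        simp [al0, h2]
    simp only [h1]
    rw [← Finsupp.single_finsetSum, hε σ hσ h, Finsupp.single_zero]
  · refine Finset.sum_eq_zero fun i _ => ?_
    by_cases hc : coef F Face σ i = 0
    · simp [hc]
    · have := nz_upd (coef_ne hc).1
      have h2 : ¬ nz (upd σ i) = n + 1 := by omega
      simp [al0, h2]

lemma Zop_one_nil (p : ℕ) (f : V → V) (c : F) : Zop F p f 1 (Finsupp.single [] c) = 0 := by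
  simp [Zop]

lemma DD_al {n : ℕ} {ε : (Fin N → SignType) → F} (hε : EpsC Face n ε) (p k : ℕ) (f : ℕ → V → V) {σ : Fin N → SignType} (hσ : Face σ) (m : ℕ → ℕ) :
    DD Face p n k f (al V n k ε) (σ, m) = 0 := by
  simp only [DD, LinearMap.add_apply, LinearMap.sum_apply, Pi.add_apply, Finset.sum_apply]
  have h1 : DS F V Face (al V n k ε) (σ, m) = 0 := by
    simp only [DS, LinearMap.coe_mk, AddHom.coe_mk, al]
    by_cases hm : tot k m = 0
    · simp only [hm, if_true]; exact sum_al0 hε hσ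
    · simp [hm]
  rw [h1, zero_add]
  refine Finset.sum_eq_zero fun l hl => ?_
  simp only [DL, LinearMap.coe_mk, AddHom.coe_mk, al]
  by_cases hm : m l = 0
  · simp [hm]
  · simp only [hm, if_false]
    split_ifs with h
    · have hl0 := (Finset.sum_eq_zero_iff.1 h) l hl
      rw [dec_self] at hl0
      have : m l = 1 := by omega
      rw [this]
      unfold al0; split_ifs
      · rw [Zop_one_nil, smul_zero]
      · simp
    · simp

noncomputable def lamF (F : Type*) [Field F] {V : Type*} {N : ℕ} (Face : (Fin N → SignType) → Prop) (n : ℕ) (ε : (Fin N → SignType) → F)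
    (vx : (Fin N → SignType) → V) : ℕ → (Fin N → SignType) → (List V →₀ F)
  | 0, _ => 0
  | t + 1, σ => consL F (vx σ) (al0 V n ε σ + ∑ i, coef F Face σ i • lamF F Face n ε vx t (upd σ i))

noncomputable def lam (F : Type*) [Field F] {V : Type*} {N : ℕ} (Face : (Fin N → SignType) → Prop) (n : ℕ) (ε : (Fin N → SignType) → F)
    (vx : (Fin N → SignType) → V) (σ : Fin N → SignType) : List V →₀ F := lamF F Face n ε vx (nz σ) σ

variable (vx : (Fin N → SignType) → V) {n : ℕ} {ε : (Fin N → SignType) → F}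

lemma lam_eq {σ : Fin N → SignType} (h : 0 < nz σ) :
    lam F Face n ε vx σ = consL F (vx σ) (al0 V n ε σ + ∑ i, coef F Face σ i • lam F Face n ε vx (upd σ i)) := by
  unfold lam
  obtain ⟨t, ht⟩ : ∃ t, nz σ = t + 1 := ⟨nz σ - 1, by omega⟩
  rw [ht, lamF]
  congr 2
  refine Finset.sum_congr rfl fun i _ => ?_
  by_cases hc : coef F Face σ i = 0
  · simp [hc]
  · have := nz_upd (coef_ne hc).1
    rw [show nz (upd σ i) = t by omega]

lemma bd_lam (h : FP Face) (hnz : ∀ σ, Face σ → n + 1 ≤ nz σ) (hε : EpsC Face n ε) :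
    ∀ (t : ℕ) (σ : Fin N → SignType), nz σ = t → Face σ →
    bd F (lam F Face n ε vx σ) = al0 V n ε σ + ∑ i, coef F Face σ i • lam F Face n ε vx (upd σ i) := by
  intro t
  induction t using Nat.strong_induction_on with
  | _ t ih =>
    intro σ ht hσ
    rw [lam_eq vx (by have := hnz σ hσ; omega), bd_cons, sub_eq_self]
    have : bd F (al0 V n ε σ + ∑ i, coef F Face σ i • lam F Face n ε vx (upd σ i)) = 0 := by
      rw [map_add, bd_al0, zero_add, map_sum]
      have h1 : ∀ i, bd F (coef F Face σ i • lam F Face n ε vx (upd σ i)) =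
          coef F Face σ i • al0 V n ε (upd σ i) +
          coef F Face σ i • ∑ j, coef F Face (upd σ i) j • lam F Face n ε vx (upd (upd σ i) j) := by
        intro i
        by_cases hc : coef F Face σ i = 0
        · simp [hc]
        · obtain ⟨c1, c2⟩ := coef_ne hc
          have := nz_upd c1
          rw [map_smul, ih (nz (upd σ i)) (by omega) _ rfl c2, smul_add]
      simp only [h1, Finset.sum_add_distrib, sum_al0 hε hσ, zero_add]
      exact coef_sum_sum h σ _
    rw [this, map_zero]

lemma lam_mem (S : (Fin N → SignType) → Set V) (hS : ∀ σ i, S (upd σ i) ⊆ S σ) (hv : ∀ σ, Face σ → vx σ ∈ S σ)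
    (hnz : ∀ σ, Face σ → n + 1 ≤ nz σ) :
    ∀ (t : ℕ) (σ : Fin N → SignType), nz σ = t → Face σ →
    lam F Face n ε vx σ ∈ Finsupp.supported F F {l : List V | l.length = nz σ - n ∧ ∀ v ∈ l, v ∈ S σ} := by
  intro t
  induction t using Nat.strong_induction_on with
  | _ t ih =>
    intro σ ht hσ
    have hn := hnz σ hσ
    rw [lam_eq vx (by omega)]
    have h1 : al0 V n ε σ + ∑ i, coef F Face σ i • lam F Face n ε vx (upd σ i) ∈
        Finsupp.supported F F {l : List V | l.length = nz σ - n - 1 ∧ ∀ v ∈ l, v ∈ S σ} := by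
      refine Submodule.add_mem _ ?_ (Submodule.sum_mem _ fun i _ => ?_)
      · unfold al0; split_ifs with h
        · refine single_mem ?_ _
          simp [h]
        · simp
      · by_cases hc : coef F Face σ i = 0
        · simp [hc]
        · obtain ⟨c1, c2⟩ := coef_ne hc
          have hh := nz_upd c1
          refine Submodule.smul_mem _ _ (Finsupp.supported_mono ?_ (ih (nz (upd σ i)) (by omega) _ rfl c2))
          rintro l ⟨h1, h2⟩
          exact ⟨by omega, fun v hv => hS σ i (h2 v hv)⟩
    refine map_supported _ ?_ h1
    rintro l ⟨h1, h2⟩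
    rw [consL_single]
    refine single_mem ?_ _
    refine ⟨by simp [h1]; omega, ?_⟩
    intro v hv'
    rcases List.mem_cons.1 hv' with rfl | h
    · exact hv σ hσ
    · exact h2 v h

lemma BB_congr (p : ℕ) (f : ℕ → V → V) {m m' : ℕ → ℕ} (k : ℕ) (h : ∀ l < k, m l = m' l) : BB F p f m k = BB F p f m' k := by
  induction k with
  | zero => rfl
  | succ k ih => rw [BB, BB, ih (fun l hl => h l (by omega)), h k (by omega)]

lemma bd_BB (p : ℕ) (f : ℕ → V → V) (hf : ∀ l, (f l)^[p] = id) (hfc : ∀ l l', Function.Commute (f l) (f l'))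
    (m : ℕ → ℕ) (k L : ℕ) (x : List V →₀ F) (hx : x ∈ Finsupp.supported F F {l : List V | l.length = L}) :
    bd F (BB F p f m k x) = BB F p f m k (bd F x) +
      ∑ l ∈ Finset.range k, if m l = 0 then 0 else (-1 : F) ^ (L + 1 + ∑ i ∈ Finset.range l, m i) • Zop F p (f l) (m l) (BB F p f (dec m l) k x) := by
  induction k with
  | zero => simp [BB]
  | succ k ih =>
    have hmem := BB_mem (F := F) p f m k L Set.univ (by simp) (x := x) (by simpa using hx)
    rw [BB, LinearMap.comp_apply, bd_B (hf k) (L + ∑ i ∈ Finset.range k, m i) (m k) _ (by simpa using hmem), ih, map_add, map_sum, Finset.sum_range_succ, LinearMap.comp_apply, add_assoc]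
    congr 2
    · refine Finset.sum_congr rfl fun l hl => ?_
      have hlk := Finset.mem_range.1 hl
      split_ifs
      · simp
      · rw [map_smul, B_Zop (hfc k l), BB, LinearMap.comp_apply, dec_ne m (by omega)]
    · split_ifs with hm
      · rfl
      · rw [BB, LinearMap.comp_apply, dec_self, BB_congr p f (m := dec m k) (m' := m) k (fun l hl => dec_ne m (by omega))]
        congr 2
        ring

lemma BB_nil (p : ℕ) (f : ℕ → V → V) (m : ℕ → ℕ) (k : ℕ) (c : F) :
    BB F p f m k (Finsupp.single [] c) = if tot k m = 0 then Finsupp.single [] c else 0 := by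
  induction k with
  | zero => simp [BB, tot]
  | succ k ih =>
    rw [BB, LinearMap.comp_apply, ih]
    have ht : tot (k+1) m = tot k m + m k := Finset.sum_range_succ _ _
    by_cases h1 : tot k m = 0
    · rw [ht, h1, zero_add]; simp only [if_true]
      have : (Finsupp.single ([] : List V) c) = c • Finsupp.single [] (1 : F) := by simp
      rw [this, map_smul, B_single]
      rcases m k with _ | a
      · simp [BL]
      · simp [BL]
    · rw [ht]; simp [h1]

lemma bd_Theta0 (h : FP Face) (p k : ℕ) (f : ℕ → V → V) (hf : ∀ l, (f l)^[p] = id) (hfc : ∀ l l', Function.Commute (f l) (f l'))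
    (hnz : ∀ σ, Face σ → n + 1 ≤ nz σ) (hε : EpsC Face n ε) {σ : Fin N → SignType} (hσ : Face σ) (m : ℕ → ℕ) :
    bd F (BB F p f m k (lam F Face n ε vx σ)) =
      DD Face p n k f (fun j => BB F p f j.2 k (lam F Face n ε vx j.1)) (σ, m) + al V n k ε (σ, m) := by
  have hmem := lam_mem (F := F) (ε := ε) vx (fun _ => Set.univ) (fun _ _ => subset_rfl) (fun _ _ => Set.mem_univ _) hnz (nz σ) σ rfl hσ
  have hn := hnz σ hσ
  rw [bd_BB p f hf hfc m k (nz σ - n) _ (by simpa using hmem), bd_lam vx h hnz hε (nz σ) σ rfl hσ, map_add, map_sum]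
  simp only [DD, LinearMap.add_apply, LinearMap.sum_apply, Pi.add_apply, Finset.sum_apply]
  have e1 : BB F p f m k (al0 V n ε σ) = al V n k ε (σ, m) := by
    simp only [al, al0]
    split_ifs with h1 h2 h3
    · rw [BB_nil, if_pos h2]
    · rw [BB_nil, if_neg h2]
    · simp
    · simp
  have e2 : ∑ l ∈ Finset.range k, (if m l = 0 then 0 else (-1 : F) ^ (nz σ - n + 1 + ∑ i ∈ Finset.range l, m i) • Zop F p (f l) (m l) (BB F p f (dec m l) k (lam F Face n ε vx σ)))
      = ∑ l ∈ Finset.range k, DL p n f l (fun j => BB F p f j.2 k (lam F Face n ε vx j.1)) (σ, m) := by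
    refine Finset.sum_congr rfl fun l _ => ?_
    simp only [DL, LinearMap.coe_mk, AddHom.coe_mk]
    split_ifs
    · rfl
    · congr 1
      simp only [sgl]
      obtain ⟨a, ha⟩ : ∃ a, nz σ = n + a := ⟨nz σ - n, by omega⟩
      rw [ha, Nat.add_sub_cancel_left]
      rw [show n + a + n + 1 + ∑ i ∈ Finset.range l, m i = 2 * n + (a + 1 + ∑ i ∈ Finset.range l, m i) by ring, pow_add (-1 : F) (2 * n), pow_mul]
      simp
  rw [e1, e2]
  simp only [DS, LinearMap.coe_mk, AddHom.coe_mk, map_smul]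
  abel

end theta
end DT


namespace DT

lemma I_zero {F : Type*} [CommRing F] {V : Type*} (I : (List V →₀ F) →ₗ[F] F) {S : Set (List V)}
    (h : ∀ l ∈ S, I (Finsupp.single l 1) = 0) {x : List V →₀ F} (hx : x ∈ Finsupp.supported F F S) : I x = 0 := by
  have := map_supported (F := F) I (S := S) (T := LinearMap.ker (LinearMap.id (R := F) (M := F))) (fun l hl => by rw [LinearMap.mem_ker]; exact h l hl) hx
  rw [LinearMap.mem_ker] at this
  exact this

section main_top
variable {F : Type*} [Field F] {N : ℕ} {Face : (Fin N → SignType) → Prop}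
  {G : Type*}

abbrev VV (N : ℕ) (G : Type*) := (Fin N × SignType) × G

/-- vertices compatible with a sign vector -/
def SS (G : Type*) {N : ℕ} (σ : Fin N → SignType) : Set (VV N G) := {v | v.1.2 = σ v.1.1 ∧ v.1.2 ≠ 0}

def AH (G : Type*) {N : ℕ} (σ : Fin N → SignType) (L : ℕ) : Set (List (VV N G)) :=
  {l | l.length = L ∧ ∀ v ∈ l, v ∈ SS G σ}

def layers {N : ℕ} (σ : Fin N → SignType) : List (Fin N × SignType) :=
  ((List.finRange N).filter (fun i => decide (σ i ≠ 0))).map (fun i => (i, σ i))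

lemma layers_nodup (σ : Fin N → SignType) : (layers σ).Nodup := by
  unfold layers
  refine List.Nodup.map (fun a b h => by simpa using (congrArg Prod.fst h)) ?_
  exact (List.nodup_finRange N).filter _

lemma layers_length (σ : Fin N → SignType) : (layers σ).length = nz σ := by
  classical
  unfold layers nz
  rw [List.length_map, ← List.toFinset_card_of_nodup ((List.nodup_finRange N).filter _)]
  congr 1
  ext i; simp

lemma layers_upd (σ : Fin N → SignType) (i : Fin N) : (layers (upd σ i)).Sublist (layers σ) := by
  unfold layers
  have : ((List.finRange N).filter (fun j => decide (upd σ i j ≠ 0))).map (fun j => (j, upd σ i j)) =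
      ((List.finRange N).filter (fun j => decide (upd σ i j ≠ 0))).map (fun j => (j, σ j)) := by
    apply List.map_congr_left
    intro j hj
    have hj' := (List.mem_filter.1 hj).2
    have : j ≠ i := by rintro rfl; simp [upd_self] at hj'
    rw [upd_ne σ this]
  rw [this]
  apply List.Sublist.map
  apply List.monotone_filter_right
  intro j hj
  have : j ≠ i := by rintro rfl; simp [upd_self] at hj
  rwa [upd_ne σ this] at hj

lemma mem_layers {σ : Fin N → SignType} {x : Fin N × SignType} (h : x ∈ layers σ) : x.2 = σ x.1 ∧ x.2 ≠ 0 := by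
  unfold layers at h
  obtain ⟨i, hi, rfl⟩ := List.mem_map.1 h
  exact ⟨rfl, by simpa using (List.mem_filter.1 hi).2⟩

lemma SS_upd (σ : Fin N → SignType) (i : Fin N) : SS G (upd σ i) ⊆ SS G σ := by
  rintro v ⟨h1, h2⟩
  have : v.1.1 ≠ i := by
    intro h; rw [h, upd_self] at h1; exact h2 h1
  exact ⟨by rw [h1, upd_ne σ this], h2⟩

lemma AH_upd (σ : Fin N → SignType) (i : Fin N) (L : ℕ) : AH G (upd σ i) L ⊆ AH G σ L :=
  fun _ hl => ⟨hl.1, fun v hv => SS_upd σ i (hl.2 v hv)⟩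

lemma KS_AH (σ : Fin N → SignType) (L : ℕ) : KS G (layers σ) L ⊆ AH G σ L := by
  rintro l ⟨h1, h2⟩
  refine ⟨h2, fun v hv => ?_⟩
  exact mem_layers (h1.subset (List.mem_map_of_mem hv))

variable [Fintype G] [DecidableEq G] [Inhabited G]

lemma I_act_iter (I : (List (VV N G) →₀ F) →ₗ[F] F) (f : VV N G → VV N G) (h : ∀ x, I (act F f x) = I x) (t : ℕ) :
    ∀ x, I (act F (f^[t]) x) = I x := by
  induction t with
  | zero => intro x; rw [Function.iterate_zero, act_id]; rfl
  | succ t ih => intro x; rw [Function.iterate_succ, ← act_act, ih, h]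

lemma I_Zop (p : ℕ) [CharP F p] (I : (List (VV N G) →₀ F) →ₗ[F] F) (f : VV N G → VV N G) (h : ∀ x, I (act F f x) = I x)
    (a : ℕ) (x : List (VV N G) →₀ F) : I (Zop F p f a x) = 0 := by
  by_cases ha : Odd a
  · simp [Zop, ha, h]
  · simp [Zop, ha, I_act_iter I f h]

open Classical in
lemma sum_topes (h : FP Face) (g : (Fin N → SignType) → F) :
    ∑ σ : Fin N → SignType, (if nz σ = N ∧ Face σ then ∑ i, coef F Face σ i * g (upd σ i) else 0) = 0 := by
  classical
  have e : ∀ σ : Fin N → SignType, (if nz σ = N ∧ Face σ then ∑ i, coef F Face σ i * g (upd σ i) else 0) =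
      ∑ i, (if nz σ = N ∧ Face σ then coef F Face σ i * g (upd σ i) else 0) := by
    intro σ; split_ifs <;> simp
  simp only [e]
  rw [Finset.sum_comm]
  refine Finset.sum_eq_zero fun i _ => ?_
  let fl : (Fin N → SignType) → (Fin N → SignType) := fun σ => Function.update σ i (-(σ i))
  have hupd : ∀ σ, upd (fl σ) i = upd σ i := by intro σ; simp [fl, upd]
  have hfli : ∀ σ, fl σ i = - σ i := by intro σ; simp [fl]
  have hnz0 : ∀ σ : Fin N → SignType, σ i ≠ 0 → nz (fl σ) = nz σ := by
    intro σ hσ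
    have h1 : fl σ i ≠ 0 := by
      rw [hfli]; revert hσ; generalize σ i = s; revert s; decide
    rw [nz_upd hσ, nz_upd h1, hupd]
  refine Finset.sum_involution (fun σ _ => fl σ) ?_ ?_ (fun _ _ => Finset.mem_univ _) ?_
  · intro σ _
    by_cases hc : σ i ≠ 0 ∧ Face (upd σ i)
    · obtain ⟨c1, c2⟩ := hc
      have f1 : Face σ := h.upd c2
      have f2 : Face (fl σ) := h.upd (i := i) (by rw [hupd]; exact c2)
      have c3 : fl σ i ≠ 0 := by
        rw [hfli]; revert c1; generalize σ i = s; revert s; decide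
      have hz : zb (fl σ) i = zb σ i := by
        unfold zb; congr 1; ext j
        simp only [Finset.mem_filter, Finset.mem_univ, true_and]
        refine and_congr_right fun hj => ?_
        simp [fl, hj.ne]
      have hs : sg F (fl σ i) = - sg F (σ i) := by
        rw [hfli]; generalize σ i = s; cases s <;> simp [sg]
      simp only [hnz0 σ c1, f1, f2, and_true, coef, c1, c2, c3, hupd, hz, hs, ne_eq, not_false_eq_true, and_self, if_true]
      split_ifs
      · ring
      · ring
    · have z1 : coef F Face σ i = 0 := by by_contra hh; exact hc (coef_ne hh)
      have z2 : coef F Face (fl σ) i = 0 := by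
        by_contra hh
        obtain ⟨b1, b2⟩ := coef_ne hh
        refine hc ⟨?_, by rwa [hupd] at b2⟩
        rw [hfli] at b1
        intro h0; rw [h0] at b1; exact b1 (by decide)
      simp [z1, z2]
  · intro σ _ hne heq
    have : coef F Face σ i ≠ 0 := by
      intro hh; rw [hh] at hne; simp at hne
    have := (coef_ne this).1
    have h2 := congrFun heq i
    rw [hfli] at h2
    revert this h2; generalize σ i = s; revert s; decide
  · intro σ _
    simp [fl]

open Classical in
theorem top_main (p : ℕ) [CharP F p] (h : FP Face) (n k : ℕ) (f : ℕ → VV N G → VV N G) (hf : ∀ l, (f l)^[p] = id)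
    (hfc : ∀ l l', Function.Commute (f l) (f l')) (hf1 : ∀ l v, (f l v).1 = v.1)
    (hnz : ∀ σ, Face σ → n + 1 ≤ nz σ) (ε : (Fin N → SignType) → F) (hε : EpsC Face n ε)
    (vx : (Fin N → SignType) → VV N G) (hvx : ∀ σ, Face σ → vx σ ∈ SS G σ)
    (I : (List (VV N G) →₀ F) →ₗ[F] F) (I1 : ∀ l x, I (act F (f l) x) = I x)
    (I2 : ∀ σ, Face σ → nz σ = N → ∀ x ∈ AH G σ (N+1), I (bd F (Finsupp.single x 1)) = 0)
    (ms : ℕ → ℕ) (hms : tot k ms = n) (hnN : n ≤ N) :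
    (∃ σ, Face σ ∧ nz σ = N ∧ ∃ l ∈ KS G (layers σ) N, I (Finsupp.single l 1) ≠ 0) ∨
    ∑ σ : Fin N → SignType, (if nz σ = N ∧ Face σ then I (BB F p f ms k (lam F Face n ε vx σ)) else 0) = 0 := by
  classical
  have hSf : ∀ σ : Fin N → SignType, ∀ l, ∀ v ∈ SS G σ, f l v ∈ SS G σ := by
    intro σ l v hv
    simpa [SS, hf1] using hv
  have hAHf : ∀ (σ : Fin N → SignType) (L l : ℕ), ∀ x ∈ AH G σ L, x.map (f l) ∈ AH G σ L := by
    rintro σ L l x ⟨h1, h2⟩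
    refine ⟨by simpa using h1, fun v hv => ?_⟩
    obtain ⟨w, hw, rfl⟩ := List.mem_map.1 hv
    exact hSf σ l w (h2 w hw)
  obtain ⟨Θ1, hΘ1⟩ := lift_D (F := F) h p n k f hf hfc hnz (fun σ L => KS G (layers σ) L) 0
    (fun σ i L x hx => ⟨hx.1.trans (layers_upd σ i), hx.2⟩)
    (by
      rintro σ L l x ⟨h1, h2⟩
      refine ⟨?_, by simpa using h2⟩
      have : (x.map (f l)).map Prod.fst = x.map Prod.fst := by
        rw [List.map_map]; apply List.map_congr_left; intro v _; exact hf1 l v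
      rw [this]; exact h1)
    (by
      intro σ L hσ hL c hc hb
      exact KS_exact (F := F) (layers σ) (layers_nodup σ) L c hc hb (by rw [layers_length]; omega))
    (al (VV N G) n k ε) 1
    (by
      intro σ m hσ hm
      simp only [al, al0]
      split_ifs with h1 h2
      · refine single_mem ?_ _
        refine ⟨by simp, ?_⟩
        simp only [List.length_nil]; omega
      · exact Submodule.zero_mem _
      · exact Submodule.zero_mem _)
    (by
      intro σ m hσ hm
      rw [DD_al hε p k f hσ m, smul_zero, neg_zero]
      simp only [al]
      split_ifs
      · exact bd_al0 ..
      · simp)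
  let Θ0 : Ix N → (List (VV N G) →₀ F) := fun j => BB F p f j.2 k (lam F Face n ε vx j.1)
  obtain ⟨H, hH⟩ := lift_D (F := F) h p n k f hf hfc hnz (fun σ L => AH G σ L) 1
    (fun σ i L => AH_upd σ i L) hAHf
    (by
      intro σ L hσ hL c hc hb
      exact cone_exact (F := F) (P := fun v => v ∈ SS G σ) (hvx σ hσ) L c hc hb)
    (Θ1 - Θ0) (-1)
    (by
      intro σ m hσ hm
      have hn := hnz σ hσ
      rw [Pi.sub_apply]
      refine Submodule.sub_mem _ ?_ ?_
      · refine Finsupp.supported_mono ?_ (hΘ1 σ m hσ hm).1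
        simpa using KS_AH σ _
      · have h1 := lam_mem (F := F) (ε := ε) vx (fun σ => SS G σ) SS_upd hvx hnz (nz σ) σ rfl hσ
        have h2 := BB_mem (F := F) p f m k (nz σ - n) (SS G σ) (fun l _ => hSf σ l) h1
        refine Finsupp.supported_mono ?_ h2
        rintro x ⟨a1, a2⟩
        refine ⟨?_, a2⟩
        rw [a1]; simp only [tot] at *; omega)
    (by
      intro σ m hσ hm
      have e1 := (hΘ1 σ m hσ hm).2
      have e2 := bd_Theta0 (F := F) vx h p k f hf hfc hnz hε hσ m
      rw [Pi.sub_apply, map_sub, e1, map_sub]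
      change _ - bd F (BB F p f m k (lam F Face n ε vx σ)) = _
      rw [e2, Pi.sub_apply]
      simp only [one_smul, neg_smul, neg_neg, Θ0]
      abel)
  by_cases hex : ∃ σ, Face σ ∧ nz σ = N ∧ ∃ l ∈ KS G (layers σ) N, I (Finsupp.single l 1) ≠ 0
  · exact Or.inl hex
  right
  push Not at hex
  have key : ∀ σ, nz σ = N ∧ Face σ → I (Θ0 (σ, ms)) = - ∑ i, coef F Face σ i * I (H (upd σ i, ms)) := by
    rintro σ ⟨hσN, hσ⟩
    obtain ⟨b1, b2⟩ := hH σ ms hσ hms.le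
    have z1 : I (Θ1 (σ, ms)) = 0 := by
      have := (hΘ1 σ ms hσ hms.le).1
      rw [hσN, hms, show N + n - n + 0 = N by omega] at this
      exact I_zero I (hex σ hσ hσN) this
    have z2 : I (bd F (H (σ, ms))) = 0 := by
      rw [hσN, hms, show N + n - n + 1 = N + 1 by omega] at b1
      exact I_zero (I ∘ₗ bd F) (I2 σ hσ hσN) b1
    rw [b2] at z2
    simp only [Pi.sub_apply, map_add, map_sub, z1, zero_sub, map_smul, smul_eq_mul] at z2
    simp only [DD, LinearMap.add_apply, LinearMap.sum_apply, Pi.add_apply, Finset.sum_apply, map_add, map_sum] at z2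
    have z3 : ∑ l ∈ Finset.range k, I (DL p n f l H (σ, ms)) = 0 := by
      refine Finset.sum_eq_zero fun l _ => ?_
      simp only [DL, LinearMap.coe_mk, AddHom.coe_mk]
      split_ifs
      · simp
      · rw [map_smul, I_Zop p I (f l) (I1 l), smul_zero]
    rw [z3] at z2
    simp only [DS, LinearMap.coe_mk, AddHom.coe_mk, map_sum, map_smul, smul_eq_mul] at z2
    linear_combination -z2
  have := sum_topes h (fun τ => - I (H (τ, ms)))
  refine Eq.trans ?_ this
  refine Finset.sum_congr rfl fun σ _ => ?_
  split_ifs with hc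
  · rw [show I (BB F p f ms k (lam F Face n ε vx σ)) = I (Θ0 (σ, ms)) from rfl, key σ hc]
    simp
  · rfl

end main_top
end DT


namespace DT

section geom
variable {d N : ℕ} {a : Fin N → Fin (d+1) → ℝ}

abbrev Du (d : ℕ) := Module.Dual ℝ (Fin (d+1) → ℝ)

/-- any `d+1` of the vectors are independent -/
def GP1 {d N : ℕ} (a : Fin N → Fin (d+1) → ℝ) : Prop :=
  ∀ g : Fin (d+1) → Fin N, Function.Injective g → LinearIndependent ℝ (fun m => a (g m))

def Fc {d N : ℕ} (a : Fin N → Fin (d+1) → ℝ) (σ : Fin N → SignType) : Prop :=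
  ∃ l : Du d, l ≠ 0 ∧ ∀ i, SignType.sign (l (a i)) = σ i

lemma exists_basis (h : GP1 a) {Z : Finset (Fin N)} (hZ : Z.card = d + 1) :
    ∃ (g : Fin (d+1) → Fin N) (b : Module.Basis (Fin (d+1)) ℝ (Fin (d+1) → ℝ)), Function.Injective g ∧
      Set.range g = Z ∧ ∀ m, b m = a (g m) := by
  let g := Z.orderEmbOfFin hZ
  have hg : Function.Injective g := g.injective
  have hl := h g hg
  refine ⟨g, basisOfLinearIndependentOfCardEqFinrank hl (by simp), hg, ?_, fun m => ?_⟩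
  · simp [g]
  · simp

lemma exists_val (h : GP1 a) (hN : d + 1 ≤ N) {Z : Finset (Fin N)} (hZ : Z.card ≤ d + 1) (y : Fin N → ℝ) :
    ∃ l : Du d, ∀ z ∈ Z, l (a z) = y z := by
  obtain ⟨Z', hs, hc⟩ := Finset.exists_superset_card_eq hZ (by simpa using hN)
  obtain ⟨g, b, hg, hr, hb⟩ := exists_basis h hc
  refine ⟨b.constr ℝ (fun m => y (g m)), fun z hz => ?_⟩
  have : z ∈ Set.range g := by rw [hr]; exact hs hz
  obtain ⟨m, rfl⟩ := this
  rw [← hb, Module.Basis.constr_basis]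

lemma eq_zero_of_vanish (h : GP1 a) {Z : Finset (Fin N)} (hZ : d + 1 ≤ Z.card) {l : Du d} (hl : ∀ z ∈ Z, l (a z) = 0) : l = 0 := by
  obtain ⟨Z', hs, hc⟩ := Finset.exists_subset_card_eq hZ
  obtain ⟨g, b, hg, hr, hb⟩ := exists_basis h hc
  refine b.ext fun m => ?_
  rw [hb]
  have : g m ∈ (Z' : Set (Fin N)) := by rw [← hr]; exact ⟨m, rfl⟩
  simpa using hl _ (hs this)

open Classical in
noncomputable def zs {N : ℕ} (σ : Fin N → SignType) : Finset (Fin N) := Finset.univ.filter (fun i => σ i = 0)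

lemma mem_zs {σ : Fin N → SignType} {i : Fin N} : i ∈ zs σ ↔ σ i = 0 := by simp [zs]

lemma nz_add_zs (σ : Fin N → SignType) : nz σ + (zs σ).card = N := by
  classical
  have := Finset.card_filter_add_card_filter_not (s := (Finset.univ : Finset (Fin N))) (fun i => σ i ≠ 0)
  simp only [Finset.card_univ, Fintype.card_fin, not_not] at this
  unfold nz zs
  convert this using 2

lemma Fc_zs (h : GP1 a) {σ : Fin N → SignType} (hσ : Fc a σ) : (zs σ).card ≤ d := by
  by_contra hc
  obtain ⟨l, h0, hs⟩ := hσ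
  refine h0 (eq_zero_of_vanish h (Z := zs σ) (by omega) fun z hz => ?_)
  rw [mem_zs, ← hs, sign_eq_zero_iff] at hz
  exact hz

lemma Fc_nz (h : GP1 a) {n : ℕ} (hn : n + (d + 1) = N) {σ : Fin N → SignType} (hσ : Fc a σ) : n + 1 ≤ nz σ := by
  have := Fc_zs h hσ
  have := nz_add_zs σ
  omega

lemma sign_near {x : ℝ} (hx : x ≠ 0) (y : ℝ) : ∀ᶠ δ in nhdsWithin (0:ℝ) (Set.Ioi 0), SignType.sign (x + δ * y) = SignType.sign x := by
  have hc : Filter.Tendsto (fun δ : ℝ => x + δ * y) (nhdsWithin (0:ℝ) (Set.Ioi 0)) (nhds x) := by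
    have : Continuous (fun δ : ℝ => x + δ * y) := by fun_prop
    have h2 := (this.tendsto 0).mono_left (nhdsWithin_le_nhds (s := Set.Ioi 0))
    simpa using h2
  rcases lt_or_gt_of_ne hx with h | h
  · filter_upwards [hc.eventually (gt_mem_nhds h)] with δ hδ
    rw [sign_neg hδ, sign_neg h]
  · filter_upwards [hc.eventually (lt_mem_nhds h)] with δ hδ
    rw [sign_pos hδ, sign_pos h]

lemma Fc_FP (h : GP1 a) (hN : d + 1 ≤ N) : FP (Fc a) := by
  intro σ τ hτ hag
  have hz := Fc_zs h hτ
  obtain ⟨l, h0, hs⟩ := hτ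
  obtain ⟨l', hl'⟩ := exists_val h hN (Z := zs τ) (by omega) (fun z => ((σ z : ℝ)))
  have hev : ∀ᶠ δ in nhdsWithin (0:ℝ) (Set.Ioi 0), ∀ i, τ i ≠ 0 → SignType.sign (l (a i) + δ * l' (a i)) = τ i := by
    rw [Filter.eventually_all]
    intro i
    by_cases hi : τ i = 0
    · simp [hi]
    · have : l (a i) ≠ 0 := by
        intro hh; rw [← hs, hh] at hi; simp at hi
      filter_upwards [sign_near this (l' (a i))] with δ hδ _
      rw [hδ, hs]
  obtain ⟨δ, hδ, hpos⟩ := (hev.and self_mem_nhdsWithin).exists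
  have hpos : 0 < δ := hpos
  have hsg : ∀ i, SignType.sign ((l + δ • l') (a i)) = σ i := by
    intro i
    simp only [LinearMap.add_apply, LinearMap.smul_apply, smul_eq_mul]
    by_cases hi : τ i = 0
    · have h1 : l (a i) = 0 := by rw [← sign_eq_zero_iff, hs, hi]
      rw [h1, zero_add, hl' i (mem_zs.2 hi), sign_mul, sign_pos hpos, one_mul]
      generalize σ i = s; cases s <;> simp
    · rw [hδ i hi, hag i hi]
  refine ⟨l + δ • l', ?_, hsg⟩
  intro hzero
  have : (zs τ).card < N := by omega
  have hex : ∃ i, τ i ≠ 0 := by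
    by_contra hcon
    push Not at hcon
    have : zs τ = Finset.univ := by ext i; simp [mem_zs, hcon]
    rw [this] at hz; simp at hz; omega
  obtain ⟨i, hi⟩ := hex
  have := hsg i
  rw [hzero, hag i hi] at this
  simp at this
  exact hi this.symm

end geom
end DT


namespace DT

section Tdet

lemma ext_mul_prod_comm {R M : Type*} [CommRing R] [AddCommGroup M] [Module R M] (x : M) (l : List M) :
    ExteriorAlgebra.ι R x * (l.map (ExteriorAlgebra.ι R)).prod =
      (-1 : R) ^ l.length • ((l.map (ExteriorAlgebra.ι R)).prod * ExteriorAlgebra.ι R x) := by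
  induction l with
  | nil => simp
  | cons y l ih =>
    have h := ExteriorAlgebra.ι_add_mul_swap (R := R) x y
    have h' : ExteriorAlgebra.ι R x * ExteriorAlgebra.ι R y = - (ExteriorAlgebra.ι R y * ExteriorAlgebra.ι R x) :=
      eq_neg_of_add_eq_zero_left h
    rw [List.map_cons, List.prod_cons, ← mul_assoc, h', neg_mul, mul_assoc, ih, List.length_cons, pow_succ]
    simp [mul_assoc]

lemma ext_mul_prod_mem {R M : Type*} [CommRing R] [AddCommGroup M] [Module R M] (x : M) (l : List M) (h : x ∈ l) :
    ExteriorAlgebra.ι R x * (l.map (ExteriorAlgebra.ι R)).prod = 0 := by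
  induction l with
  | nil => simp at h
  | cons y l ih =>
    rcases List.mem_cons.1 h with rfl | h
    · rw [List.map_cons, List.prod_cons, ← mul_assoc, ExteriorAlgebra.ι_sq_zero, zero_mul]
    · have h' : ExteriorAlgebra.ι R x * ExteriorAlgebra.ι R y = - (ExteriorAlgebra.ι R y * ExteriorAlgebra.ι R x) :=
        eq_neg_of_add_eq_zero_left (ExteriorAlgebra.ι_add_mul_swap (R := R) x y)
      rw [List.map_cons, List.prod_cons, ← mul_assoc, h', neg_mul, mul_assoc, ih h, mul_zero, neg_zero]

noncomputable def TA {R M : Type*} [CommRing R] [AddCommGroup M] [Module R M] (N : ℕ) (g : M [⋀^Fin N]→ₗ[R] R) :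
    (i : ℕ) → M [⋀^Fin i]→ₗ[R] R := fun i => if h : i = N then h ▸ g else 0

/-- functional on the exterior algebra from an alternating form -/
noncomputable def TT {R M : Type*} [CommRing R] [AddCommGroup M] [Module R M] {N : ℕ} (g : M [⋀^Fin N]→ₗ[R] R) :
    ExteriorAlgebra R M →ₗ[R] R := ExteriorAlgebra.liftAlternating (TA N g)

lemma TT_prod {R M : Type*} [CommRing R] [AddCommGroup M] [Module R M] {N : ℕ} (g : M [⋀^Fin N]→ₗ[R] R) (v : Fin N → M) :
    TT g ((List.ofFn v).map (ExteriorAlgebra.ι R)).prod = g v := by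
  have : ((List.ofFn v).map (ExteriorAlgebra.ι R)).prod = ExteriorAlgebra.ιMulti R N v := by
    rw [ExteriorAlgebra.ιMulti_apply, List.map_ofFn]; rfl
  rw [this, TT, ExteriorAlgebra.liftAlternating_apply_ιMulti]
  simp [TA]

end Tdet

section eps
variable {d N : ℕ} {a : Fin N → Fin (d+1) → ℝ}

noncomputable def Td (d : ℕ) : ExteriorAlgebra ℝ (Fin (d+1) → ℝ) →ₗ[ℝ] ℝ := TT Matrix.detRowAlternating

noncomputable def Wl (a : Fin N → Fin (d+1) → ℝ) (l : List (Fin N)) : ExteriorAlgebra ℝ (Fin (d+1) → ℝ) :=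
  ((l.map a).map (ExteriorAlgebra.ι ℝ)).prod

lemma Wl_cons (i : Fin N) (l : List (Fin N)) : Wl a (i :: l) = ExteriorAlgebra.ι ℝ (a i) * Wl a l := by simp [Wl]

lemma Td_ne (h : GP1 a) {l : List (Fin N)} (hl : l.Nodup) (hlen : l.length = d + 1) : Td d (Wl a l) ≠ 0 := by
  obtain ⟨g, rfl⟩ : ∃ g : Fin (d+1) → Fin N, l = List.ofFn g := by
    refine ⟨fun i => l.get (i.cast hlen.symm), ?_⟩
    rw [← List.ofFn_congr hlen, List.ofFn_get]
  have hg : Function.Injective g := List.nodup_ofFn.1 hl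
  rw [Wl, List.map_ofFn, Td, TT_prod]
  have := h g hg
  have h2 := Matrix.linearIndependent_rows_iff_isUnit (A := Matrix.of (a ∘ g)).1 this
  rw [Matrix.isUnit_iff_isUnit_det] at h2
  exact h2.ne_zero

noncomputable def zl (σ : Fin N → SignType) : List (Fin N) := (List.finRange N).filter (fun i => decide (σ i = 0))

lemma mem_zl {σ : Fin N → SignType} {i : Fin N} : i ∈ zl σ ↔ σ i = 0 := by simp [zl]

lemma zl_nodup (σ : Fin N → SignType) : (zl σ).Nodup := (List.nodup_finRange N).filter _

lemma zl_length (σ : Fin N → SignType) : (zl σ).length = (zs σ).card := by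
  rw [← List.toFinset_card_of_nodup (zl_nodup σ)]
  congr 1
  ext i; simp [mem_zl, mem_zs]

/-- the functional with zero set `l` -/
noncomputable def ph (a : Fin N → Fin (d+1) → ℝ) (l : List (Fin N)) : Du d :=
  Td d ∘ₗ LinearMap.mulRight ℝ (Wl a l) ∘ₗ ExteriorAlgebra.ι ℝ

lemma ph_apply (l : List (Fin N)) (x : Fin (d+1) → ℝ) : ph a l x = Td d (ExteriorAlgebra.ι ℝ x * Wl a l) := rfl

lemma ph_mem {l : List (Fin N)} {i : Fin N} (h : i ∈ l) : ph a l (a i) = 0 := by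
  rw [ph_apply, Wl, ext_mul_prod_mem _ _ (List.mem_map_of_mem h), map_zero]

lemma ph_ne (h : GP1 a) {l : List (Fin N)} (hl : l.Nodup) (hlen : l.length = d) {i : Fin N} (hi : i ∉ l) : ph a l (a i) ≠ 0 := by
  rw [ph_apply, ← Wl_cons]
  exact Td_ne h (List.nodup_cons.2 ⟨hi, hl⟩) (by simp [hlen])

lemma ph_prop (h : GP1 a) {l : List (Fin N)} (hl : l.Nodup) (hlen : l.length = d) {f : Du d} (hf : ∀ i ∈ l, f (a i) = 0)
    {j : Fin N} (hj : j ∉ l) : f (a j) • ph a l = ph a l (a j) • f := by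
  rw [← sub_eq_zero]
  refine eq_zero_of_vanish h (Z := insert j l.toFinset) ?_ ?_
  · rw [Finset.card_insert_of_notMem (by simpa using hj), List.toFinset_card_of_nodup hl, hlen]
  · intro z hz
    rcases Finset.mem_insert.1 hz with rfl | hz
    · simp [mul_comm]
    · have hz : z ∈ l := by simpa using hz
      simp [hf z hz, ph_mem hz]

open Classical in
noncomputable def es (a : Fin N → Fin (d+1) → ℝ) (σ : Fin N → SignType) : SignType :=
  if h : ∃ j, σ j ≠ 0 then σ h.choose * SignType.sign (ph a (zl σ) (a h.choose)) else 1

lemma es_const (h : GP1 a) (hN : d + 1 ≤ N) {σ : Fin N → SignType} (hσ : Fc a σ) (hz : (zs σ).card = d) :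
    ∃ c : SignType, c ≠ 0 ∧ ∀ j, σ j ≠ 0 → σ j * SignType.sign (ph a (zl σ) (a j)) = c := by
  have hl := zl_nodup σ
  have hlen : (zl σ).length = d := by rw [zl_length, hz]
  obtain ⟨l, h0, hs⟩ := hσ
  have hlz : ∀ i ∈ zl σ, l (a i) = 0 := by
    intro i hi
    rw [mem_zl, ← hs, sign_eq_zero_iff] at hi; exact hi
  have hex : ∃ j, σ j ≠ 0 := by
    by_contra hcon
    push Not at hcon
    have : zs σ = Finset.univ := by ext i; simp [mem_zs, hcon]
    rw [this] at hz; simp at hz; omega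
  obtain ⟨j0, hj0⟩ := hex
  have hj0' : j0 ∉ zl σ := by rwa [mem_zl]
  have hP := ph_prop h hl hlen hlz hj0'
  refine ⟨σ j0 * SignType.sign (ph a (zl σ) (a j0)), ?_, ?_⟩
  · have := ph_ne h hl hlen hj0'
    have h3 : SignType.sign (ph a (zl σ) (a j0)) ≠ 0 := by rwa [ne_eq, sign_eq_zero_iff]
    exact mul_ne_zero hj0 h3
  · intro j hj
    have h1 := congrArg SignType.sign (LinearMap.congr_fun hP (a j))
    simp only [LinearMap.smul_apply, smul_eq_mul, sign_mul, hs] at h1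
    revert h1 hj hj0
    generalize SignType.sign (ph a (zl σ) (a j)) = s1
    generalize SignType.sign (ph a (zl σ) (a j0)) = s2
    generalize σ j = s3
    generalize σ j0 = s4
    revert s1 s2 s3 s4
    decide

lemma es_eq (h : GP1 a) (hN : d + 1 ≤ N) {σ : Fin N → SignType} (hσ : Fc a σ) (hz : (zs σ).card = d) {j : Fin N} (hj : σ j ≠ 0) :
    es a σ = σ j * SignType.sign (ph a (zl σ) (a j)) := by
  obtain ⟨c, _, hc⟩ := es_const h hN hσ hz
  have hex : ∃ j, σ j ≠ 0 := ⟨j, hj⟩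
  rw [es, dif_pos hex, hc _ hex.choose_spec, hc j hj]

lemma es_ne (h : GP1 a) (hN : d + 1 ≤ N) {σ : Fin N → SignType} (hσ : Fc a σ) (hz : (zs σ).card = d) :
    es a σ ≠ 0 := by
  obtain ⟨c, h0, hc⟩ := es_const h hN hσ hz
  by_cases hex : ∃ j, σ j ≠ 0
  · rw [es, dif_pos hex, hc _ hex.choose_spec]; exact h0
  · rw [es, dif_neg hex]; decide

lemma Wl_append (l l' : List (Fin N)) : Wl a (l ++ l') = Wl a l * Wl a l' := by simp [Wl]

lemma Wl_zl_upd {σ : Fin N → SignType} {i : Fin N} (hi : σ i ≠ 0) :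
    Wl a (zl (upd σ i)) = (-1 : ℝ) ^ zb σ i • Wl a (i :: zl σ) := by
  obtain ⟨L1, L2, hL⟩ := List.append_of_mem (List.mem_finRange i)
  have hs : (List.finRange N).Pairwise (· < ·) := List.pairwise_lt_finRange N
  have hnd := List.nodup_finRange N
  rw [hL] at hs hnd
  rw [List.pairwise_append] at hs
  obtain ⟨_, hs2, hs3⟩ := hs
  have hs2 := (List.pairwise_cons.1 hs2).1
  have h1 : ∀ j ∈ L1, j < i := fun j hj => hs3 j hj i (by simp)
  have f1 : L1.filter (fun j => decide (upd σ i j = 0)) = L1.filter (fun j => decide (σ j = 0)) := by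
    apply List.filter_congr; intro j hj; rw [upd_ne σ (h1 j hj).ne]
  have f2 : L2.filter (fun j => decide (upd σ i j = 0)) = L2.filter (fun j => decide (σ j = 0)) := by
    apply List.filter_congr; intro j hj; rw [upd_ne σ (hs2 j hj).ne']
  have e1 : zl (upd σ i) = L1.filter (fun j => decide (σ j = 0)) ++ i :: L2.filter (fun j => decide (σ j = 0)) := by
    rw [zl, hL, List.filter_append, List.filter_cons_of_pos (by simp [upd_self]), f1, f2]
  have e2 : zl σ = L1.filter (fun j => decide (σ j = 0)) ++ L2.filter (fun j => decide (σ j = 0)) := by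
    rw [zl, hL, List.filter_append, List.filter_cons_of_neg (by simp [hi])]
  have e3 : (L1.filter (fun j => decide (σ j = 0))).length = zb σ i := by
    rw [← List.toFinset_card_of_nodup ((List.nodup_append.1 hnd).1.filter _), zb]
    congr 1
    ext j
    simp only [List.mem_toFinset, List.mem_filter, decide_eq_true_eq, Finset.mem_filter, Finset.mem_univ, true_and]
    refine and_congr_left fun _ => ⟨h1 j, fun hj => ?_⟩
    have hm : j ∈ L1 ++ i :: L2 := by rw [← hL]; exact List.mem_finRange j
    rcases List.mem_append.1 hm with hm | hm
    · exact hm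
    · rcases List.mem_cons.1 hm with rfl | hm
      · exact absurd hj (lt_irrefl _)
      · exact absurd (hs2 j hm) (not_lt.2 hj.le)
  have key := ext_mul_prod_comm (R := ℝ) (a i) ((L1.filter (fun j => decide (σ j = 0))).map a)
  rw [List.length_map, e3] at key
  rw [e1, Wl_cons, e2, Wl_append, Wl_append, Wl_cons, ← mul_assoc (ExteriorAlgebra.ι ℝ (a i))]
  have k2 : ExteriorAlgebra.ι ℝ (a i) * Wl a (L1.filter (fun j => decide (σ j = 0))) =
    (-1 : ℝ) ^ zb σ i • (Wl a (L1.filter (fun j => decide (σ j = 0))) * ExteriorAlgebra.ι ℝ (a i)) := key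
  rw [k2, smul_mul_assoc, smul_smul, ← mul_pow]
  simp [mul_assoc]

lemma ph_zl_upd {σ : Fin N → SignType} {i : Fin N} (hi : σ i ≠ 0) (x : Fin (d+1) → ℝ) :
    ph a (zl (upd σ i)) x = (-1 : ℝ) ^ zb σ i * ph a (i :: zl σ) x := by
  rw [ph_apply, Wl_zl_upd hi, ph_apply, mul_smul_comm, map_smul, smul_eq_mul]

lemma ph_anti (l : List (Fin N)) (i j : Fin N) : ph a (i :: l) (a j) = - ph a (j :: l) (a i) := by
  rw [ph_apply, ph_apply, Wl_cons, Wl_cons, ← mul_assoc, ← mul_assoc, ← map_neg, ← neg_mul]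
  congr 2
  exact eq_neg_of_add_eq_zero_left (ExteriorAlgebra.ι_add_mul_swap (R := ℝ) _ _)

lemma zs_upd {σ : Fin N → SignType} {i : Fin N} (hi : σ i ≠ 0) : (zs (upd σ i)).card = (zs σ).card + 1 := by
  have := nz_add_zs σ
  have := nz_add_zs (upd σ i)
  have := nz_upd hi
  omega

lemma sign_negpow (m : ℕ) : SignType.sign ((-1 : ℝ) ^ m) = (-1) ^ m := by
  rcases neg_one_pow_eq_or ℝ m with h | h <;> rcases Nat.even_or_odd m with h' | h' <;> simp [h'.neg_one_pow]

lemma sg_mul {F : Type*} [Field F] (s t : SignType) : sg F (s * t) = sg F s * sg F t := by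
  cases s <;> cases t <;> simp [sg]

lemma sg_negpow {F : Type*} [Field F] (m : ℕ) : sg F ((-1) ^ m) = (-1) ^ m := by
  rcases Nat.even_or_odd m with h' | h' <;> simp [h'.neg_one_pow, sg]

/-- contribution of a wall -/
lemma wall_term {F : Type*} [Field F] (h : GP1 a) (hN : d + 1 ≤ N) {σ : Fin N → SignType} (hz : (zs σ).card + 1 = d) {i : Fin N} (hi : σ i ≠ 0)
    (hf : Fc a (upd σ i)) {j : Fin N} (hj : σ j ≠ 0) (hji : j ≠ i) :
    coef F (Fc a) σ i * sg F (es a (upd σ i)) = sg F (σ i * σ j * SignType.sign (ph a (i :: zl σ) (a j))) := by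
  have hj' : upd σ i j ≠ 0 := by rwa [upd_ne σ hji]
  rw [es_eq h hN hf (by rw [zs_upd hi, hz]) hj', upd_ne σ hji, ph_zl_upd hi, sign_mul, sign_negpow]
  simp only [coef, hi, hf, ne_eq, not_false_eq_true, and_self, if_true, sg_mul, sg_negpow]
  have : ((-1 : F) ^ zb σ i) * ((-1 : F) ^ zb σ i) = 1 := by rw [← mul_pow]; simp
  linear_combination (sg F (σ i) * sg F (σ j) * sg F (SignType.sign (ph a (i :: zl σ) (a j)))) * this

lemma sgn_aux1 : ∀ s3 s4 s5 c : SignType, s5 ≠ 0 → s3 ≠ 0 → c ≠ 0 → c * s3 * s5 * (s4 * s3 * s5 * c) = s4 := by decide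

lemma sgn_aux2 : ∀ s1 s2 s3 s4 s5 : SignType, s5 ≠ 0 → s2 ≠ 0 → s3 ≠ 0 → s4 ≠ 0 → s1 ≠ 0 →
    s2 * (s1 * (s2 * s4 * s5 * 1)) = s3 * (s1 * (s3 * s4 * s5 * -1)) → False := by decide

lemma psi_id (h : GP1 a) {l : List (Fin N)} (hl : l.Nodup) (hlen : l.length + 1 = d) {f : Du d} (hf : ∀ i ∈ l, f (a i) = 0)
    {i0 : Fin N} (hi0 : i0 ∉ l) (i : Fin N) {j : Fin N} (hj : j ∉ l) :
    ph a (j :: l) (a i) * f (a i0) = ph a (i0 :: l) (a i) * f (a j) - ph a (i0 :: l) (a j) * f (a i) := by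
  by_cases hji : j = i0
  · subst hji
    rw [ph_mem (l := j :: l) (i := j) (by simp)]; ring
  · have key : f (a i0) • ph a (j :: l) - f (a j) • ph a (i0 :: l) + ph a (i0 :: l) (a j) • f = 0 := by
      refine eq_zero_of_vanish h (Z := insert i0 (insert j l.toFinset)) ?_ ?_
      · rw [Finset.card_insert_of_notMem (by simp [hi0, Ne.symm hji]), Finset.card_insert_of_notMem (by simpa using hj), List.toFinset_card_of_nodup hl, hlen]
      · intro z hz
        have hz : z = i0 ∨ z = j ∨ z ∈ l := by simpa using hz
        rcases hz with rfl | rfl | hz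
        · simp only [LinearMap.add_apply, LinearMap.sub_apply, LinearMap.smul_apply, smul_eq_mul]
          rw [ph_mem (l := z :: l) (i := z) (by simp), ph_anti l j z]; ring
        · simp only [LinearMap.add_apply, LinearMap.sub_apply, LinearMap.smul_apply, smul_eq_mul]
          rw [ph_mem (l := z :: l) (i := z) (by simp)]; ring
        · simp only [LinearMap.add_apply, LinearMap.sub_apply, LinearMap.smul_apply, smul_eq_mul]
          rw [ph_mem (l := j :: l) (i := z) (by simp [hz]), ph_mem (l := i0 :: l) (i := z) (by simp [hz]), hf z hz]; ring
    have := LinearMap.congr_fun key (a i)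
    simp only [LinearMap.add_apply, LinearMap.sub_apply, LinearMap.smul_apply, smul_eq_mul, LinearMap.zero_apply] at this
    linear_combination this

theorem es_EpsC {F : Type*} [Field F] (h : GP1 a) {n : ℕ} (hn : n + (d + 1) = N) : EpsC (F := F) (Fc a) n (fun σ => sg F (es a σ)) := by
  classical
  intro σ hσ hnz
  have hN : d + 1 ≤ N := by omega
  have hz : (zs σ).card + 1 = d := by have := nz_add_zs σ; omega
  have hl := zl_nodup σ
  have hlen : (zl σ).length + 1 = d := by rw [zl_length, hz]
  obtain ⟨f, hf0, hs⟩ := hσ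
  have hfz : ∀ i ∈ zl σ, f (a i) = 0 := by
    intro i hi
    rw [mem_zl, ← hs, sign_eq_zero_iff] at hi; exact hi
  have hfn : ∀ i, σ i ≠ 0 → f (a i) ≠ 0 := by
    intro i hi h0
    rw [← hs, h0] at hi; simp at hi
  let P : Finset (Fin N) := Finset.univ.filter (fun i => σ i ≠ 0)
  have hP : P.card = n + 2 := by rw [← hnz]; unfold nz; simp only [P]
  have hPm : ∀ i, i ∈ P ↔ σ i ≠ 0 := by intro i; simp [P]
  obtain ⟨i0, hi0P⟩ : P.Nonempty := by rw [← Finset.card_pos]; omega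
  have hi0 := (hPm i0).1 hi0P
  let θ : Fin N → ℝ := fun j => ph a (i0 :: zl σ) (a j) / f (a j)
  have hid : ∀ i j, σ i ≠ 0 → σ j ≠ 0 → ph a (j :: zl σ) (a i) * f (a i0) = f (a i) * f (a j) * (θ i - θ j) := by
    intro i j hi hj
    rw [psi_id h hl hlen hfz (by rwa [mem_zl]) i (by rwa [mem_zl])]
    have := hfn i hi
    have := hfn j hj
    simp only [θ]; field_simp
  have hsg : ∀ i j, σ i ≠ 0 → σ j ≠ 0 → SignType.sign (ph a (j :: zl σ) (a i)) = σ i * σ j * σ i0 * SignType.sign (θ i - θ j) := by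
    intro i j hi hj
    have := congrArg SignType.sign (hid i j hi hj)
    simp only [sign_mul, hs] at this
    revert this hi0
    generalize SignType.sign (ph a (j :: zl σ) (a i)) = s1
    generalize SignType.sign (θ i - θ j) = s2
    generalize σ i = s3
    generalize σ j = s4
    generalize σ i0 = s5
    revert s1 s2 s3 s4 s5
    decide
  have hinj : ∀ i j, σ i ≠ 0 → σ j ≠ 0 → θ i = θ j → i = j := by
    intro i j hi hj hij
    by_contra hne
    have h1 := hsg i j hi hj
    rw [hij, sub_self, sign_zero, mul_zero, sign_eq_zero_iff] at h1
    refine ph_ne h (l := j :: zl σ) ?_ ?_ ?_ h1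
    · exact List.nodup_cons.2 ⟨by rwa [mem_zl], hl⟩
    · simpa using hlen
    · simp [mem_zl, hi, hne]
  obtain ⟨i, hiP, hi⟩ := Finset.exists_max_image P θ ⟨i0, hi0P⟩
  obtain ⟨j, hjP, hj⟩ := Finset.exists_min_image P θ ⟨i0, hi0P⟩
  have hiσ := (hPm i).1 hiP
  have hjσ := (hPm j).1 hjP
  have hlt_i : ∀ m, σ m ≠ 0 → m ≠ i → θ m < θ i := fun m hm hne =>
    lt_of_le_of_ne (hi m ((hPm m).2 hm)) (fun he => hne (hinj m i hm hiσ he))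
  have hlt_j : ∀ m, σ m ≠ 0 → m ≠ j → θ j < θ m := fun m hm hne =>
    lt_of_le_of_ne (hj m ((hPm m).2 hm)) (fun he => hne (hinj j m hjσ hm he).symm)
  have hij : i ≠ j := by
    rintro rfl
    have : P ⊆ {i} := by
      intro m hm
      rw [Finset.mem_singleton]
      by_contra hne
      exact lt_asymm (hlt_i m ((hPm m).1 hm) hne) (hlt_j m ((hPm m).1 hm) hne)
    have := Finset.card_le_card this
    rw [hP, Finset.card_singleton] at this
    omega
  have face_of : ∀ (m : Fin N) (c : SignType), σ m ≠ 0 → c ≠ 0 → (∀ t, σ t ≠ 0 → t ≠ m → SignType.sign (θ t - θ m) = c) → Fc a (upd σ m) := by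
    intro m c hm hc hcond
    have hsn : ∀ t, SignType.sign ((((c * σ m * σ i0 : SignType) : ℝ) • ph a (m :: zl σ)) (a t)) = upd σ m t := by
      intro t
      rw [LinearMap.smul_apply, smul_eq_mul, sign_mul]
      by_cases htm : t = m
      · subst htm
        rw [ph_mem (by simp), upd_self]; simp
      · rw [upd_ne σ htm]
        by_cases ht : σ t = 0
        · rw [ph_mem (by simp [mem_zl, ht]), ht]; simp
        · rw [hsg t m ht hm, hcond t ht htm]
          have e : ∀ s : SignType, SignType.sign ((s : ℝ)) = s := by intro s; cases s <;> simp
          rw [e]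
          exact sgn_aux1 _ _ _ _ hi0 hm hc
    refine ⟨_, ?_, hsn⟩
    intro h0
    rw [h0] at hsn
    obtain ⟨t, ht, htm⟩ : ∃ t, σ t ≠ 0 ∧ t ≠ m := by
      by_cases him : i = m
      · exact ⟨j, hjσ, by rw [← him]; exact hij.symm⟩
      · exact ⟨i, hiσ, him⟩
    have := hsn t
    rw [upd_ne σ htm] at this
    simp at this
    exact ht this.symm
  have fi : Fc a (upd σ i) := face_of i (-1) hiσ (by decide) fun t ht hne => sign_neg (sub_neg.2 (hlt_i t ht hne))
  have fj : Fc a (upd σ j) := face_of j 1 hjσ (by decide) fun t ht hne => sign_pos (sub_pos.2 (hlt_j t ht hne))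
  have hrest : ∀ m, m ≠ i → m ≠ j → coef F (Fc a) σ m * sg F (es a (upd σ m)) = 0 := by
    intro m hmi hmj
    by_contra hne
    obtain ⟨hm, hfm⟩ := coef_ne (left_ne_zero_of_mul hne)
    have hzm : (zs (upd σ m)).card = d := by rw [zs_upd hm, hz]
    have e1 := es_eq h hN hfm hzm (j := i) (by rwa [upd_ne σ hmi.symm])
    have e2 := es_eq h hN hfm hzm (j := j) (by rwa [upd_ne σ hmj.symm])
    rw [upd_ne σ hmi.symm, ph_zl_upd hm, sign_mul, hsg i m hiσ hm, sign_pos (sub_pos.2 (hlt_i m hm hmi))] at e1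
    rw [upd_ne σ hmj.symm, ph_zl_upd hm, sign_mul, hsg j m hjσ hm, sign_neg (sub_neg.2 (hlt_j m hm hmj)), e1] at e2
    have h3 : SignType.sign ((-1 : ℝ) ^ zb σ m) ≠ 0 := by
      rw [ne_eq, sign_eq_zero_iff]; exact pow_ne_zero _ (by norm_num)
    exact sgn_aux2 _ _ _ _ _ hi0 hiσ hjσ hm h3 e2
  rw [← Finset.add_sum_erase _ _ (Finset.mem_univ i), ← Finset.add_sum_erase _ _ (show j ∈ Finset.univ.erase i by simp [hij.symm])]
  rw [Finset.sum_eq_zero (fun m hm => ?_), add_zero]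
  · rw [wall_term h hN hz hiσ fi hjσ hij.symm, wall_term h hN hz hjσ fj hiσ hij, ph_anti (zl σ) i j, mul_comm (σ i) (σ j)]
    rw [show SignType.sign (-ph a (j :: zl σ) (a i)) = - SignType.sign (ph a (j :: zl σ) (a i)) from Left.sign_neg _]
    generalize SignType.sign (ph a (j :: zl σ) (a i)) = s1
    rw [mul_neg]
    generalize σ j * σ i * s1 = s
    cases s <;> simp [sg]
  · have hm := Finset.mem_erase.1 hm
    exact hrest m (Finset.mem_erase.1 hm.2).1 hm.1

end eps
end DT


namespace DT

section Ifun

lemma TT_prod_ne {R M : Type*} [CommRing R] [AddCommGroup M] [Module R M] {N : ℕ} (g : M [⋀^Fin N]→ₗ[R] R) (l : List M) (h : l.length ≠ N) :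
    TT g (l.map (ExteriorAlgebra.ι R)).prod = 0 := by
  have : (l.map (ExteriorAlgebra.ι R)).prod = ExteriorAlgebra.ιMulti R l.length l.get := by
    rw [ExteriorAlgebra.ιMulti_apply]
    congr 1
    conv_lhs => rw [← List.ofFn_get l, List.map_ofFn]
    rfl
  rw [this, TT, ExteriorAlgebra.liftAlternating_apply_ιMulti]
  simp [TA, h]

variable (F : Type*) [Field F] {V : Type*} [Fintype V] [DecidableEq V] {N : ℕ}

/-- alternating form on the free module with prescribed values on the basis -/
noncomputable def altK (kap : (Fin N → V) → F) (hs : ∀ t i j, i ≠ j → kap (t ∘ Equiv.swap i j) = - kap t)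
    (he : ∀ t i j, i ≠ j → t i = t j → kap t = 0) : (V →₀ F) [⋀^Fin N]→ₗ[F] F :=
  { (∑ t : Fin N → V, kap t • (MultilinearMap.mkPiAlgebra F (Fin N) F).compLinearMap (fun i => Finsupp.lapply (t i)) :
      MultilinearMap F (fun _ : Fin N => V →₀ F) F) with
    map_eq_zero_of_eq' := by
      intro v i j hv hij
      simp only [MultilinearMap.toFun_eq_coe, sum_apply, smul_apply, MultilinearMap.compLinearMap_apply,
        MultilinearMap.mkPiAlgebra_apply, Finsupp.lapply_apply, smul_eq_mul]
      refine Finset.sum_involution (fun t _ => t ∘ Equiv.swap i j) ?_ ?_ (fun _ _ => Finset.mem_univ _) ?_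
      · intro t _
        have : ∏ x, v x ((t ∘ Equiv.swap i j) x) = ∏ x, v x (t x) := by
          rw [← Equiv.prod_comp (Equiv.swap i j)]
          refine Finset.prod_congr rfl fun x _ => ?_
          simp only [Function.comp_apply, Equiv.swap_apply_self]
          congr 1
          by_cases hx : x = i
          · subst hx; rw [Equiv.swap_apply_left, hv]
          by_cases hx : x = j
          · subst hx; rw [Equiv.swap_apply_right, hv]
          · rw [Equiv.swap_apply_of_ne_of_ne] <;> assumption
        rw [this, hs t i j hij]; ring
      · intro t _ hne heq
        apply hne
        have : t i = t j := by
          have := congrFun heq j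
          simpa using this
        rw [he t i j hij this, zero_mul]
      · intro t _
        funext x; simp }

lemma altK_single (kap : (Fin N → V) → F) (hs : ∀ t i j, i ≠ j → kap (t ∘ Equiv.swap i j) = - kap t)
    (he : ∀ t i j, i ≠ j → t i = t j → kap t = 0) (t : Fin N → V) :
    altK F kap hs he (fun i => Finsupp.single (t i) 1) = kap t := by
  change (∑ t : Fin N → V, kap t • (MultilinearMap.mkPiAlgebra F (Fin N) F).compLinearMap (fun i => Finsupp.lapply (t i)) :
      MultilinearMap F (fun _ : Fin N => V →₀ F) F) _ = _
  simp only [sum_apply, smul_apply, MultilinearMap.compLinearMap_apply,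
        MultilinearMap.mkPiAlgebra_apply, Finsupp.lapply_apply, smul_eq_mul]
  rw [Finset.sum_eq_single t]
  · simp
  · intro t' _ hne
    obtain ⟨i, hi⟩ := Function.ne_iff.1 hne
    rw [Finset.prod_eq_zero (Finset.mem_univ i), mul_zero]
    rw [Finsupp.single_apply, if_neg hi.symm]
  · simp

variable (u : V → Fin N → ℝ) (eh : Fin N → ℝ)

def inC {V : Type*} {N M : ℕ} (u : V → Fin N → ℝ) (eh : Fin N → ℝ) (t : Fin M → V) : Prop :=
  ∃ c : Fin M → ℝ, (∀ j, 0 ≤ c j) ∧ ∑ j, c j • u (t j) = eh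

open Classical in
noncomputable def kap {V : Type*} (u : V → Fin N → ℝ) (eh : Fin N → ℝ) (t : Fin N → V) : F :=
  if inC u eh t then sg F (SignType.sign (Matrix.det (Matrix.of (fun i => u (t i))))) else 0

lemma inC_perm {V : Type*} (u : V → Fin N → ℝ) (eh : Fin N → ℝ) (t : Fin N → V) (π : Equiv.Perm (Fin N)) :
    inC u eh (t ∘ π) ↔ inC u eh t := by
  constructor
  · rintro ⟨c, h1, h2⟩
    refine ⟨c ∘ π.symm, fun j => h1 _, ?_⟩
    rw [← h2, ← Equiv.sum_comp π]; simp
  · rintro ⟨c, h1, h2⟩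
    refine ⟨c ∘ π, fun j => h1 _, ?_⟩
    rw [← h2]; exact Equiv.sum_comp π (fun j => c j • u (t j))

lemma sg_neg (s : SignType) : sg F (-s) = - sg F s := by cases s <;> simp [sg]

lemma kap_swap {V : Type*} (u : V → Fin N → ℝ) (eh : Fin N → ℝ) (t : Fin N → V) (i j : Fin N) (hij : i ≠ j) :
    kap F u eh (t ∘ Equiv.swap i j) = - kap F u eh t := by
  unfold kap
  rw [inC_perm]
  have := Matrix.det_permute (Equiv.swap i j) (Matrix.of (fun i => u (t i)))
  rw [Equiv.Perm.sign_swap hij] at this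
  have h2 : Matrix.det (Matrix.of (fun x => u ((t ∘ Equiv.swap i j) x))) = - Matrix.det (Matrix.of (fun i => u (t i))) := by
    rw [show Matrix.of (fun x => u ((t ∘ Equiv.swap i j) x)) = (Matrix.of (fun i => u (t i))).submatrix (Equiv.swap i j) id from rfl, this]
    simp
  rw [h2, Left.sign_neg, sg_neg]
  split_ifs <;> simp

lemma kap_eq {V : Type*} (u : V → Fin N → ℝ) (eh : Fin N → ℝ) (t : Fin N → V) (i j : Fin N) (hij : i ≠ j) (h : t i = t j) :
    kap F u eh t = 0 := by
  unfold kap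
  rw [Matrix.det_zero_of_row_eq hij (by funext x; simp [h])]
  simp [sg]

noncomputable def IL : Lam F V →ₗ[F] F := TT (altK F (kap F u eh) (kap_swap F u eh) (kap_eq F u eh))

noncomputable def II : (List V →₀ F) →ₗ[F] F := IL F u eh ∘ₗ q F

lemma IL_ofFn (t : Fin N → V) : IL F u eh ((List.ofFn t).map (iv F)).prod = kap F u eh t := by
  have : ((List.ofFn t).map (iv F)) = (List.ofFn (fun i => (Finsupp.single (t i) (1 : F)))).map (ExteriorAlgebra.ι F) := by
    rw [List.map_ofFn, List.map_ofFn]; rfl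
  rw [this, IL, TT_prod, altK_single]

lemma IL_ne (l : List V) (h : l.length ≠ N) : IL F u eh (l.map (iv F)).prod = 0 := by
  have : (l.map (iv F)) = (l.map (fun v => (Finsupp.single v (1 : F)))).map (ExteriorAlgebra.ι F) := by
    rw [List.map_map]; rfl
  rw [this, IL, TT_prod_ne]
  simpa using h

lemma II_ofFn (t : Fin N → V) : II F u eh (Finsupp.single (List.ofFn t) 1) = kap F u eh t := by
  rw [II, LinearMap.comp_apply, q_single, one_smul, IL_ofFn]

lemma exists_ofFn {V : Type*} {N : ℕ} (l : List V) (h : l.length = N) : ∃ t : Fin N → V, l = List.ofFn t := by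
  subst h; exact ⟨l.get, (List.ofFn_get l).symm⟩

lemma II_act (f : V → V) (h : ∀ t : Fin N → V, kap F u eh (f ∘ t) = kap F u eh t) (x : List V →₀ F) :
    II F u eh (act F f x) = II F u eh x := by
  have : II F u eh ∘ₗ act F f = II F u eh := by
    apply hom_ext
    intro l
    rw [LinearMap.comp_apply, act_single]
    by_cases hl : l.length = N
    · obtain ⟨t, rfl⟩ := exists_ofFn l hl
      rw [List.map_ofFn, II_ofFn, II_ofFn, h]
    · rw [II, LinearMap.comp_apply, LinearMap.comp_apply, q_single, q_single, map_smul, map_smul, IL_ne _ _ _ _ hl, IL_ne _ _ _ _ (by simpa using hl)]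
  exact LinearMap.congr_fun this x

lemma bd_ofFn {V : Type*} (M : ℕ) (t : Fin (M+1) → V) :
    bd F (Finsupp.single (List.ofFn t) 1) = ∑ i : Fin (M+1), (-1 : F) ^ (i : ℕ) • Finsupp.single (List.ofFn (t ∘ i.succAbove)) 1 := by
  induction M with
  | zero => rw [bd_single]; simp [bdL]
  | succ M ih =>
    rw [List.ofFn_succ, ← consL_single, bd_cons, ih, sub_eq_add_neg]
    conv_rhs => rw [Fin.sum_univ_succ]
    congr 1
    · simp [Function.comp_def]
    · rw [map_sum, ← Finset.sum_neg_distrib]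
      refine Finset.sum_congr rfl fun i _ => ?_
      rw [map_smul, consL_single, ← neg_smul]
      congr 1
      · simp [pow_succ]
      · rw [List.ofFn_succ]
        congr 2
        congr 1
        funext y
        simp

lemma gamma_rel {N : ℕ} (w : Fin (N+1) → Fin N → ℝ) :
    ∑ i : Fin (N+1), ((-1 : ℝ) ^ (i : ℕ) * Matrix.det (Matrix.of (fun j => w (i.succAbove j)))) • w i = 0 := by
  funext m
  let A : Matrix (Fin (N+1)) (Fin (N+1)) ℝ := Matrix.of (fun i => Fin.cons (w i m) (w i))
  have h0 : A.det = 0 := Matrix.det_zero_of_column_eq (i := 0) (j := m.succ) (Fin.succ_ne_zero m).symm (by intro k; simp [A])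
  rw [Matrix.det_succ_column_zero] at h0
  simp only [Finset.sum_apply, Pi.smul_apply, smul_eq_mul, Pi.zero_apply]
  rw [← h0]
  refine Finset.sum_congr rfl fun i _ => ?_
  have : A.submatrix i.succAbove Fin.succ = Matrix.of (fun j => w (i.succAbove j)) := by
    ext x y; simp [A]
  rw [this]
  simp only [A, Matrix.of_apply, Fin.cons_zero]
  ring

/-- the solution segment has two ends -/
lemma seg_ends {M : ℕ} (γ : Fin M → ℝ) (S : Set (Fin M → ℝ))
    (hγ : ∀ c ∈ S, ∀ c' ∈ S, ∃ τ : ℝ, c' = c + τ • γ)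
    (hS : ∀ c ∈ S, ∀ i, 0 ≤ c i)
    (hS2 : ∀ c ∈ S, ∀ τ : ℝ, (∀ i, 0 ≤ (c + τ • γ) i) → c + τ • γ ∈ S)
    (hgen : ∀ c ∈ S, ∀ i j, c i = 0 → c j = 0 → i = j)
    (hneg : ∀ i, 0 < γ i → ∃ j, γ j < 0)
    (i : Fin M) (hi : 0 < γ i) (hE : ∃ c ∈ S, c i = 0) :
    (∀ i', 0 < γ i' → (∃ c ∈ S, c i' = 0) → i' = i) ∧ ∃ j, γ j < 0 ∧ ∃ c ∈ S, c j = 0 := by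
  classical
  obtain ⟨c, hc, hci⟩ := hE
  constructor
  · rintro i' hi' ⟨c', hc', hci'⟩
    obtain ⟨τ, hτ⟩ := hγ c hc c' hc'
    have h1 : 0 ≤ τ * γ i := by
      have := hS c' hc' i; rw [hτ] at this; simpa [hci] using this
    have h2 : c i' + τ * γ i' = 0 := by
      rw [hτ] at hci'; simpa using hci'
    have h3 := hS c hc i'
    have h4 : 0 ≤ τ := by
      by_contra hcon; push Not at hcon; nlinarith
    have h5 : c i' = 0 := by nlinarith [mul_nonneg h4 hi'.le]
    exact hgen c hc i' i h5 hci
  · obtain ⟨j0, hj0⟩ := hneg i hi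
    obtain ⟨j, hj, hmin⟩ := Finset.exists_min_image (Finset.univ.filter (fun j => γ j < 0)) (fun j => c j / (- γ j)) ⟨j0, by simpa using hj0⟩
    have hj : γ j < 0 := by simpa using hj
    refine ⟨j, hj, c + (c j / (- γ j)) • γ, hS2 c hc _ ?_, ?_⟩
    · intro m
      simp only [Pi.add_apply, Pi.smul_apply, smul_eq_mul]
      have hnn : 0 ≤ c j / (- γ j) := div_nonneg (hS c hc j) (by linarith)
      rcases lt_or_ge (γ m) 0 with hm | hm
      · have := hmin m (by simpa using hm)
        have h3 : c j / (- γ j) * (- γ m) ≤ c m := by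
          have := mul_le_mul_of_nonneg_right this (by linarith : 0 ≤ - γ m)
          rwa [div_mul_cancel₀ _ (by linarith : - γ m ≠ 0)] at this
        linarith
      · have := mul_nonneg hnn hm
        have := hS c hc m
        linarith
    · simp only [Pi.add_apply, Pi.smul_apply, smul_eq_mul]
      rw [div_neg, neg_mul, div_mul_cancel₀ _ hj.ne]
      ring

lemma seg_sum {M : ℕ} (γ : Fin M → ℝ) (S : Set (Fin M → ℝ))
    (hγ : ∀ c ∈ S, ∀ c' ∈ S, ∃ τ : ℝ, c' = c + τ • γ)
    (hS : ∀ c ∈ S, ∀ i, 0 ≤ c i)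
    (hS2 : ∀ c ∈ S, ∀ τ : ℝ, (∀ i, 0 ≤ (c + τ • γ) i) → c + τ • γ ∈ S)
    (hgen : ∀ c ∈ S, ∀ i j, c i = 0 → c j = 0 → i = j)
    (hneg : ∀ i, 0 < γ i → ∃ j, γ j < 0) (hpos : ∀ i, γ i < 0 → ∃ j, 0 < γ j)
    (E : Fin M → F) (hE1 : ∀ i, (∃ c ∈ S, c i = 0) → E i = sg F (SignType.sign (γ i)))
    (hE2 : ∀ i, (¬ ∃ c ∈ S, c i = 0) → E i = 0) : ∑ i, E i = 0 := by
  classical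
  have P := seg_ends γ S hγ hS hS2 hgen hneg
  have Q : ∀ (i : Fin M) (_ : γ i < 0) (_ : ∃ c ∈ S, c i = 0),
    (∀ i', γ i' < 0 → (∃ c ∈ S, c i' = 0) → i' = i) ∧ ∃ j, 0 < γ j ∧ ∃ c ∈ S, c j = 0 := by
    intro i hi hE
    have := seg_ends (-γ) S (fun c hc c' hc' => by
        obtain ⟨τ, hτ⟩ := hγ c hc c' hc'
        exact ⟨-τ, by rw [hτ]; simp⟩) hS
      (fun c hc τ h => by
        have := hS2 c hc (-τ) (by simpa using h)
        simpa using this) hgen (fun i hi => by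
          obtain ⟨j, hj⟩ := hpos i (by simpa using hi)
          exact ⟨j, by simpa using hj⟩) i (by simpa using hi) hE
    simpa using this
  by_cases hall : ∀ i, E i = 0
  · exact Finset.sum_eq_zero fun i _ => hall i
  push Not at hall
  obtain ⟨i, hi⟩ := hall
  have hne : ∀ i, E i ≠ 0 → (∃ c ∈ S, c i = 0) ∧ γ i ≠ 0 := by
    intro i hi
    by_cases h : ∃ c ∈ S, c i = 0
    · refine ⟨h, fun h0 => hi ?_⟩
      rw [hE1 i h, h0]; simp [sg]
    · exact absurd (hE2 i h) hi
  -- get one positive and one negative end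
  obtain ⟨i, j, hi, hiE, hj, hjE⟩ : ∃ i j, 0 < γ i ∧ (∃ c ∈ S, c i = 0) ∧ γ j < 0 ∧ (∃ c ∈ S, c j = 0) := by
    obtain ⟨h1, h2⟩ := hne i hi
    rcases lt_or_gt_of_ne h2 with h2 | h2
    · obtain ⟨j, hj, hjE⟩ := (Q i h2 h1).2
      exact ⟨j, i, hj, hjE, h2, h1⟩
    · obtain ⟨j, hj, hjE⟩ := (P i h2 h1).2
      exact ⟨i, j, h2, h1, hj, hjE⟩
  have hij : j ≠ i := by rintro rfl; linarith
  rw [← Finset.add_sum_erase _ _ (Finset.mem_univ i), ← Finset.add_sum_erase _ _ (show j ∈ Finset.univ.erase i by simp [hij])]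
  rw [Finset.sum_eq_zero (fun m hm => ?_), add_zero, hE1 i hiE, hE1 j hjE, sign_pos hi, sign_neg hj]
  · simp [sg]
  · by_contra hm0
    obtain ⟨h1, h2⟩ := hne m hm0
    have hm1 := Finset.mem_erase.1 hm
    rcases lt_or_gt_of_ne h2 with h2 | h2
    · exact hm1.1 ((Q j hj hjE).1 m h2 h1)
    · exact (Finset.mem_erase.1 hm1.2).1 ((P i hi hiE).1 m h2 h1)

/-- cocycle property of the intersection functional -/
theorem kap_cocycle {V : Type*} (u : V → Fin N → ℝ) (eh : Fin N → ℝ) (t : Fin (N+1) → V) (f : Module.Dual ℝ (Fin N → ℝ))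
    (hf : ∀ i, 0 < f (u (t i)))
    (hgen : ∀ c : Fin (N+1) → ℝ, (∀ i, 0 ≤ c i) → ∑ i, c i • u (t i) = eh → ∀ i j, c i = 0 → c j = 0 → i = j) :
    ∑ i : Fin (N+1), (-1 : F) ^ (i : ℕ) * kap F u eh (t ∘ i.succAbove) = 0 := by
  classical
  let γ : Fin (N+1) → ℝ := fun i => (-1 : ℝ) ^ (i : ℕ) * Matrix.det (Matrix.of (fun j => u (t (i.succAbove j))))
  have hγ0 : ∑ i, γ i • u (t i) = 0 := gamma_rel (fun i => u (t i))
  by_cases hz : ∀ i, γ i = 0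
  · refine Finset.sum_eq_zero fun i _ => ?_
    have : Matrix.det (Matrix.of (fun j => u (t (i.succAbove j)))) = 0 := by
      have := hz i
      simpa [γ] using this
    simp only [kap, Function.comp_apply, this]
    simp [sg]
  push Not at hz
  obtain ⟨i0, hi0⟩ := hz
  have hind : LinearIndependent ℝ (fun j => u (t (i0.succAbove j))) := by
    have h1 : Matrix.det (Matrix.of (fun j => u (t (i0.succAbove j)))) ≠ 0 := right_ne_zero_of_mul hi0
    exact Matrix.linearIndependent_rows_iff_isUnit.2 ((Matrix.isUnit_iff_isUnit_det _).2 h1.isUnit)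
  have hker : ∀ δ : Fin (N+1) → ℝ, ∑ i, δ i • u (t i) = 0 → ∃ τ : ℝ, δ = τ • γ := by
    intro δ hδ
    refine ⟨δ i0 / γ i0, ?_⟩
    have h1 : ∑ i, (δ i - δ i0 / γ i0 * γ i) • u (t i) = 0 := by
      simp only [sub_smul, Finset.sum_sub_distrib, hδ, mul_smul, ← Finset.smul_sum, hγ0]
      simp
    rw [Fin.sum_univ_succAbove _ i0] at h1
    rw [div_mul_cancel₀ _ hi0, sub_self, zero_smul, zero_add] at h1
    have h2 := Fintype.linearIndependent_iff.1 hind _ h1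
    funext i
    rcases Fin.eq_self_or_eq_succAbove i0 i with rfl | ⟨j, rfl⟩
    · simp [div_mul_cancel₀ _ hi0]
    · have := h2 j
      simp only [Pi.smul_apply, smul_eq_mul]; linarith
  have hfγ : ∑ i, γ i * f (u (t i)) = 0 := by
    have := congrArg f hγ0
    simpa using this
  have hneg : ∀ i, 0 < γ i → ∃ j, γ j < 0 := by
    intro i hi
    by_contra hcon
    push Not at hcon
    have := Finset.sum_pos' (s := Finset.univ) (f := fun i => γ i * f (u (t i))) (fun j _ => mul_nonneg (hcon j) (hf j).le) ⟨i, Finset.mem_univ _, mul_pos hi (hf i)⟩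
    linarith
  have hpos : ∀ i, γ i < 0 → ∃ j, 0 < γ j := by
    intro i hi
    by_contra hcon
    push Not at hcon
    have := Finset.sum_pos' (s := Finset.univ) (f := fun i => (-γ i) * f (u (t i))) (fun j _ => mul_nonneg (by linarith [hcon j]) (hf j).le) ⟨i, Finset.mem_univ _, mul_pos (by linarith) (hf i)⟩
    simp only [neg_mul, Finset.sum_neg_distrib] at this
    linarith
  let S : Set (Fin (N+1) → ℝ) := {c | (∀ i, 0 ≤ c i) ∧ ∑ i, c i • u (t i) = eh}
  have hSE : ∀ i : Fin (N+1), (∃ c ∈ S, c i = 0) ↔ inC u eh (t ∘ i.succAbove) := by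
    intro i
    constructor
    · rintro ⟨c, ⟨h1, h2⟩, h3⟩
      refine ⟨c ∘ i.succAbove, fun j => h1 _, ?_⟩
      rw [Fin.sum_univ_succAbove _ i, h3, zero_smul, zero_add] at h2
      exact h2
    · rintro ⟨c, h1, h2⟩
      refine ⟨i.insertNth 0 c, ⟨?_, ?_⟩, by simp⟩
      · intro j
        rcases Fin.eq_self_or_eq_succAbove i j with rfl | ⟨j, rfl⟩
        · simp
        · simpa using h1 j
      · rw [Fin.sum_univ_succAbove _ i]
        simpa using h2
  refine seg_sum F γ S ?_ (fun c hc => hc.1) ?_ (fun c hc => hgen c hc.1 hc.2) hneg hpos _ ?_ ?_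
  · rintro c ⟨_, h1⟩ c' ⟨_, h2⟩
    obtain ⟨τ, hτ⟩ := hker (c' - c) (by simp [sub_smul, h1, h2])
    exact ⟨τ, by rw [← hτ]; simp⟩
  · rintro c ⟨_, h1⟩ τ h2
    refine ⟨h2, ?_⟩
    simp only [Pi.add_apply, Pi.smul_apply, smul_eq_mul, add_smul, Finset.sum_add_distrib, mul_smul, ← Finset.smul_sum, h1, hγ0]
    simp
  · intro i hi
    rw [kap, if_pos ((hSE i).1 hi)]
    simp only [γ, sign_mul, sign_negpow, sg_mul, sg_negpow, Function.comp_apply]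
  · intro i hi
    rw [kap, if_neg (fun h => hi ((hSE i).2 h)), mul_zero]

theorem II_bd (t : Fin (N+1) → V) (f : Module.Dual ℝ (Fin N → ℝ))
    (hf : ∀ i, 0 < f (u (t i)))
    (hgen : ∀ c : Fin (N+1) → ℝ, (∀ i, 0 ≤ c i) → ∑ i, c i • u (t i) = eh → ∀ i j, c i = 0 → c j = 0 → i = j) :
    II F u eh (bd F (Finsupp.single (List.ofFn t) 1)) = 0 := by
  rw [bd_ofFn, map_sum, ← kap_cocycle F u eh t f hf hgen]
  refine Finset.sum_congr rfl fun i _ => ?_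
  rw [map_smul, II_ofFn, smul_eq_mul]

end Ifun
end DT


namespace DT

section Conc

variable {d N p k : ℕ} {a : Fin N → Fin (d+1) → ℝ} {e : Fin (d+1) → ℝ}

/-- the vector `e` is in general position with respect to the family -/
def GP2 {d N : ℕ} (a : Fin N → Fin (d+1) → ℝ) (e : Fin (d+1) → ℝ) : Prop :=
  ∀ s : Finset (Fin N), s.card ≤ d → e ∉ Submodule.span ℝ (a '' (s : Set (Fin N)))

abbrev GG (p k : ℕ) := Fin k → ZMod p

def uu {d N p k : ℕ} (a : Fin N → Fin (d+1) → ℝ) (ψ : Fin N ≃ GG p k × Fin (d+1)) (v : VV N (GG p k)) (m : Fin N) : ℝ :=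
  if (ψ m).1 = v.2 then (v.1.2 : ℝ) * a v.1.1 (ψ m).2 else 0

def ee {d N p k : ℕ} (e : Fin (d+1) → ℝ) (ψ : Fin N ≃ GG p k × Fin (d+1)) (m : Fin N) : ℝ := e (ψ m).2

def gl (p k l : ℕ) : GG p k := fun i => if i.val = l then 1 else 0

def ff (N p k : ℕ) (l : ℕ) (v : VV N (GG p k)) : VV N (GG p k) := (v.1, v.2 + gl p k l)

lemma ff_iter (l m : ℕ) (v : VV N (GG p k)) : (ff N p k l)^[m] v = (v.1, v.2 + m • gl p k l) := by
  induction m with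
  | zero => simp
  | succ m ih => rw [Function.iterate_succ_apply', ih, ff, succ_nsmul, add_assoc]

lemma ff_p (l : ℕ) : (ff N p k l)^[p] = id := by
  funext v
  rw [ff_iter]
  have : p • gl p k l = 0 := by
    funext i; simp
  rw [this]; simp

lemma ff_comm (l l' : ℕ) : Function.Commute (ff N p k l) (ff N p k l') := by
  intro v
  simp [ff, add_right_comm]

lemma color_sum (ψ : Fin N ≃ GG p k × Fin (d+1)) {M : ℕ} (t : Fin M → VV N (GG p k)) (c : Fin M → ℝ)
    (h : ∑ i, c i • uu a ψ (t i) = ee e ψ) (g : GG p k) :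
    ∑ i ∈ Finset.univ.filter (fun i => (t i).2 = g), (c i * ((t i).1.2 : ℝ)) • a (t i).1.1 = e := by
  funext j
  have := congrFun h (ψ.symm (g, j))
  simp only [Finset.sum_apply, Pi.smul_apply, smul_eq_mul, uu, ee, Equiv.apply_symm_apply] at this
  rw [← this, Finset.sum_apply, Finset.sum_filter]
  refine Finset.sum_congr rfl fun i _ => ?_
  by_cases hi : (t i).2 = g
  · simp [hi, mul_assoc]
  · simp [hi, Ne.symm hi]

lemma color_card (h2 : GP2 a e) (ψ : Fin N ≃ GG p k × Fin (d+1)) {M : ℕ} (t : Fin M → VV N (GG p k)) (c : Fin M → ℝ)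
    (h : ∑ i, c i • uu a ψ (t i) = ee e ψ) (g : GG p k) :
    d + 1 ≤ (Finset.univ.filter (fun i => (t i).2 = g ∧ c i ≠ 0)).card := by
  classical
  by_contra hcon
  push Not at hcon
  refine h2 ((Finset.univ.filter (fun i => (t i).2 = g ∧ c i ≠ 0)).image (fun i => (t i).1.1))
    (Finset.card_image_le.trans (by omega)) ?_
  rw [← color_sum ψ t c h g]
  refine Submodule.sum_mem _ fun i hi => ?_
  by_cases hc : c i = 0
  · simp [hc]
  · refine Submodule.smul_mem _ _ (Submodule.subset_span ⟨(t i).1.1, ?_, rfl⟩)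
    simp only [Finset.coe_image, Set.mem_image, Finset.mem_coe, Finset.mem_filter, Finset.mem_univ, true_and] at hi ⊢
    exact ⟨i, ⟨hi, hc⟩, rfl⟩

lemma color_total [Fact p.Prime] (h2 : GP2 a e) (ψ : Fin N ≃ GG p k × Fin (d+1)) {M : ℕ} (t : Fin M → VV N (GG p k)) (c : Fin M → ℝ)
    (h : ∑ i, c i • uu a ψ (t i) = ee e ψ) : N ≤ (Finset.univ.filter (fun i => c i ≠ 0)).card := by
  classical
  have hN : N = Fintype.card (GG p k) * (d+1) := by
    have := Fintype.card_congr ψ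
    simpa using this
  have h1 : (Finset.univ.filter (fun i => c i ≠ 0)).card = ∑ g : GG p k, (Finset.univ.filter (fun i => (t i).2 = g ∧ c i ≠ 0)).card := by
    rw [Finset.card_eq_sum_card_fiberwise (f := fun i => (t i).2) (t := Finset.univ) (by intro x _; simp)]
    refine Finset.sum_congr rfl fun g _ => ?_
    congr 1
    ext i
    simp [and_comm]
  rw [h1]
  calc N = ∑ g : GG p k, (d+1) := by rw [hN]; simp
    _ ≤ _ := Finset.sum_le_sum fun g _ => color_card h2 ψ t c h g

lemma kap_ff [Fact p.Prime] (F : Type*) [Field F] [CharP F p] (ψ : Fin N ≃ GG p k × Fin (d+1)) (l : ℕ) (t : Fin N → VV N (GG p k)) :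
    kap F (uu a ψ) (ee e ψ) (ff N p k l ∘ t) = kap F (uu a ψ) (ee e ψ) t := by
  let π : Equiv.Perm (Fin N) := ψ.trans (((Equiv.subRight (gl p k l)).prodCongr (Equiv.refl _)).trans ψ.symm)
  have hπ : ∀ m, ψ (π m) = ((ψ m).1 - gl p k l, (ψ m).2) := by intro m; simp only [π, Equiv.trans_apply, Equiv.apply_symm_apply]; rfl
  have hu : ∀ v m, uu a ψ (ff N p k l v) m = uu a ψ v (π m) := by
    intro v m
    simp only [uu, ff, hπ]
    exact if_congr sub_eq_iff_eq_add.symm rfl rfl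
  have he : ∀ m, ee e ψ (π m) = ee e ψ m := by intro m; simp [ee, hπ]
  have hin : inC (uu a ψ) (ee e ψ) (ff N p k l ∘ t) ↔ inC (uu a ψ) (ee e ψ) t := by
    refine exists_congr fun c => and_congr_right fun _ => ?_
    constructor
    · intro h
      funext m
      have := congrFun h (π.symm m)
      simp only [Finset.sum_apply, Pi.smul_apply, Function.comp, hu, Equiv.apply_symm_apply] at this ⊢
      rw [this, ← he, Equiv.apply_symm_apply]
    · intro h
      funext m
      have := congrFun h (π m)
      simp only [Finset.sum_apply, Pi.smul_apply, Function.comp, hu] at this ⊢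
      rw [this, he]
  have hpow : π ^ p = 1 := by
    have : ∀ n m, ψ ((π ^ n) m) = ((ψ m).1 - n • gl p k l, (ψ m).2) := by
      intro n
      induction n with
      | zero => simp
      | succ n ih => intro m; rw [pow_succ', Equiv.Perm.mul_apply, hπ, ih, succ_nsmul, sub_sub]
    ext m
    have h0 : p • gl p k l = 0 := by
      funext i; simp
    have := this p m
    rw [h0] at this
    simp only [sub_zero, Prod.mk.eta, EmbeddingLike.apply_eq_iff_eq] at this
    rw [this]; rfl
  have hdet : (Matrix.of (fun i => uu a ψ ((ff N p k l ∘ t) i))).det = (Equiv.Perm.sign π : ℤ) * (Matrix.of (fun i => uu a ψ (t i))).det := by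
    rw [← Matrix.det_permute']
    congr 1
    ext i j
    simp [hu]
  have hsg : sg F (SignType.sign (Matrix.of (fun i => uu a ψ ((ff N p k l ∘ t) i))).det) = sg F (SignType.sign (Matrix.of (fun i => uu a ψ (t i))).det) := by
    rw [hdet]
    rcases Int.units_eq_one_or (Equiv.Perm.sign π) with h | h
    · simp [h]
    · have h2 := congrArg Equiv.Perm.sign hpow
      rw [map_pow, h, map_one] at h2
      have hp2 : p = 2 := by
        rcases Nat.even_or_odd p with hev | hodd
        · exact (Nat.Prime.even_iff (Fact.out)).1 hev
        · rw [hodd.neg_one_pow] at h2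
          exact absurd h2 (by decide)
      subst hp2
      rw [h]
      simp only [Units.val_neg, Units.val_one, Int.cast_neg, Int.cast_one, neg_mul, one_mul]
      rw [Left.sign_neg, sg_neg, CharTwo.neg_eq]
  unfold kap
  rw [hsg]
  by_cases h : inC (uu a ψ) (ee e ψ) t
  · rw [if_pos h, if_pos (hin.2 h)]
  · rw [if_neg h, if_neg (fun h' => h (hin.1 h'))]

lemma II_I2 [Fact p.Prime] (F : Type*) [Field F] (h2 : GP2 a e) (ψ : Fin N ≃ GG p k × Fin (d+1)) (σ : Fin N → SignType) (hσ : Fc a σ)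
    (x : List (VV N (GG p k))) (hx : x ∈ AH (GG p k) σ (N+1)) :
    II F (uu a ψ) (ee e ψ) (bd F (Finsupp.single x 1)) = 0 := by
  classical
  obtain ⟨hx1, hx2⟩ := hx
  obtain ⟨t, rfl⟩ := exists_ofFn x hx1
  obtain ⟨ℓ, -, hℓ⟩ := hσ
  let sc : (Fin N → ℝ) →ₗ[ℝ] (Fin (d+1) → ℝ) := LinearMap.pi (fun j => ∑ g : GG p k, LinearMap.proj (ψ.symm (g, j)))
  have hsc : ∀ v, sc (uu a ψ v) = (v.1.2 : ℝ) • a v.1.1 := by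
    intro v
    funext j
    simp [sc, uu]
  refine II_bd F _ _ t (ℓ ∘ₗ sc) ?_ ?_
  · intro i
    have := hx2 (t i) ((List.mem_ofFn' t _).2 ⟨i, rfl⟩)
    obtain ⟨h3, h4⟩ := this
    rw [LinearMap.comp_apply, hsc, map_smul, smul_eq_mul, h3]
    rw [h3, ← hℓ] at h4
    rw [← hℓ]
    have h5 : ℓ (a (t i).1.1) ≠ 0 := by simpa using h4
    rw [sign_mul_self]
    exact abs_pos.2 h5
  · intro c _ hc i j hi hj
    by_contra hij
    have h3 := color_total h2 ψ t c hc
    have : (Finset.univ.filter (fun i => c i ≠ 0)) ⊆ (Finset.univ.erase i).erase j := by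
      intro m hm
      simp only [Finset.mem_filter, Finset.mem_univ, true_and, Finset.mem_erase, and_true] at hm ⊢
      exact ⟨fun h => hm (h ▸ hj), fun h => hm (h ▸ hi)⟩
    have := Finset.card_le_card this
    rw [Finset.card_erase_of_mem (by simp [Ne.symm hij]), Finset.card_erase_of_mem (by simp)] at this
    rw [Finset.card_univ, Fintype.card_fin] at this
    have hN : 0 < N := by
      have := (ψ.symm (0, 0)).2
      omega
    omega

end Conc

end DT


namespace DT

section Eval

variable {d N p k n : ℕ} {a : Fin N → Fin (d+1) → ℝ} {e : Fin (d+1) → ℝ}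

open Classical in
noncomputable def mi {N : ℕ} (hN : 0 < N) (σ : Fin N → SignType) : Fin N :=
  if h : ∃ i, σ i ≠ 0 ∧ ∀ j < i, σ j = 0 then h.choose else ⟨0, hN⟩

lemma mi_eq (hN : 0 < N) {σ : Fin N → SignType} {i : Fin N} (hi : σ i ≠ 0) (hj : ∀ j < i, σ j = 0) : mi hN σ = i := by
  have h : ∃ i, σ i ≠ 0 ∧ ∀ j < i, σ j = 0 := ⟨i, hi, hj⟩
  rw [mi, dif_pos h]
  obtain ⟨h1, h2⟩ := h.choose_spec
  rcases lt_trichotomy h.choose i with h3 | h3 | h3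
  · exact absurd (hj _ h3) h1
  · exact h3
  · exact absurd (h2 _ h3) hi

lemma mi_spec (hN : 0 < N) {σ : Fin N → SignType} {i : Fin N} (hi : σ i ≠ 0) : σ (mi hN σ) ≠ 0 := by
  classical
  have hne : (Finset.univ.filter (fun i => σ i ≠ 0)).Nonempty := ⟨i, by simp [hi]⟩
  have h1 := Finset.min'_mem _ hne
  rw [mi_eq hN (i := (Finset.univ.filter (fun i => σ i ≠ 0)).min' hne)]
  · simpa using h1
  · simpa using h1
  · intro j hj
    by_contra hc
    exact absurd (Finset.min'_le _ j (by simp [hc])) (not_le.2 hj)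

noncomputable def vx0 (p k : ℕ) {N : ℕ} (hN : 0 < N) (σ : Fin N → SignType) : VV N (GG p k) := ((mi hN σ, σ (mi hN σ)), 0)

def trc {N : ℕ} (σ : Fin N → SignType) (j : ℕ) (i : Fin N) : SignType := if i.val < j then 0 else σ i

lemma trc_zero (σ : Fin N → SignType) : trc σ 0 = σ := by funext i; simp [trc]

lemma upd_trc (σ : Fin N → SignType) (j : ℕ) (hj : j < N) : upd (trc σ j) ⟨j, hj⟩ = trc σ (j+1) := by
  funext i
  by_cases hi : i = ⟨j, hj⟩
  · subst hi; rw [upd_self]; simp [trc]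
  · rw [upd_ne _ hi]
    have : i.val ≠ j := fun h => hi (Fin.ext h)
    simp only [trc]
    congr 1
    simp only [eq_iff_iff]
    omega

lemma nz_of_all {σ : Fin N → SignType} : nz σ = N ↔ ∀ i, σ i ≠ 0 := by
  have := nz_add_zs σ
  constructor
  · intro h i hi
    have h0 : (zs σ).card = 0 := by omega
    rw [Finset.card_eq_zero] at h0
    have := mem_zs.2 hi
    rw [h0] at this; simp at this
  · intro h
    have : zs σ = ∅ := by ext i; simp [mem_zs, h]
    simp_all

lemma nz_trc {σ : Fin N → SignType} (hσ : ∀ i, σ i ≠ 0) (j : ℕ) (hj : j ≤ N) : nz (trc σ j) + j = N := by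
  induction j with
  | zero => rw [trc_zero]; simpa using nz_of_all.2 hσ
  | succ j ih =>
    have := nz_upd (σ := trc σ j) (i := ⟨j, hj⟩) (by simp [trc, hσ])
    rw [upd_trc] at this
    have := ih (by omega)
    omega

/-- vertices of indices `d-m, ..., d` -/
noncomputable def vt (p k : ℕ) {N : ℕ} (hN : 0 < N) (σ : Fin N → SignType) (j : ℕ) : VV N (GG p k) :=
  if h : j < N then ((⟨j, h⟩, σ ⟨j, h⟩), 0) else ((⟨0, hN⟩, 0), 0)

noncomputable def vlist (d p k : ℕ) {N : ℕ} (hN : 0 < N) (σ : Fin N → SignType) : ℕ → List (VV N (GG p k))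
  | 0 => [vt p k hN σ d]
  | m + 1 => vt p k hN σ (d - (m+1)) :: vlist d p k hN σ m

lemma vlist_length (hN : 0 < N) (σ : Fin N → SignType) (m : ℕ) : (vlist d p k hN σ m).length = m + 1 := by
  induction m with
  | zero => rfl
  | succ m ih => simp [vlist, ih]

lemma mem_vlist (hN : 0 < N) (σ : Fin N → SignType) (m : ℕ) (hm : m ≤ d) (v : VV N (GG p k)) :
    v ∈ vlist d p k hN σ m ↔ ∃ j, d - m ≤ j ∧ j ≤ d ∧ v = vt p k hN σ j := by
  induction m with
  | zero =>
    simp only [vlist, List.mem_singleton]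
    constructor
    · rintro rfl; exact ⟨d, by omega, le_rfl, rfl⟩
    · rintro ⟨j, h1, h2, rfl⟩
      have : j = d := by omega
      rw [this]
  | succ m ih =>
    simp only [vlist, List.mem_cons, ih (by omega)]
    constructor
    · rintro (rfl | ⟨j, h1, h2, rfl⟩)
      · exact ⟨_, le_rfl, by omega, rfl⟩
      · exact ⟨j, by omega, h2, rfl⟩
    · rintro ⟨j, h1, h2, rfl⟩
      by_cases hj : j = d - (m+1)
      · left; rw [hj]
      · right; exact ⟨j, by omega, h2, rfl⟩

lemma sg_ne {F : Type*} [Field F] {s : SignType} (h : s ≠ 0) : sg F s ≠ 0 := by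
  cases s
  · exact absurd rfl h
  · simp [sg]
  · simp [sg]

lemma q_lam (F : Type*) [Field F] (hN : 0 < N) (h : GP1 a) (hn : n + (d+1) = N) (σ : Fin N → SignType) (hσ : ∀ i, σ i ≠ 0) (m : ℕ) (hm : m ≤ d)
    (hF : Fc a (trc σ (d - m))) :
    ∃ w : F, q F (lam F (Fc a) n (fun σ => sg F (es a σ)) (vx0 p k hN) (trc σ (d-m))) = w • ((vlist d p k hN σ m).map (iv F)).prod ∧
      (w ≠ 0 ↔ Fc a (trc σ d)) := by
  have hvx : ∀ j (hj : j < N), vx0 p k hN (trc σ j) = vt p k hN σ j := by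
    intro j hj
    have : mi hN (trc σ j) = ⟨j, hj⟩ := by
      apply mi_eq
      · simp [trc, hσ]
      · intro i hi
        have : i.val < j := hi
        simp [trc, this]
    rw [vx0, this, vt, dif_pos hj]
    simp [trc]
  induction m with
  | zero =>
    have hnz := nz_trc hσ d (by omega)
    refine ⟨sg F (es a (trc σ d)), ?_, ?_⟩
    · rw [Nat.sub_zero, lam_eq _ (by omega), q_cons, hvx d (by omega)]
      have h0 : ∑ i, coef F (Fc a) (trc σ d) i • lam F (Fc a) n (fun σ => sg F (es a σ)) (vx0 p k hN) (upd (trc σ d) i) = 0 := by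
        refine Finset.sum_eq_zero fun i _ => ?_
        have : coef F (Fc a) (trc σ d) i = 0 := by
          by_contra hc
          obtain ⟨h1, h2⟩ := coef_ne hc
          have := Fc_nz h hn h2
          have := nz_upd h1
          omega
        rw [this, zero_smul]
      rw [h0, add_zero, al0, if_pos (by omega), q_single]
      simp [vlist]
    · refine iff_of_true (sg_ne ?_) hF
      refine es_ne h (by omega) hF ?_
      have := nz_add_zs (trc σ d)
      omega
  | succ m ih =>
    have hj : d - m = d - (m+1) + 1 := by omega
    have hnz := nz_trc hσ (d-(m+1)) (by omega)
    have hlt : d - (m+1) < N := by omega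
    set j := d - (m+1) with hjdef
    rw [lam_eq _ (by omega), q_cons, hvx j (by omega), al0, if_neg (by omega), zero_add, map_sum, Finset.mul_sum,
      Finset.sum_eq_single ⟨j, hlt⟩]
    · rw [upd_trc, map_smul]
      by_cases hF' : Fc a (trc σ (d-m))
      · obtain ⟨w, hw, hw'⟩ := ih (by omega) hF'
        refine ⟨coef F (Fc a) (trc σ j) ⟨j, hlt⟩ * w, ?_, ?_⟩
        · rw [← hj, hw, vlist, List.map_cons, List.prod_cons, mul_smul_comm, mul_smul_comm, smul_smul]
        · rw [← hw', mul_ne_zero_iff]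
          refine and_iff_right ?_
          rw [coef, upd_trc, ← hj, if_pos ⟨by simp [trc, hσ], hF'⟩]
          exact mul_ne_zero (sg_ne (by simp [trc, hσ])) (pow_ne_zero _ (by simp))
      · refine ⟨0, ?_, ?_⟩
        · rw [coef, upd_trc, ← hj, if_neg (fun hh => hF' hh.2)]
          simp
        · simp only [ne_eq, not_true_eq_false, false_iff]
          intro hd
          refine hF' (Fc_FP h (by omega) _ _ hd ?_)
          intro i hi
          simp only [trc] at hi ⊢
          by_cases h1 : i.val < d
          · simp [h1] at hi
          · rw [if_neg h1, if_neg (by omega)]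
    · intro i _ hi
      rw [map_smul]
      by_cases hc : coef F (Fc a) (trc σ j) i = 0
      · simp [hc]
      obtain ⟨h1, h2⟩ := coef_ne hc
      have h3 := Fc_nz h hn h2
      rw [lam_eq _ (by omega), q_cons]
      have : vx0 p k hN (upd (trc σ j) i) = vt p k hN σ j := by
        have : mi hN (upd (trc σ j) i) = ⟨j, hlt⟩ := by
          apply mi_eq
          · rw [upd_ne _ hi.symm]; simp [trc, hσ]
          · intro i' hi'
            have : i'.val < j := hi'
            by_cases hii : i' = i
            · rw [hii, upd_self]
            · rw [upd_ne _ hii]; simp [trc, this]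
        rw [vx0, this, vt, dif_pos hlt, upd_ne _ hi.symm]
        simp [trc]
      rw [this, mul_smul_comm, ← mul_assoc, iv_sq, zero_mul, smul_zero]
    · simp

end Eval
end DT


namespace DT

section Fl

variable {d N p k n : ℕ} {a : Fin N → Fin (d+1) → ℝ} {e : Fin (d+1) → ℝ}

lemma flat_length {V : Type*} (f : ℕ → V → V) (K : ℕ) (x : List V) : (flat p f K x).length = x.length * p ^ K := by
  induction K with
  | zero => simp [flat]
  | succ K ih =>
    rw [flat, List.length_flatMap]
    simp only [List.length_map, List.length_range, List.map_const', List.sum_replicate, ih, smul_eq_mul]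
    ring

lemma flat_fst (K : ℕ) (x : List (VV N (GG p k))) (v : VV N (GG p k)) (hv : v ∈ flat p (ff N p k) K x) : ∃ w ∈ x, v.1 = w.1 := by
  induction K generalizing v with
  | zero => exact ⟨v, hv, rfl⟩
  | succ K ih =>
    rw [flat, List.mem_flatMap] at hv
    obtain ⟨y, hy, hv⟩ := hv
    obtain ⟨t, -, rfl⟩ := List.mem_map.1 hv
    rw [ff_iter]
    exact ih y hy

lemma mem_flat [Fact p.Prime] (K : ℕ) (x : List (VV N (GG p k))) (w : Fin N × SignType) (hw : (w, (0 : GG p k)) ∈ x) (g : GG p k)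
    (hg : ∀ i, K ≤ i.val → g i = 0) : (w, g) ∈ flat p (ff N p k) K x := by
  induction K generalizing g with
  | zero =>
    have : g = 0 := by funext i; exact hg i (Nat.zero_le _)
    rw [this]; exact hw
  | succ K ih =>
    rw [flat, List.mem_flatMap]
    by_cases hK : K < k
    · refine ⟨(w, Function.update g ⟨K, hK⟩ 0), ih _ ?_, List.mem_map.2 ⟨(g ⟨K, hK⟩).val, ?_, ?_⟩⟩
      · intro i hi
        by_cases h : i = ⟨K, hK⟩
        · rw [h]; simp
        · rw [Function.update_of_ne h]
          have : i.val ≠ K := fun hh => h (Fin.ext hh)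
          exact hg i (by omega)
      · exact List.mem_range.2 (ZMod.val_lt _)
      · rw [ff_iter]
        congr 1
        funext i
        by_cases h : i = ⟨K, hK⟩
        · rw [h]; simp only [Pi.add_apply, Pi.smul_apply, Function.update_self, zero_add, gl, if_true]; rw [nsmul_eq_mul, mul_one]; exact ZMod.natCast_zmod_val _
        · have : i.val ≠ K := fun hh => h (Fin.ext hh)
          simp [gl, Function.update_of_ne h, this]
    · refine ⟨(w, g), ih _ ?_, List.mem_map.2 ⟨0, ?_, rfl⟩⟩
      · intro i hi; have := i.2; omega
      · exact List.mem_range.2 (Fact.out : p.Prime).pos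

/-- coordinates of `e` in the first `d+1` vectors -/
lemma exists_coord (h : GP1 a) (h2 : GP2 a e) (hN : d + 1 ≤ N) :
    ∃ y : Fin (d+1) → ℝ, (∀ j, y j ≠ 0) ∧ ∑ j, y j • a (Fin.castLE hN j) = e := by
  classical
  have hli := h (Fin.castLE hN) (Fin.castLE_injective hN)
  let b := basisOfLinearIndependentOfCardEqFinrank hli (by simp)
  have hb : ∀ j, b j = a (Fin.castLE hN j) := by intro j; simp [b]
  have hs : ∑ j, b.repr e j • a (Fin.castLE hN j) = e := by
    simp only [← hb]; exact b.sum_repr e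
  refine ⟨b.repr e, fun j hj => ?_, hs⟩
  refine h2 ((Finset.univ.erase j).image (Fin.castLE hN)) (Finset.card_image_le.trans (by simp)) ?_
  rw [← hs]
  refine Submodule.sum_mem _ fun i _ => ?_
  by_cases hij : i = j
  · rw [hij, hj, zero_smul]; exact Submodule.zero_mem _
  · refine Submodule.smul_mem _ _ (Submodule.subset_span ⟨_, ?_, rfl⟩)
    simp only [Finset.coe_image, Set.mem_image, Finset.mem_coe, Finset.mem_erase, Finset.mem_univ, and_true]
    exact ⟨i, hij, rfl⟩

lemma sign_mul_nonneg {c : ℝ} (hc : 0 ≤ c) {s : SignType} (hs : s ≠ 0) (hne : c * (s : ℝ) ≠ 0) : SignType.sign (c * (s:ℝ)) = s := by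
  have : 0 < c := lt_of_le_of_ne hc (by rintro rfl; simp at hne)
  rw [sign_mul, sign_pos this, one_mul]
  cases s <;> simp

lemma kap_ne_imp (F : Type*) [Field F] (h : GP1 a) (hN : d + 1 ≤ N) (ψ : Fin N ≃ GG p k × Fin (d+1))
    (y : Fin (d+1) → ℝ) (hy : ∀ j, y j ≠ 0) (hye : ∑ j, y j • a (Fin.castLE hN j) = e)
    (σ : Fin N → SignType) (hσ : ∀ i, σ i ≠ 0) (t : Fin N → VV N (GG p k))
    (ht : ∀ i, ∃ j : Fin (d+1), (t i).1 = (Fin.castLE hN j, σ (Fin.castLE hN j)))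
    (hk : kap F (uu a ψ) (ee e ψ) t ≠ 0) (j : Fin (d+1)) : σ (Fin.castLE hN j) = SignType.sign (y j) := by
  classical
  have hin : inC (uu a ψ) (ee e ψ) t := by
    by_contra hc
    exact hk (by rw [kap, if_neg hc])
  obtain ⟨c, hc, hce⟩ := hin
  have h1 := color_sum ψ t c hce 0
  choose jj hjj using ht
  have hli := Fintype.linearIndependent_iff.1 (h (Fin.castLE hN) (Fin.castLE_injective hN))
  have h3 : ∑ j, (∑ i ∈ Finset.univ.filter (fun i => (t i).2 = 0) with jj i = j, c i * ((t i).1.2 : ℝ)) • a (Fin.castLE hN j) = e := by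
    rw [← h1, ← Finset.sum_fiberwise (Finset.univ.filter (fun i => (t i).2 = 0)) jj]
    refine Finset.sum_congr rfl fun j _ => ?_
    rw [Finset.sum_smul]
    refine Finset.sum_congr rfl fun i hi => ?_
    rw [Finset.mem_filter] at hi
    rw [hjj i, hi.2]
  have h4 := hli (fun j => y j - (∑ i ∈ Finset.univ.filter (fun i => (t i).2 = 0) with jj i = j, c i * ((t i).1.2 : ℝ)))
    (by simp only [sub_smul, Finset.sum_sub_distrib]; rw [h3, hye, sub_self]) j
  have h5 : y j = (∑ i ∈ Finset.univ.filter (fun i => (t i).2 = 0) with jj i = j, c i) * (σ (Fin.castLE hN j) : ℝ) := by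
    rw [sub_eq_zero.1 h4, Finset.sum_mul]
    refine Finset.sum_congr rfl fun i hi => ?_
    rw [Finset.mem_filter] at hi
    rw [hjj i, hi.2]
  have h6 := hy j
  rw [h5] at h6 ⊢
  exact (sign_mul_nonneg (Finset.sum_nonneg fun i _ => hc i) (hσ _) h6).symm

lemma kap_ne_of [Fact p.Prime] (F : Type*) [Field F] (h : GP1 a) (hN : d + 1 ≤ N) (ψ : Fin N ≃ GG p k × Fin (d+1))
    (y : Fin (d+1) → ℝ) (hye : ∑ j, y j • a (Fin.castLE hN j) = e)
    (σ : Fin N → SignType) (hσ : ∀ i, σ i ≠ 0) (t : Fin N → VV N (GG p k))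
    (ht : ∀ (j : Fin (d+1)) g, ∃ i, t i = ((Fin.castLE hN j, σ (Fin.castLE hN j)), g))
    (hs : ∀ j : Fin (d+1), σ (Fin.castLE hN j) = SignType.sign (y j)) : kap F (uu a ψ) (ee e ψ) t ≠ 0 := by
  classical
  choose T hT using ht
  let T' : GG p k × Fin (d+1) → Fin N := fun x => T x.2 x.1
  have hinj : Function.Injective T' := by
    rintro ⟨g, j⟩ ⟨g', j'⟩ hh
    have h1 := hT j g
    have h2 : t (T j' g') = _ := hT j' g'
    have hh' : T j g = T j' g' := hh
    rw [hh', h2] at h1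
    simp only [Prod.mk.injEq] at h1
    have := Fin.castLE_injective hN h1.1.1
    rw [this, h1.2]
  have hbij : Function.Bijective T' := (Fintype.bijective_iff_injective_and_card _).2 ⟨hinj, (Fintype.card_congr ψ).symm⟩
  let E := Equiv.ofBijective T' hbij
  have hE : ∀ x, t (E x) = ((Fin.castLE hN x.2, σ (Fin.castLE hN x.2)), x.1) := fun x => hT x.2 x.1
  have hli := Fintype.linearIndependent_iff.1 (h (Fin.castLE hN) (Fin.castLE_injective hN))
  have hdet : (Matrix.of (fun i => uu a ψ (t i))).det ≠ 0 := by
    have : LinearIndependent ℝ (fun i => uu a ψ (t i)) := by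
      rw [Fintype.linearIndependent_iff]
      intro c hc
      have h0 : ∀ x, c (E x) = 0 := by
        rintro ⟨g, j⟩
        have h1 := color_sum (e := 0) ψ t c (by rw [hc]; rfl) g
        have h2 : ∑ j, (c (E (g, j)) * (σ (Fin.castLE hN j) : ℝ)) • a (Fin.castLE hN j) = 0 := by
          rw [← h1, Finset.sum_filter, ← E.sum_comp, Fintype.sum_prod_type, Finset.sum_eq_single g]
          · refine Finset.sum_congr rfl fun j _ => ?_
            rw [hE, if_pos rfl]
          · intro g' _ hg'
            refine Finset.sum_eq_zero fun j _ => ?_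
            rw [hE, if_neg hg']
          · simp
        have h3 := hli _ h2 j
        rcases mul_eq_zero.1 h3 with h4 | h4
        · exact h4
        · exfalso
          have := hσ (Fin.castLE hN j)
          revert this h4
          generalize σ (Fin.castLE hN j) = s
          cases s <;> simp
      intro i
      have := h0 (E.symm i)
      rwa [Equiv.apply_symm_apply] at this
    have h1 : IsUnit (Matrix.of (fun i => uu a ψ (t i))) := Matrix.linearIndependent_rows_iff_isUnit.1 this
    exact ((Matrix.isUnit_iff_isUnit_det _).1 h1).ne_zero
  have hin : inC (uu a ψ) (ee e ψ) t := by
    refine ⟨fun i => |y (E.symm i).2|, fun i => abs_nonneg _, ?_⟩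
    rw [← E.sum_comp, Fintype.sum_prod_type]
    funext m
    simp only [Equiv.symm_apply_apply, hE, Finset.sum_apply, Pi.smul_apply, smul_eq_mul, ee, uu]
    rw [Finset.sum_eq_single (ψ m).1]
    · rw [← hye]
      simp only [Finset.sum_apply, Pi.smul_apply, smul_eq_mul, if_true]
      refine Finset.sum_congr rfl fun j _ => ?_
      rw [hs, ← mul_assoc, mul_comm |y j|, sign_mul_abs]
    · intro g _ hg
      refine Finset.sum_eq_zero fun j _ => ?_
      rw [if_neg (Ne.symm hg), mul_zero]
    · simp
  rw [kap, if_pos hin]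
  exact sg_ne (by simpa using hdet)

/-- the unique contributing tope -/
lemma exists_tope (h : GP1 a) (hN : d + 1 ≤ N) (s : Fin (d+1) → SignType) (hs : ∀ j, s j ≠ 0) :
    ∃ σ : Fin N → SignType, Fc a σ ∧ (∀ i, σ i ≠ 0) ∧ Fc a (trc σ d) ∧ (∀ j, σ (Fin.castLE hN j) = s j) ∧
      ∀ σ', Fc a (trc σ' d) → (∀ j, σ' (Fin.castLE hN j) = s j) → σ' = σ := by
  classical
  obtain ⟨l0, hl0⟩ := exists_val h hN (Z := Finset.univ.map (Fin.castLEEmb hN)) (by simp)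
    (fun i => if i.val < d then 0 else (s (Fin.last d) : ℝ))
  have hl1 : ∀ i : Fin N, i.val < d → l0 (a i) = 0 := by
    intro i hi
    rw [hl0 i (Finset.mem_map.2 ⟨⟨i.val, by omega⟩, by simp, by ext; simp⟩), if_pos hi]
  have hl2 : l0 (a (Fin.castLE hN (Fin.last d))) = (s (Fin.last d) : ℝ) := by
    rw [hl0 _ (Finset.mem_map.2 ⟨Fin.last d, by simp, by ext; simp⟩), if_neg (by simp)]
  have hsl : (s (Fin.last d) : ℝ) ≠ 0 := by
    have := hs (Fin.last d)
    revert this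
    generalize s (Fin.last d) = x
    cases x <;> simp
  have hsgn : SignType.sign (s (Fin.last d) : ℝ) = s (Fin.last d) := by
    generalize s (Fin.last d) = x
    cases x <;> simp
  let τ : Fin N → SignType := fun i => SignType.sign (l0 (a i))
  have hτ : Fc a τ := ⟨l0, by rintro rfl; exact hsl (by rw [← hl2]; simp), fun i => rfl⟩
  have hτ0 : ∀ i : Fin N, d ≤ i.val → τ i ≠ 0 := by
    intro i hi h0
    have h1 := Fc_zs h hτ
    have h2 : insert i (Finset.univ.map (Fin.castLEEmb (show d ≤ N by omega))) ⊆ zs τ := by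
      intro m hm
      rw [mem_zs]
      rcases Finset.mem_insert.1 hm with rfl | hm
      · exact h0
      · obtain ⟨m', -, rfl⟩ := Finset.mem_map.1 hm
        simp only [τ]
        rw [hl1 _ (by simp), sign_zero]
    have h3 := Finset.card_le_card h2
    rw [Finset.card_insert_of_notMem] at h3
    · simp at h3; omega
    · intro hm
      obtain ⟨m', -, hm'⟩ := Finset.mem_map.1 hm
      rw [← hm'] at hi
      simp at hi
      omega
  let σ : Fin N → SignType := fun i => if hi : i.val < d then s ⟨i.val, by omega⟩ else τ i
  have htr : trc σ d = τ := by
    funext i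
    by_cases hi : i.val < d
    · simp only [trc, hi, if_true, τ]
      rw [hl1 i hi, sign_zero]
    · simp [trc, hi, σ]
  have hσs : ∀ j, σ (Fin.castLE hN j) = s j := by
    intro j
    by_cases hj : j.val < d
    · simp [σ, hj]
    · have : j = Fin.last d := by ext; simp; omega
      subst this
      simp only [σ, τ]
      rw [dif_neg (by simp), hl2, hsgn]
  refine ⟨σ, ?_, ?_, htr ▸ hτ, hσs, ?_⟩
  · refine Fc_FP h hN _ _ hτ ?_
    intro i hi
    by_cases h1 : i.val < d
    · exact absurd (by simp only [τ]; rw [hl1 i h1, sign_zero]) hi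
    · simp [σ, h1]
  · intro i
    by_cases h1 : i.val < d
    · simp only [σ, h1, dif_pos]; exact hs _
    · simp only [σ, h1, dif_neg, not_false_eq_true]; exact hτ0 i (by omega)
  · rintro σ' ⟨l, -, hl⟩ hσ'
    have hld : SignType.sign (l (a (Fin.castLE hN (Fin.last d)))) = s (Fin.last d) := by
      rw [hl, ← hσ']; simp [trc]
    have heq : l = |l (a (Fin.castLE hN (Fin.last d)))| • l0 := by
      rw [← sub_eq_zero]
      refine eq_zero_of_vanish h (Z := Finset.univ.map (Fin.castLEEmb hN)) (by simp) ?_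
      intro z hz
      obtain ⟨j, -, rfl⟩ := Finset.mem_map.1 hz
      simp only [LinearMap.sub_apply, LinearMap.smul_apply, smul_eq_mul]
      by_cases hj : j.val < d
      · rw [hl1 _ (by simpa using hj)]
        have := hl (Fin.castLE hN j)
        simp only [trc, Fin.val_castLE, hj, if_true, sign_eq_zero_iff] at this
        rw [Fin.castLEEmb_apply, this]; simp
      · have : j = Fin.last d := by ext; simp; omega
        subst this
        rw [Fin.castLEEmb_apply, hl2, ← hld, mul_comm, sign_mul_abs, sub_self]
    have hpos : 0 < |l (a (Fin.castLE hN (Fin.last d)))| := by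
      rw [abs_pos]
      intro h0
      rw [h0, sign_zero] at hld
      exact hs _ hld.symm
    funext i
    by_cases h1 : i.val < d
    · have e1 := hσ' ⟨i.val, by omega⟩
      have e2 := hσs ⟨i.val, by omega⟩
      exact e1.trans e2.symm
    · have e1 := hl i
      rw [heq] at e1
      simp only [LinearMap.smul_apply, smul_eq_mul, trc, h1, if_false] at e1
      rw [sign_mul, sign_pos hpos, one_mul] at e1
      simp only [σ, h1, dif_neg, not_false_eq_true, τ]
      exact e1.symm

end Fl
end DT


namespace DT

section Mainc

variable {d N p k : ℕ} {a : Fin N → Fin (d+1) → ℝ} {e : Fin (d+1) → ℝ}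

lemma tot_ms (D p k : ℕ) (hp : 0 < p) : tot k (fun l => D * p ^ l * (p - 1)) + D = D * p ^ k := by
  obtain ⟨m, rfl⟩ : ∃ m, p = m + 1 := ⟨p - 1, by omega⟩
  simp only [Nat.add_sub_cancel]
  induction k with
  | zero => simp [tot]
  | succ k ih =>
    unfold tot at ih ⊢
    rw [Finset.sum_range_succ, pow_succ]
    nlinarith

lemma layers_all {σ : Fin N → SignType} (hσ : ∀ i, σ i ≠ 0) : layers σ = (List.finRange N).map (fun i => (i, σ i)) := by
  unfold layers
  rw [List.filter_eq_self.2]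
  intro i _
  simp [hσ]

lemma IL_flat (F : Type*) [Field F] [Fact p.Prime] (hN0 : 0 < N) (h : GP1 a) (hN : d + 1 ≤ N) (hNp : N = (d+1) * p ^ k) (ψ : Fin N ≃ GG p k × Fin (d+1))
    (y : Fin (d+1) → ℝ) (hy : ∀ j, y j ≠ 0) (hye : ∑ j, y j • a (Fin.castLE hN j) = e)
    (σ : Fin N → SignType) (hσ : ∀ i, σ i ≠ 0) :
    IL F (uu a ψ) (ee e ψ) ((flat p (ff N p k) k (vlist d p k hN0 σ d)).map (iv F)).prod ≠ 0 ↔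
      ∀ j, σ (Fin.castLE hN j) = SignType.sign (y j) := by
  have hlen : (flat p (ff N p k) k (vlist d p k hN0 σ d)).length = N := by
    rw [flat_length, vlist_length, hNp]
  obtain ⟨t, ht⟩ := exists_ofFn _ hlen
  have hmem : ∀ i, t i ∈ flat p (ff N p k) k (vlist d p k hN0 σ d) := by
    intro i; rw [ht]; exact (List.mem_ofFn' t _).2 ⟨i, rfl⟩
  rw [ht, IL_ofFn]
  constructor
  · refine kap_ne_imp F h hN ψ y hy hye σ hσ t ?_
    intro i
    obtain ⟨w, hw, hw'⟩ := flat_fst _ _ _ (hmem i)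
    obtain ⟨j, -, hj, rfl⟩ := (mem_vlist hN0 σ d le_rfl w).1 hw
    refine ⟨⟨j, by omega⟩, ?_⟩
    rw [hw', vt, dif_pos (by omega)]
    rfl
  · refine kap_ne_of F h hN ψ y hye σ hσ t ?_
    intro j g
    have : ((Fin.castLE hN j, σ (Fin.castLE hN j)), g) ∈ flat p (ff N p k) k (vlist d p k hN0 σ d) := by
      refine mem_flat _ _ _ ?_ g (by intro i hi; have := i.2; omega)
      rw [mem_vlist hN0 σ d le_rfl]
      refine ⟨j.val, by omega, by omega, ?_⟩
      rw [vt, dif_pos (by omega)]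
      rfl
    rw [ht] at this
    exact (List.mem_ofFn' t _).1 this

theorem main_comb [Fact p.Prime] (h : GP1 a) (h2 : GP2 a e) (hNp : N = (d+1) * p ^ k) :
    ∃ l : Du d, (∀ i, l (a i) ≠ 0) ∧ ∃ (x : Fin N → GG p k) (c : Fin N → ℝ), (∀ i, 0 ≤ c i) ∧
      (∀ g, ∑ i ∈ Finset.univ.filter (fun i => x i = g), (c i * (SignType.sign (l (a i)) : ℝ)) • a i = e) ∧
      ∀ g, d + 1 ≤ (Finset.univ.filter (fun i => x i = g ∧ c i ≠ 0)).card := by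
  classical
  have hp : p.Prime := Fact.out
  have hpk : 1 ≤ p ^ k := Nat.one_le_pow _ _ hp.pos
  have hN : d + 1 ≤ N := by rw [hNp]; nlinarith
  have hN0 : 0 < N := by omega
  obtain ⟨ψ⟩ : Nonempty (Fin N ≃ GG p k × Fin (d+1)) := by
    refine ⟨Fintype.equivOfCardEq ?_⟩
    simp [ZMod.card, hNp, mul_comm]
  obtain ⟨y, hy, hye⟩ := exists_coord h h2 hN
  obtain ⟨σ0, hF0, hσ0, hFd0, hs0, huniq⟩ := exists_tope h hN (fun j => SignType.sign (y j)) (by intro j; simpa using hy j)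
  obtain ⟨s, hs, hBB⟩ := BB_eval (ZMod p) (VV N (GG p k)) p (d+1) k
  have htot := tot_ms (d+1) p k hp.pos
  set n := tot k (fun l => (d+1) * p ^ l * (p - 1)) with hn
  have hnN : n + (d+1) = N := by omega
  have hnz : ∀ σ, Fc a σ → n + 1 ≤ nz σ := fun σ hσ => Fc_nz h hnN hσ
  have hvx : ∀ σ, Fc a σ → vx0 p k hN0 σ ∈ SS (GG p k) σ := by
    intro σ hσ
    have hne : ∃ i, σ i ≠ 0 := by
      by_contra hc
      push Not at hc
      have h3 := hnz σ hσ
      have h4 : nz σ = 0 := by simp [nz, hc]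
      omega
    obtain ⟨i, hi⟩ := hne
    exact ⟨rfl, mi_spec hN0 hi⟩
  have hterm : ∀ σ, nz σ = N → Fc a σ →
      (II (ZMod p) (uu a ψ) (ee e ψ) (BB (ZMod p) p (ff N p k) (fun l => (d+1) * p ^ l * (p - 1)) k
        (lam (ZMod p) (Fc a) n (fun σ => sg (ZMod p) (es a σ)) (vx0 p k hN0) σ)) ≠ 0 ↔ σ = σ0) := by
    intro σ h3 h4
    have hσ := nz_of_all.1 h3
    have hmem := lam_mem (F := ZMod p) (ε := fun σ => sg (ZMod p) (es a σ)) (vx0 p k hN0) (fun _ => Set.univ) (fun _ _ => subset_rfl)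
      (fun _ _ => Set.mem_univ _) hnz (nz σ) σ rfl h4
    obtain ⟨w, hw, hw'⟩ := q_lam (p := p) (k := k) (ZMod p) hN0 h hnN σ hσ d le_rfl (by simpa [trc_zero] using h4)
    rw [Nat.sub_self, trc_zero] at hw
    rw [II, LinearMap.comp_apply, hBB _ ff_p, hw, map_smul, map_smul, PsiK_prod, map_smul, smul_ne_zero_iff, smul_ne_zero_iff, hw',
      IL_flat (ZMod p) hN0 h hN hNp ψ y hy hye σ hσ]
    · constructor
      · rintro ⟨-, h5, h6⟩
        exact huniq σ h5 h6
      · rintro rfl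
        exact ⟨hs, hFd0, hs0⟩
    · refine Finsupp.supported_mono ?_ hmem
      rintro l ⟨hl, -⟩
      show l.length = d + 1
      rw [hl]; omega
  have hmain := top_main (F := ZMod p) (G := GG p k) p (Fc_FP h hN) n k (ff N p k) ff_p ff_comm (fun _ _ => rfl) hnz _ (es_EpsC h hnN) (vx0 p k hN0) hvx
    (II (ZMod p) (uu a ψ) (ee e ψ)) (fun l x => II_act _ _ _ _ (fun t => kap_ff _ ψ l t) x)
    (fun σ hσ _ x hx => II_I2 _ h2 ψ σ hσ x hx) (fun l => (d+1) * p ^ l * (p - 1)) hn.symm (by omega)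
  rcases hmain with ⟨σ, hσF, hσN, l, ⟨hl1, hl2⟩, hI⟩ | hzero
  · have hσ := nz_of_all.1 hσN
    obtain ⟨t, rfl⟩ := exists_ofFn l hl2
    have h3 := hl1.eq_of_length (by rw [List.length_map, hl2, layers_length, hσN])
    rw [layers_all hσ, List.map_ofFn, ← List.ofFn_eq_map] at h3
    have h4 := List.ofFn_injective h3
    have h5 : ∀ i, (t i).1 = (i, σ i) := fun i => congrFun h4 i
    rw [II_ofFn] at hI
    have hin : inC (uu a ψ) (ee e ψ) t := by
      by_contra hc
      exact hI (by rw [kap, if_neg hc])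
    obtain ⟨c, hc, hce⟩ := hin
    obtain ⟨ℓ, -, hℓ⟩ := hσF
    refine ⟨ℓ, ?_, fun i => (t i).2, c, hc, ?_, ?_⟩
    · intro i hi
      have := hℓ i
      rw [hi, sign_zero] at this
      exact hσ i this.symm
    · intro g
      rw [← color_sum ψ t c hce g]
      refine Finset.sum_congr rfl fun i _ => ?_
      rw [h5, hℓ]
    · intro g
      exact color_card h2 ψ t c hce g
  · exfalso
    rw [Finset.sum_eq_single σ0] at hzero
    · rw [if_pos ⟨nz_of_all.2 hσ0, hF0⟩] at hzero
      exact (hterm σ0 (nz_of_all.2 hσ0) hF0).2 rfl hzero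
    · intro σ _ hne
      split_ifs with hh
      · by_contra hcon
        exact hne ((hterm σ hh.1 hh.2).1 hcon)
      · rfl
    · simp

end Mainc
end DT


namespace DT

section Fin14

lemma solve_li {d : ℕ} (w : Fin d → Fin d → ℝ) (h : LinearIndependent ℝ w) (b : Fin d → ℝ) :
    ∃ x : Fin d → ℝ, ∀ m, w m ⬝ᵥ x = b m := by
  have h1 : IsUnit (Matrix.of w) := Matrix.linearIndependent_rows_iff_isUnit.1 h
  have h2 := (Matrix.isUnit_iff_isUnit_det _).1 h1
  refine ⟨(Matrix.of w)⁻¹.mulVec b, fun m => ?_⟩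
  have : (Matrix.of w).mulVec ((Matrix.of w)⁻¹.mulVec b) = b := by
    rw [Matrix.mulVec_mulVec, Matrix.mul_nonsing_inv _ h2, Matrix.one_mulVec]
  exact congrFun this m

lemma uniq_li {d : ℕ} (w : Fin d → Fin d → ℝ) (h : LinearIndependent ℝ w) (x x' : Fin d → ℝ)
    (hx : ∀ m, w m ⬝ᵥ x = w m ⬝ᵥ x') : x = x' := by
  have h1 : IsUnit (Matrix.of w) := Matrix.linearIndependent_rows_iff_isUnit.1 h
  exact Matrix.mulVec_injective_of_isUnit h1 (funext hx)

lemma block_geom {d : ℕ} (v : Fin (d+1) → Fin d → ℝ) (c : Fin (d+1) → ℝ)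
    (hli : ∀ k : Fin (d+1), LinearIndependent ℝ (fun m => v (k.succAbove m)))
    (μ : Fin (d+1) → ℝ) (hv : ∑ i, μ i • v i = 0) (hc : ∑ i, μ i * c i = 1)
    (P : Fin d → ℝ) (hP : ∀ i, 0 ≤ μ i * (c i - v i ⬝ᵥ P)) : P ∈ inducedSimplex d v c := by
  have hsum : ∀ x, ∑ i, μ i * (c i - v i ⬝ᵥ x) = 1 := by
    intro x
    have : ∑ i, μ i * (v i ⬝ᵥ x) = 0 := by
      have h1 : (∑ i, μ i • v i) ⬝ᵥ x = 0 := by rw [hv, zero_dotProduct]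
      rw [sum_dotProduct] at h1
      simpa [smul_dotProduct] using h1
    simp only [mul_sub, Finset.sum_sub_distrib]
    rw [hc, this, sub_zero]
  choose V hV using fun k : Fin (d+1) => solve_li _ (hli k) (fun m => c (k.succAbove m))
  have hV' : ∀ k i, i ≠ k → v i ⬝ᵥ V k = c i := by
    intro k i hik
    obtain ⟨m, rfl⟩ := Fin.exists_succAbove_eq hik
    exact hV k m
  have hVk : ∀ k, μ k * (c k - v k ⬝ᵥ V k) = 1 := by
    intro k
    rw [← hsum (V k)]
    symm
    apply Finset.sum_eq_single
    · intro i _ hik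
      rw [hV' k i hik, sub_self, mul_zero]
    · simp
  have hPeq : P = ∑ k, (μ k * (c k - v k ⬝ᵥ P)) • V k := by
    have key : ∀ i, v i ⬝ᵥ P = v i ⬝ᵥ (∑ k, (μ k * (c k - v k ⬝ᵥ P)) • V k) := by
      intro i
      rw [dotProduct_sum]
      simp only [dotProduct_smul, smul_eq_mul]
      have h2 := hsum P
      have h3 : ∑ k, μ k * (c k - v k ⬝ᵥ P) * (c i - v i ⬝ᵥ V k) = c i - ∑ k, μ k * (c k - v k ⬝ᵥ P) * (v i ⬝ᵥ V k) := by
        simp only [mul_sub (_ * _) (c i), Finset.sum_sub_distrib]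
        rw [← Finset.sum_mul, h2, one_mul]
      have h4 : ∑ k, μ k * (c k - v k ⬝ᵥ P) * (c i - v i ⬝ᵥ V k) = c i - v i ⬝ᵥ P := by
        rw [Finset.sum_eq_single i]
        · have := hVk i
          linear_combination (c i - v i ⬝ᵥ P) * this
        · intro k _ hk
          rw [hV' k i hk.symm, sub_self, mul_zero]
        · simp
      linarith
    exact uniq_li _ (hli 0) _ _ (fun m => key _)
  rw [hPeq]
  refine (convex_convexHull ℝ _).sum_mem (fun i _ => hP i) (hsum P) ?_
  intro k _
  refine subset_convexHull ℝ _ ⟨k, fun i hi => ?_⟩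
  exact hV' k i hi

variable {d N : ℕ} (v : Fin N → Fin d → ℝ) (c : Fin N → ℝ)

def lft (i : Fin N) : Fin (d+1) → ℝ := Fin.cons (c i) (v i)

def e0 (d : ℕ) : Fin (d+1) → ℝ := Fin.cons 1 0

lemma sum_lft {ι : Type*} (s : Finset ι) (μ : ι → ℝ) (g : ι → Fin N) (b : ℝ) (w : Fin d → ℝ) :
    ∑ i ∈ s, μ i • lft v c (g i) = (Fin.cons b w : Fin (d+1) → ℝ) ↔ ∑ i ∈ s, μ i * c (g i) = b ∧ ∑ i ∈ s, μ i • v (g i) = w := by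
  constructor
  · intro h
    constructor
    · have := congrFun h 0
      simpa [lft] using this
    · funext m
      have := congrFun h m.succ
      simpa [lft] using this
  · rintro ⟨h1, h2⟩
    funext m
    refine Fin.cases ?_ (fun m => ?_) m
    · simpa [lft] using h1
    · have := congrFun h2 m
      simpa [lft] using this

lemma gp1_of (h : InGeneralPosition d v c) : GP1 (lft v c) := by
  intro g hg
  rw [Fintype.linearIndependent_iff]
  intro μ hμ k
  by_contra hk
  have hz : (0 : Fin (d+1) → ℝ) = Fin.cons 0 0 := by
    funext m; refine Fin.cases ?_ (fun m => ?_) m <;> simp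
  rw [hz, sum_lft] at hμ
  obtain ⟨h1, h2⟩ := hμ
  obtain ⟨x, hx⟩ := solve_li _ (h.1 (fun m => g (k.succAbove m)) (hg.comp Fin.succAbove_right_injective)) (fun m => c (g (k.succAbove m)))
  have hx' : ∀ i, i ≠ k → v (g i) ⬝ᵥ x = c (g i) := by
    intro i hik
    obtain ⟨m, rfl⟩ := Fin.exists_succAbove_eq hik
    exact hx m
  have h3 : ∑ i, μ i * (v (g i) ⬝ᵥ x) = 0 := by
    have h1 : (∑ i, μ i • v (g i)) ⬝ᵥ x = 0 := by rw [h2, zero_dotProduct]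
    rw [sum_dotProduct] at h1
    simpa [smul_dotProduct] using h1
  have h4 : ∑ i, μ i * (c (g i) - v (g i) ⬝ᵥ x) = 0 := by
    simp only [mul_sub, Finset.sum_sub_distrib]
    rw [h1, h3, sub_zero]
  rw [Finset.sum_eq_single k] at h4
  · refine h.2 g hg ⟨x, fun m => ?_⟩
    show v (g m) ⬝ᵥ x = c (g m)
    by_cases hm : m = k
    · subst hm
      rcases mul_eq_zero.1 h4 with h5 | h5
      · exact absurd h5 hk
      · linarith
    · exact hx' m hm
  · intro i _ hi
    rw [hx' i hi, sub_self, mul_zero]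
  · simp

lemma gp2_of (h : InGeneralPosition d v c) (hN : d ≤ N) : GP2 (lft v c) (e0 d) := by
  intro s hs hmem
  obtain ⟨Z, hsZ, hZ⟩ := Finset.exists_superset_card_eq hs (by simpa using hN)
  have h1 : e0 d ∈ Submodule.span ℝ (Set.range (fun m => lft v c (Z.orderEmbOfFin hZ m))) := by
    refine Submodule.span_mono ?_ hmem
    rintro _ ⟨i, hi, rfl⟩
    have : i ∈ Set.range (Z.orderEmbOfFin hZ) := by
      rw [Finset.range_orderEmbOfFin]; exact hsZ hi
    obtain ⟨m, rfl⟩ := this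
    exact ⟨m, rfl⟩
  obtain ⟨μ, hμ⟩ := (Submodule.mem_span_range_iff_exists_fun ℝ).1 h1
  rw [e0, sum_lft] at hμ
  have h2 := Fintype.linearIndependent_iff.1 (h.1 _ (Z.orderEmbOfFin hZ).injective) μ hμ.2
  have h3 := hμ.1
  simp [h2] at h3

lemma dual_lft (l : Du d) (i : Fin N) :
    l (lft v c i) = c i * l (e0 d) + v i ⬝ᵥ (fun m => l (Pi.single m.succ 1)) := by
  have h1 : lft v c i = c i • e0 d + ∑ m, v i m • (Pi.single m.succ 1 : Fin (d+1) → ℝ) := by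
    funext j
    refine Fin.cases ?_ (fun j => ?_) j
    · simp [lft, e0, Pi.single_apply, Fin.succ_ne_zero, (Fin.succ_ne_zero _).symm]
    · simp [lft, e0, Pi.single_apply]
  rw [h1, map_add, map_smul, map_sum]
  simp [dotProduct]

lemma exists_phi {r D p k : ℕ} [Fact p.Prime] (hr : r = p ^ k) (x : Fin (r * D) → GG p k)
    (hx : ∀ g, (Finset.univ.filter (fun i => x i = g)).card = D) :
    ∃ (φ : Fin (r * D) ≃ Fin r × Fin D) (γ : Fin r ≃ GG p k), ∀ i, x i = γ (φ i).1 := by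
  classical
  have γ : Fin r ≃ GG p k := Fintype.equivOfCardEq (by simp [ZMod.card, hr])
  have hc : ∀ g, Fintype.card {i // x i = g} = D := by
    intro g; rw [Fintype.card_subtype, hx]
  let φ1 : Fin (r * D) ≃ GG p k × Fin D := (Equiv.sigmaFiberEquiv x).symm.trans
    ((Equiv.sigmaCongrRight (fun g => Fintype.equivFinOfCardEq (hc g))).trans (Equiv.sigmaEquivProd _ _))
  refine ⟨φ1.trans (γ.symm.prodCongr (Equiv.refl _)), γ, fun i => ?_⟩
  have : (φ1 i).1 = x i := rfl
  simp [this]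

theorem final (d r : ℕ) (hr : IsPrimePow r)
    (v : Fin (r * (d + 1)) → Fin d → ℝ) (c : Fin (r * (d + 1)) → ℝ)
    (hgp : InGeneralPosition d v c) :
    ∃ (φ : Fin (r * (d + 1)) ≃ Fin r × Fin (d + 1)) (p : Fin d → ℝ),
      ∀ j : Fin r,
        p ∈ inducedSimplex d (fun i => v (φ.symm (j, i))) (fun i => c (φ.symm (j, i))) := by
  classical
  obtain ⟨p, k, hp, hk, hpk⟩ := hr
  haveI : Fact p.Prime := ⟨hp.nat_prime⟩
  have hr1 : 1 ≤ r := by rw [← hpk]; exact Nat.one_le_pow _ _ hp.nat_prime.pos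
  have hN : d + 1 ≤ r * (d+1) := by nlinarith
  obtain ⟨l, hl, x, cc, hcc, hsum, hcard⟩ := main_comb (p := p) (k := k) (gp1_of v c hgp) (gp2_of v c hgp (by omega)) (by rw [hpk, mul_comm])
  have hle : ∀ g, d + 1 ≤ (Finset.univ.filter (fun i => x i = g)).card := fun g => (hcard g).trans
    (Finset.card_le_card (fun i hi => by simp only [Finset.mem_filter, Finset.mem_univ, true_and] at hi ⊢; exact hi.1))
  have htot : ∑ g : GG p k, (d+1) = ∑ g : GG p k, (Finset.univ.filter (fun i => x i = g)).card := by
    rw [← Finset.card_eq_sum_card_fiberwise (f := x) (by intro x _; simp)]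
    simp [ZMod.card, hpk]
  have hx : ∀ g, (Finset.univ.filter (fun i => x i = g)).card = d + 1 := fun g =>
    ((Finset.sum_eq_sum_iff_of_le (fun g _ => hle g)).1 htot g (Finset.mem_univ _)).symm
  obtain ⟨φ, γ, hφ⟩ := exists_phi hpk.symm x hx
  have hblock : ∀ j : Fin r, ∑ i : Fin (d+1), (cc (φ.symm (j, i)) * (SignType.sign (l (lft v c (φ.symm (j, i)))) : ℝ)) • lft v c (φ.symm (j, i)) = e0 d := by
    intro j
    rw [← hsum (γ j), Finset.sum_filter, ← φ.symm.sum_comp, Fintype.sum_prod_type, Finset.sum_eq_single j]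
    · refine Finset.sum_congr rfl fun i _ => ?_
      rw [hφ, Equiv.apply_symm_apply, if_pos rfl]
    · intro j' _ hj'
      refine Finset.sum_eq_zero fun i _ => ?_
      rw [hφ, Equiv.apply_symm_apply, if_neg (fun hh => hj' (γ.injective hh))]
    · simp
  have hle0 : 0 ≤ l (e0 d) := by
    rw [← hblock ⟨0, hr1⟩, map_sum]
    refine Finset.sum_nonneg fun i _ => ?_
    rw [map_smul, smul_eq_mul, mul_assoc, sign_mul_self]
    exact mul_nonneg (hcc _) (abs_nonneg _)
  have hlne : l (e0 d) ≠ 0 := by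
    intro h0
    rw [← hblock ⟨0, hr1⟩, map_sum, Finset.sum_eq_zero_iff_of_nonneg] at h0
    · have hz : ∀ i, cc (φ.symm (⟨0, hr1⟩, i)) = 0 := by
        intro i
        have := h0 i (Finset.mem_univ _)
        rw [map_smul, smul_eq_mul, mul_assoc, sign_mul_self] at this
        rcases mul_eq_zero.1 this with h | h
        · exact h
        · exact absurd (abs_eq_zero.1 h) (hl _)
      have := hblock ⟨0, hr1⟩
      simp only [hz, zero_mul, zero_smul, Finset.sum_const_zero] at this
      have := congrFun this 0
      simp [e0] at this
    · intro i _
      rw [map_smul, smul_eq_mul, mul_assoc, sign_mul_self]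
      exact mul_nonneg (hcc _) (abs_nonneg _)
  have hpos : 0 < l (e0 d) := lt_of_le_of_ne hle0 hlne.symm
  refine ⟨φ, (-(l (e0 d))⁻¹) • (fun m => l (Pi.single m.succ 1)), fun j => ?_⟩
  have hb := hblock j
  rw [e0, sum_lft] at hb
  refine block_geom _ _ ?_ (fun i => cc (φ.symm (j, i)) * (SignType.sign (l (lft v c (φ.symm (j, i)))) : ℝ)) hb.2 hb.1 _ ?_
  · intro k'
    refine hgp.1 (fun m => φ.symm (j, k'.succAbove m)) ?_
    intro m m' hm
    have := φ.symm.injective hm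
    simp only [Prod.mk.injEq, true_and] at this
    exact Fin.succAbove_right_injective this
  · intro i
    have h1 := dual_lft v c l (φ.symm (j, i))
    have h2 : c (φ.symm (j, i)) - v (φ.symm (j, i)) ⬝ᵥ ((-(l (e0 d))⁻¹) • (fun m => l (Pi.single m.succ 1))) = (l (e0 d))⁻¹ * l (lft v c (φ.symm (j, i))) := by
      rw [h1, dotProduct_smul, smul_eq_mul]
      field_simp
      ring
    rw [h2]
    have h3 : cc (φ.symm (j, i)) * (SignType.sign (l (lft v c (φ.symm (j, i)))) : ℝ) * ((l (e0 d))⁻¹ * l (lft v c (φ.symm (j, i)))) =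
        cc (φ.symm (j, i)) * (l (e0 d))⁻¹ * |l (lft v c (φ.symm (j, i)))| := by
      rw [← sign_mul_self]; ring
    rw [h3]
    exact mul_nonneg (mul_nonneg (hcc _) (inv_nonneg.2 hle0)) (abs_nonneg _)

end Fin14
end DT

/-- Karasev's theorem: for `d ≥ 1` and `r` a prime power, every family of `r(d+1)`
hyperplanes in `ℝ^d` in general position can be partitioned into `r` subfamilies of
`d+1` hyperplanes each whose induced simplices have a common point. -/
theorem stmt6 (d r : ℕ) (hd : 1 ≤ d) (hr : IsPrimePow r)
    (v : Fin (r * (d + 1)) → Fin d → ℝ) (c : Fin (r * (d + 1)) → ℝ)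
    (hv : ∀ m, v m ≠ 0)
    (hgp : InGeneralPosition d v c) :
    ∃ (φ : Fin (r * (d + 1)) ≃ Fin r × Fin (d + 1)) (p : Fin d → ℝ),
      ∀ j : Fin r,
        p ∈ inducedSimplex d (fun i => v (φ.symm (j, i))) (fun i => c (φ.symm (j, i))) := by
  exact DT.final d r hr v c hgp
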